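/- For every F ∈ BMOA there exist a function G ∈ QA and an analytic function H on 𝔻 with H ∈ ℍ^q for every 0 < q < ∞ and 1/H ∈ ℍ^∞, such that F'(z) = G'(z) H(z) for all z ∈ 𝔻. -/

import Mathlib

open MeasureTheory Filter Set Topology

noncomputable section

/-- The open unit disc in `ℂ`. -/
def unitDisc : Set ℂ := {z : ℂ | ‖z‖ < 1}

/-- The point `e^{iθ}` on the unit circle. -/
def circlePt (θ : ℝ) : ℂ := Complex.exp ((θ : ℂ) * Complex.I)

/-- The Carleson square based on the arc centered at `e^{iθ₀}` of normalized length `t`. -/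
def carlesonSquare (θ₀ t : ℝ) : Set ℂ :=
  {z : ℂ | z ∈ unitDisc ∧ 1 - t ≤ ‖z‖ ∧
    ∃ θ : ℝ, |θ - θ₀| ≤ Real.pi * t ∧ z = (‖z‖ : ℂ) * circlePt θ}

/-- `μ` is a Carleson measure. -/
def IsCarleson (μ : Measure ℂ) : Prop :=
  ∃ C : ℝ, 0 < C ∧ ∀ θ₀ t : ℝ, 0 < t → t ≤ 1 →
    μ (carlesonSquare θ₀ t) ≤ ENNReal.ofReal (C * t)

/-- `μ` is a vanishing Carleson measure. -/
def IsVanishingCarleson (μ : Measure ℂ) : Prop :=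
  IsCarleson μ ∧ ∀ ε : ℝ, 0 < ε → ∃ δ : ℝ, 0 < δ ∧ ∀ θ₀ t : ℝ, 0 < t → t < δ →
    μ (carlesonSquare θ₀ t) ≤ ENNReal.ofReal (ε * t)

/-- The measure `|E| μ`, i.e. `d(|E|μ)(z) = |E(z)| dμ(z)`. -/
def absDensity (E : ℂ → ℂ) (μ : Measure ℂ) : Measure ℂ :=
  μ.withDensity (fun z => ENNReal.ofReal ‖E z‖)

/-- Average of a boundary function (in the angle variable) over the arc
centered at `e^{iθ₀}` of normalized length `t`; `dm = dθ/(2π)`. -/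
def arcAvg (f : ℝ → ℂ) (θ₀ t : ℝ) : ℂ :=
  ((2 * Real.pi * t)⁻¹ : ℝ) •
    ∫ θ in Set.Ioo (θ₀ - Real.pi * t) (θ₀ + Real.pi * t), f θ

/-- Mean oscillation of a boundary function over the arc centered at `e^{iθ₀}`
of normalized length `t`. -/
def meanOsc (f : ℝ → ℂ) (θ₀ t : ℝ) : ℝ :=
  (2 * Real.pi * t)⁻¹ *
    ∫ θ in Set.Ioo (θ₀ - Real.pi * t) (θ₀ + Real.pi * t), ‖f θ - arcAvg f θ₀ t‖

/-- A (2π-periodic, integrable) boundary function has bounded mean oscillation. -/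
def IsBMO (f : ℝ → ℂ) : Prop :=
  (∀ θ : ℝ, f (θ + 2 * Real.pi) = f θ) ∧
  IntegrableOn f (Set.Ioc 0 (2 * Real.pi)) ∧
  ∃ C : ℝ, ∀ θ₀ t : ℝ, 0 < t → t ≤ 1 → meanOsc f θ₀ t ≤ C

/-- A boundary function has vanishing mean oscillation. -/
def IsVMO (f : ℝ → ℂ) : Prop :=
  IsBMO f ∧ ∀ ε : ℝ, 0 < ε → ∃ δ : ℝ, 0 < δ ∧
    ∀ θ₀ t : ℝ, 0 < t → t < δ → meanOsc f θ₀ t ≤ ε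

/-- The BMO seminorm of a boundary function. -/
def bmoSeminorm (f : ℝ → ℂ) : ℝ :=
  sSup {c : ℝ | ∃ θ₀ t : ℝ, 0 < t ∧ t ≤ 1 ∧ c = meanOsc f θ₀ t}

/-- `Fb` is the (a.e.) radial boundary function of `F`. -/
def HasRadialLimits (F : ℂ → ℂ) (Fb : ℝ → ℂ) : Prop :=
  ∀ᵐ θ ∂(volume.restrict (Set.Ioc 0 (2 * Real.pi))),
    Tendsto (fun r : ℝ => F ((r : ℂ) * circlePt θ))
      (nhdsWithin 1 (Set.Iio 1)) (nhds (Fb θ))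

/-- `F` is a bounded analytic function on the unit disc. -/
def MemHinf (F : ℂ → ℂ) : Prop :=
  DifferentiableOn ℂ F unitDisc ∧ ∃ M : ℝ, ∀ z ∈ unitDisc, ‖F z‖ ≤ M

/-- `F` belongs to `QA` with boundary function `Fb`: it is a bounded analytic
function on the disc whose radial boundary values are in VMO. -/
def MemQA (F : ℂ → ℂ) (Fb : ℝ → ℂ) : Prop :=
  MemHinf F ∧ HasRadialLimits F Fb ∧ IsVMO Fb

/-- `E` is an outer function. -/
def IsOuter (E : ℂ → ℂ) : Prop :=
  DifferentiableOn ℂ E unitDisc ∧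
  ∃ h : ℝ → ℝ, IntegrableOn h (Set.Ioc 0 (2 * Real.pi)) ∧ ∀ z ∈ unitDisc,
    E z = Complex.exp (((2 * Real.pi)⁻¹ : ℝ) • ∫ θ in Set.Ioc 0 (2 * Real.pi),
      ((circlePt θ + z) / (circlePt θ - z)) * (h θ : ℂ))

/-- The integral means appearing in the definition of the Hardy space `ℍ^p`. -/
def hardyIntegral (p : ℝ) (F : ℂ → ℂ) (r : ℝ) : ℝ :=
  ∫ θ in Set.Ioc 0 (2 * Real.pi), ‖F ((r : ℂ) * circlePt θ)‖ ^ p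

/-- `F` belongs to the Hardy space `ℍ^p`, `0 < p < ∞`. -/
def MemHardy (p : ℝ) (F : ℂ → ℂ) : Prop :=
  DifferentiableOn ℂ F unitDisc ∧
  ∃ M : ℝ, ∀ r : ℝ, 0 < r → r < 1 → hardyIntegral p F r ≤ M

/-- `F` belongs to `BMOA` with boundary function `Fb`. -/
def MemBMOA (F : ℂ → ℂ) (Fb : ℝ → ℂ) : Prop :=
  MemHardy 2 F ∧ HasRadialLimits F Fb ∧ IsBMO Fb

/-- `F` belongs to `VMOA` with boundary function `Fb`. -/
def MemVMOA (F : ℂ → ℂ) (Fb : ℝ → ℂ) : Prop :=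
  MemHardy 2 F ∧ HasRadialLimits F Fb ∧ IsVMO Fb

/-- The generalized Volterra operator `T_G(F)(z) = ∫₀^z F(w) G'(w) dw`. -/
def volterra (G F : ℂ → ℂ) (z : ℂ) : ℂ :=
  ∫ t in (0:ℝ)..1, z * F ((t : ℂ) * z) * deriv G ((t : ℂ) * z)

/-- Second order Taylor expansion with little-o remainder. -/
theorem second_order_expansion {𝕜 : Type*} [RCLike 𝕜] {φ φ' : 𝕜 → 𝕜} {y c : 𝕜}
    (h1 : ∀ᶠ x in 𝓝 y, HasDerivAt φ (φ' x) x) (h2 : HasDerivAt φ' c y) :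
    (fun t => φ (y + t) - φ y - φ' y * t - c / 2 * t ^ 2) =o[𝓝 0] (fun t => ‖t‖ ^ 2) := by
  rw [Asymptotics.isLittleO_iff]
  intro ε hε
  have h3 := (hasDerivAt_iff_isLittleO_nhds_zero.1 h2)
  rw [Asymptotics.isLittleO_iff] at h3
  have h3 := h3 hε
  have h1' : ∀ᶠ t in 𝓝 (0 : 𝕜), HasDerivAt φ (φ' (y + t)) (y + t) := by
    have : Tendsto (fun t => y + t) (𝓝 (0 : 𝕜)) (𝓝 y) := by
      have : Continuous (fun t : 𝕜 => y + t) := by fun_prop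
      simpa using this.tendsto 0
    exact this.eventually h1
  obtain ⟨δ, hδ, hb⟩ := Metric.eventually_nhds_iff_ball.1 (h3.and h1')
  refine Metric.eventually_nhds_iff_ball.2 ⟨δ, hδ, fun t ht => ?_⟩
  have hder : ∀ s ∈ Metric.closedBall (0 : 𝕜) ‖t‖,
      HasDerivWithinAt (fun t => φ (y + t) - φ y - φ' y * t - c / 2 * t ^ 2)
        (φ' (y + s) - φ' y - s * c) (Metric.closedBall (0 : 𝕜) ‖t‖) s := by
    intro s hs
    have hs' : s ∈ Metric.ball (0 : 𝕜) δ := by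
      simp only [Metric.mem_closedBall, Metric.mem_ball, dist_zero_right] at *
      linarith
    have e1 : HasDerivAt (fun t => φ (y + t)) (φ' (y + s)) s := (hb s hs').2.comp_const_add y s
    have e2 : HasDerivAt (fun t : 𝕜 => φ' y * t) (φ' y) s := by
      simpa using (hasDerivAt_id s).const_mul (φ' y)
    have e3 : HasDerivAt (fun t : 𝕜 => c / 2 * t ^ 2) (s * c) s := by
      have := (hasDerivAt_pow 2 s).const_mul (c / 2)
      refine this.congr_deriv ?_
      push_cast
      simp only [pow_one]
      ring
    exact (((e1.sub_const (φ y)).sub e2).sub e3).hasDerivWithinAt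
  have hbd : ∀ s ∈ Metric.closedBall (0 : 𝕜) ‖t‖, ‖φ' (y + s) - φ' y - s * c‖ ≤ ε * ‖t‖ := by
    intro s hs
    have hs' : s ∈ Metric.ball (0 : 𝕜) δ := by
      simp only [Metric.mem_closedBall, Metric.mem_ball, dist_zero_right] at *
      linarith
    have := (hb s hs').1
    simp only [smul_eq_mul] at this
    refine this.trans ?_
    simp only [Metric.mem_closedBall, dist_zero_right] at hs
    gcongr
  have := Convex.norm_image_sub_le_of_norm_hasDerivWithin_le hder hbd
    (convex_closedBall (0 : 𝕜) ‖t‖) (x := 0) (y := t) (by simp) (by simp)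
  simp only [add_zero, sub_self, mul_zero, ne_eq, OfNat.ofNat_ne_zero, not_false_eq_true, zero_pow,
    sub_zero] at this
  rw [norm_pow, norm_norm]
  linarith

/-- `f` has at `z` a second order expansion with complex gradient `a` and with `l` a quarter of
the Laplacian. -/
def HasJet (f : ℂ → ℝ) (z a : ℂ) (l : ℝ) : Prop :=
  ∃ b : ℂ, (fun w => f (z + w) - f z - (a * w).re - (b * w ^ 2).re - l * ‖w‖ ^ 2)
    =o[𝓝 0] (fun w => ‖w‖ ^ 2)

theorem HasJet.congr_data {f : ℂ → ℝ} {z a a' : ℂ} {l l' : ℝ} (h : HasJet f z a l)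
    (ha : a = a') (hl : l = l') : HasJet f z a' l' := by subst ha hl; exact h

theorem HasJet.congr_eventually {f g : ℂ → ℝ} {z a : ℂ} {l : ℝ} (h : HasJet f z a l)
    (hfg : f =ᶠ[𝓝 z] g) : HasJet g z a l := by
  obtain ⟨b, hb⟩ := h
  refine ⟨b, hb.congr' ?_ EventuallyEq.rfl⟩
  have : Tendsto (fun t => z + t) (𝓝 (0 : ℂ)) (𝓝 z) := by
    have : Continuous (fun t : ℂ => z + t) := by fun_prop
    simpa using this.tendsto 0
  filter_upwards [this.eventually hfg] with w hw
  rw [hw, hfg.eq_of_nhds]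

theorem hasJet_const (c : ℝ) (z : ℂ) : HasJet (fun _ => c) z 0 0 :=
  ⟨0, by simp⟩

theorem HasJet.add {f g : ℂ → ℝ} {z a a' : ℂ} {l l' : ℝ} (hf : HasJet f z a l)
    (hg : HasJet g z a' l') : HasJet (fun w => f w + g w) z (a + a') (l + l') := by
  obtain ⟨b, hb⟩ := hf
  obtain ⟨b', hb'⟩ := hg
  refine ⟨b + b', (hb.add hb').congr_left fun w => ?_⟩
  simp only [add_mul, Complex.add_re]
  ring

theorem HasJet.const_mul {f : ℂ → ℝ} {z a : ℂ} {l : ℝ} (c : ℝ) (hf : HasJet f z a l) :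
    HasJet (fun w => c * f w) z (c * a) (c * l) := by
  obtain ⟨b, hb⟩ := hf
  refine ⟨c * b, (hb.const_mul_left c).congr_left fun w => ?_⟩
  simp only [mul_assoc, Complex.re_ofReal_mul]
  ring

theorem HasJet.neg {f : ℂ → ℝ} {z a : ℂ} {l : ℝ} (hf : HasJet f z a l) :
    HasJet (fun w => - f w) z (-a) (-l) := by
  simpa using hf.const_mul (-1)

theorem HasJet.sub {f g : ℂ → ℝ} {z a a' : ℂ} {l l' : ℝ} (hf : HasJet f z a l)
    (hg : HasJet g z a' l') : HasJet (fun w => f w - g w) z (a - a') (l - l') := by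
  simpa [sub_eq_add_neg] using hf.add hg.neg

theorem sq_isLittleO_id : (fun w : ℂ => ‖w‖ ^ 2) =o[𝓝 0] (fun w : ℂ => ‖w‖) := by
  rw [Asymptotics.isLittleO_iff]
  intro ε hε
  filter_upwards [Metric.ball_mem_nhds (0 : ℂ) hε] with w hw
  simp only [Metric.mem_ball, dist_zero_right] at hw
  rw [norm_pow, norm_norm, pow_two]
  exact mul_le_mul_of_nonneg_right hw.le (norm_nonneg w)

/-- The increment of a function with a jet is its linear part up to `O(|w|^2)`. -/
theorem HasJet.isBigO_sub {f : ℂ → ℝ} {z a : ℂ} {l : ℝ} (hf : HasJet f z a l) :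
    (fun w => f (z + w) - f z - (a * w).re) =O[𝓝 0] (fun w => ‖w‖ ^ 2) := by
  obtain ⟨b, hb⟩ := hf
  have h1 : (fun w : ℂ => (b * w ^ 2).re) =O[𝓝 0] (fun w => ‖w‖ ^ 2) := by
    refine Asymptotics.IsBigO.of_bound ‖b‖ (Eventually.of_forall fun w => ?_)
    rw [Real.norm_eq_abs, norm_pow, norm_norm, ← norm_pow, ← norm_mul]
    exact Complex.abs_re_le_norm _
  have h2 : (fun w : ℂ => l * ‖w‖ ^ 2) =O[𝓝 0] (fun w => ‖w‖ ^ 2) :=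
    (Asymptotics.isBigO_refl _ _).const_mul_left l
  refine ((hb.isBigO.add h1).add h2).congr_left fun w => ?_
  ring

theorem isBigO_re_mul (a : ℂ) : (fun w : ℂ => (a * w).re) =O[𝓝 0] (fun w => ‖w‖) := by
  refine Asymptotics.IsBigO.of_bound ‖a‖ (Eventually.of_forall fun w => ?_)
  rw [Real.norm_eq_abs, norm_norm, ← norm_mul]
  exact Complex.abs_re_le_norm _

theorem HasJet.isBigO_sub_id {f : ℂ → ℝ} {z a : ℂ} {l : ℝ} (hf : HasJet f z a l) :
    (fun w => f (z + w) - f z) =O[𝓝 0] (fun w => ‖w‖) := by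
  have := (hf.isBigO_sub.trans sq_isLittleO_id.isBigO).add (isBigO_re_mul a)
  exact this.congr_left fun w => by ring

theorem HasJet.continuousAt {f : ℂ → ℝ} {z a : ℂ} {l : ℝ} (hf : HasJet f z a l) :
    ContinuousAt f z := by
  have h1 : Tendsto (fun w : ℂ => ‖w‖) (𝓝 0) (𝓝 0) := by
    simpa using (continuous_norm (E := ℂ)).tendsto 0
  have h2 := hf.isBigO_sub_id.trans_tendsto h1
  have h3 : Tendsto (fun x => f (z + (x - z)) - f z) (𝓝 z) (𝓝 0) := by
    refine h2.comp ?_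
    have : Continuous (fun x : ℂ => x - z) := by fun_prop
    simpa using this.tendsto z
  simp only [add_sub_cancel] at h3
  have := h3.add_const (f z)
  simpa [ContinuousAt] using this

theorem re_mul_re (a b w : ℂ) : (a * w).re * (b * w).re =
    1 / 2 * (a * b * w ^ 2).re + 1 / 2 * (a * (starRingEnd ℂ) b).re * ‖w‖ ^ 2 := by
  rw [Complex.sq_norm, Complex.normSq_apply]
  simp only [Complex.mul_re, Complex.mul_im, Complex.conj_re, Complex.conj_im, pow_two]
  ring

theorem HasJet.mul {f g : ℂ → ℝ} {z a a' : ℂ} {l l' : ℝ} (hf : HasJet f z a l)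
    (hg : HasJet g z a' l') : HasJet (fun w => f w * g w) z (f z * a' + g z * a)
      (f z * l' + g z * l + 1 / 2 * (a * (starRingEnd ℂ) a').re) := by
  have hfi := hf.isBigO_sub
  have hgi := hg.isBigO_sub_id
  obtain ⟨b, hb⟩ := hf
  obtain ⟨b', hb'⟩ := hg
  refine ⟨f z * b' + g z * b + 1 / 2 * (a * a'), ?_⟩
  have e1 : (fun w => (f (z + w) - f z - (a * w).re) * (g (z + w) - g z)) =o[𝓝 0]
      (fun w : ℂ => ‖w‖ ^ 2) := by
    have h1 := hfi.mul hgi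
    have h2 : (fun w : ℂ => ‖w‖ ^ 2 * ‖w‖) =o[𝓝 0] (fun w : ℂ => ‖w‖ ^ 2) := by
      have : (fun w : ℂ => ‖w‖) =o[𝓝 0] (fun _ : ℂ => (1 : ℝ)) := by
        rw [Asymptotics.isLittleO_one_iff]
        simpa using (continuous_norm (E := ℂ)).tendsto 0
      simpa using (Asymptotics.isBigO_refl (fun w : ℂ => ‖w‖ ^ 2) (𝓝 0)).mul_isLittleO this
    exact h1.trans_isLittleO h2
  have e2 : (fun w => (a * w).re * (g (z + w) - g z - (a' * w).re)) =o[𝓝 0]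
      (fun w : ℂ => ‖w‖ ^ 2) := by
    have h1 := (isBigO_re_mul a).mul (HasJet.isBigO_sub ⟨b', hb'⟩)
    have h2 : (fun w : ℂ => ‖w‖ * ‖w‖ ^ 2) =o[𝓝 0] (fun w : ℂ => ‖w‖ ^ 2) := by
      have : (fun w : ℂ => ‖w‖) =o[𝓝 0] (fun _ : ℂ => (1 : ℝ)) := by
        rw [Asymptotics.isLittleO_one_iff]
        simpa using (continuous_norm (E := ℂ)).tendsto 0
      simpa using this.mul_isBigO (Asymptotics.isBigO_refl (fun w : ℂ => ‖w‖ ^ 2) (𝓝 0))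
    exact h1.trans_isLittleO h2
  have e3 := (hb.const_mul_left (g z)).add (hb'.const_mul_left (f z))
  refine ((e1.add e2).add e3).congr_left fun w => ?_
  have key := re_mul_re a a' w
  have k1 : ((f z * a' + g z * a) * w).re = f z * (a' * w).re + g z * (a * w).re := by
    simp only [add_mul, Complex.add_re, mul_assoc, Complex.re_ofReal_mul]
  have k2 : ((f z * b' + g z * b + 1 / 2 * (a * a')) * w ^ 2).re
      = f z * (b' * w ^ 2).re + g z * (b * w ^ 2).re + 1 / 2 * (a * a' * w ^ 2).re := by
    have : (1 / 2 : ℂ) = ((1 / 2 : ℝ) : ℂ) := by push_cast; rfl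
    rw [this]
    simp only [add_mul, Complex.add_re, mul_assoc, Complex.re_ofReal_mul]
  rw [k1, k2]
  linear_combination -key

theorem HasJet.comp {f : ℂ → ℝ} {z a : ℂ} {l : ℝ} {φ φ' : ℝ → ℝ} {c : ℝ} (hf : HasJet f z a l)
    (h1 : ∀ᶠ x in 𝓝 (f z), HasDerivAt φ (φ' x) x) (h2 : HasDerivAt φ' c (f z)) :
    HasJet (fun w => φ (f w)) z (φ' (f z) * a) (φ' (f z) * l + c / 4 * ‖a‖ ^ 2) := by
  have hexp := second_order_expansion h1 h2
  have hT : Tendsto (fun w => f (z + w) - f z) (𝓝 0) (𝓝 0) := by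
    have h1 : Tendsto (fun w : ℂ => ‖w‖) (𝓝 0) (𝓝 0) := by
      simpa using (continuous_norm (E := ℂ)).tendsto 0
    exact hf.isBigO_sub_id.trans_tendsto h1
  have e0 := hexp.comp_tendsto hT
  have e1 : ((fun t : ℝ => ‖t‖ ^ 2) ∘ fun w => f (z + w) - f z) =O[𝓝 0]
      (fun w : ℂ => ‖w‖ ^ 2) := by
    have := hf.isBigO_sub_id.norm_left.pow 2
    exact this
  have e2 := e0.trans_isBigO e1
  have hz : HasJet (fun w => f w - f z) z (a - 0) (l - 0) := hf.sub (hasJet_const (f z) z)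
  have hsq := hz.mul hz
  have hlin := (hsq.const_mul (c / 2)).add (hf.const_mul (φ' (f z)))
  obtain ⟨b, hb⟩ := hlin
  refine ⟨b, (e2.add hb).congr_left fun w => ?_⟩
  simp only [Function.comp_apply, add_sub_cancel, sub_self, sub_zero, Complex.ofReal_zero,
    zero_mul, add_zero, mul_zero, zero_add, Complex.mul_conj, Complex.ofReal_re,
    Complex.normSq_eq_norm_sq]
  ring

theorem hasJet_re {p : ℂ → ℂ} {z : ℂ} (hp : AnalyticAt ℂ p z) :
    HasJet (fun w => (p w).re) z (deriv p z) 0 := by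
  have h1 : ∀ᶠ x in 𝓝 z, HasDerivAt p (deriv p x) x := by
    filter_upwards [hp.eventually_analyticAt] with x hx
    exact hx.differentiableAt.hasDerivAt
  have h2 : HasDerivAt (deriv p) (deriv (deriv p) z) z := hp.deriv.differentiableAt.hasDerivAt
  have h := second_order_expansion h1 h2
  refine ⟨deriv (deriv p) z / 2, ?_⟩
  have hre : (fun w => (p (z + w) - p z - deriv p z * w - deriv (deriv p) z / 2 * w ^ 2).re)
      =O[𝓝 0] (fun w => p (z + w) - p z - deriv p z * w - deriv (deriv p) z / 2 * w ^ 2) :=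
    Asymptotics.IsBigO.of_bound 1 (Eventually.of_forall fun w => by
      rw [one_mul]; exact Complex.abs_re_le_norm _)
  exact (hre.trans_isLittleO h).congr_left fun w => by
    simp only [Complex.sub_re]; ring

theorem hasJet_im {p : ℂ → ℂ} {z : ℂ} (hp : AnalyticAt ℂ p z) :
    HasJet (fun w => (p w).im) z (-Complex.I * deriv p z) 0 := by
  have h := hasJet_re (p := fun w => -Complex.I * p w) (z := z) (analyticAt_const.mul hp)
  rw [deriv_const_mul _ hp.differentiableAt] at h
  simpa using h

theorem hasJet_norm_sq {p : ℂ → ℂ} {z : ℂ} (hp : AnalyticAt ℂ p z) :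
    HasJet (fun w => ‖p w‖ ^ 2) z (2 * (starRingEnd ℂ) (p z) * deriv p z) (‖deriv p z‖ ^ 2) := by
  have h := ((hasJet_re hp).mul (hasJet_re hp)).add ((hasJet_im hp).mul (hasJet_im hp))
  have h' : HasJet (fun w => ‖p w‖ ^ 2) z _ _ := h.congr_eventually (by
    refine Eventually.of_forall fun w => ?_
    simp only [Complex.sq_norm, Complex.normSq_apply])
  refine h'.congr_data ?_ ?_
  · have : (starRingEnd ℂ) (p z) = (p z).re - (p z).im * Complex.I := by
      apply Complex.ext <;> simp
    rw [this]; ring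
  · simp only [map_mul, map_neg, Complex.conj_I, mul_zero, add_zero, zero_add, neg_neg]
    rw [show -Complex.I * deriv p z * (Complex.I * (starRingEnd ℂ) (deriv p z))
      = -(Complex.I * Complex.I) * (deriv p z * (starRingEnd ℂ) (deriv p z)) by ring]
    simp [Complex.mul_conj, Complex.normSq_eq_norm_sq]
    rw [← Complex.ofReal_pow, Complex.ofReal_re]; ring

theorem hasJet_id_sq (z : ℂ) :
    HasJet (fun w => ‖w‖ ^ 2) z (2 * (starRingEnd ℂ) z) 1 := by
  have := hasJet_norm_sq (p := fun w => w) (z := z) analyticAt_id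
  refine this.congr_data ?_ ?_ <;> simp

theorem HasJet.dilate {f : ℂ → ℝ} {z a : ℂ} {l : ℝ} (r : ℝ) (hf : HasJet f (r * z) a l) :
    HasJet (fun w => f (r * w)) z (r * a) (r ^ 2 * l) := by
  obtain ⟨b, hb⟩ := hf
  refine ⟨r ^ 2 * b, ?_⟩
  have hT : Tendsto (fun w : ℂ => (r : ℂ) * w) (𝓝 0) (𝓝 0) := by
    have : Continuous (fun w : ℂ => (r : ℂ) * w) := by fun_prop
    simpa using this.tendsto 0
  have h1 := hb.comp_tendsto hT
  have h2 : ((fun w : ℂ => ‖w‖ ^ 2) ∘ fun w : ℂ => (r : ℂ) * w) =O[𝓝 0]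
      (fun w : ℂ => ‖w‖ ^ 2) := by
    refine Asymptotics.IsBigO.of_bound (r ^ 2) (Eventually.of_forall fun w => ?_)
    simp [mul_pow]
  refine (h1.trans_isBigO h2).congr_left fun w => ?_
  simp only [Function.comp_apply, norm_mul, Complex.norm_real, mul_pow, Real.norm_eq_abs, sq_abs,
    mul_add]
  rw [show a * (r * w) = r * a * w by ring, show b * ((r : ℂ) ^ 2 * w ^ 2) = r ^ 2 * b * w ^ 2 by ring]
  ring

theorem HasJet.nonpos_of_isLocalMax {f : ℂ → ℝ} {z a : ℂ} {l : ℝ} (hf : HasJet f z a l)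
    (hm : IsLocalMax f z) : l ≤ 0 := by
  by_contra! hl
  obtain ⟨b, hb⟩ := hf
  rw [Asymptotics.isLittleO_iff] at hb
  have h1 := hb (half_pos hl)
  have h2 : ∀ᶠ w in 𝓝 (0 : ℂ), f (z + w) ≤ f z := by
    have : Tendsto (fun t => z + t) (𝓝 (0 : ℂ)) (𝓝 z) := by
      have : Continuous (fun t : ℂ => z + t) := by fun_prop
      simpa using this.tendsto 0
    exact this.eventually hm
  obtain ⟨δ, hδ, hB⟩ := Metric.eventually_nhds_iff_ball.1 (h1.and h2)
  set t : ℂ := ((δ / 2 : ℝ) : ℂ) with ht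
  have hnt : ‖t‖ = δ / 2 := by rw [ht, Complex.norm_real, Real.norm_of_nonneg (by positivity)]
  have m1 : ∀ u : ℂ, ‖u‖ = 1 → (|f (z + u * t) - f z - (a * (u * t)).re
      - (b * (u * t) ^ 2).re - l * (δ / 2) ^ 2| ≤ l / 2 * (δ / 2) ^ 2) ∧ f (z + u * t) ≤ f z := by
    intro u hu
    have hn : ‖u * t‖ = δ / 2 := by rw [norm_mul, hu, hnt, one_mul]
    have := hB (u * t) (by simp only [Metric.mem_ball, dist_zero_right, hn]; linarith)
    simp only [Real.norm_eq_abs, norm_pow, hn, abs_of_pos hδ, abs_div, Nat.abs_ofNat] at this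
    exact this
  have a1 := m1 1 (by simp)
  have a2 := m1 (-1) (by simp)
  have a3 := m1 Complex.I (by simp)
  have a4 := m1 (-Complex.I) (by simp)
  have k1 := abs_le.1 a1.1
  have k2 := abs_le.1 a2.1
  have k3 := abs_le.1 a3.1
  have k4 := abs_le.1 a4.1
  simp only [one_mul, neg_mul, mul_neg, Complex.neg_re, mul_pow, Complex.I_sq, even_two,
    Even.neg_pow] at *
  nlinarith [mul_pos hl (pow_pos (half_pos hδ) 2)]

/-- Maximum principle for functions whose jets have nonnegative Laplacian. -/
theorem le_of_jet_nonneg {U : Set ℂ} (hU : IsOpen U) (hUb : Bornology.IsBounded U) {f : ℂ → ℝ}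
    (hc : ContinuousOn f (closure U)) (hj : ∀ z ∈ U, ∃ a l, HasJet f z a l ∧ 0 ≤ l) {c : ℝ}
    (hfr : ∀ z ∈ frontier U, f z ≤ c) : ∀ z ∈ U, f z ≤ c := by
  intro z hz
  obtain ⟨R, hR⟩ := hUb.closure.exists_norm_le
  have hK : IsCompact (closure U) := Metric.isCompact_of_isClosed_isBounded isClosed_closure
    hUb.closure
  refine le_of_forall_pos_le_add fun ε hε => ?_
  set η := ε / (R ^ 2 + 1) with hη
  have hη0 : 0 < η := by positivity
  obtain ⟨x, hx, hmax⟩ := hK.exists_isMaxOn (f := fun w => f w + η * ‖w‖ ^ 2)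
    ⟨z, subset_closure hz⟩ (hc.add (by fun_prop))
  have hxfr : x ∈ frontier U := by
    by_contra hxn
    have hxU : x ∈ U := by
      rw [hU.frontier_eq] at hxn
      by_contra h
      exact hxn ⟨hx, h⟩
    obtain ⟨a, l, hjet, hl⟩ := hj x hxU
    have := (hjet.add ((hasJet_id_sq x).const_mul η)).nonpos_of_isLocalMax
      (hmax.isLocalMax (mem_of_superset (hU.mem_nhds hxU) subset_closure))
    linarith
  have h1 : f z + η * ‖z‖ ^ 2 ≤ f x + η * ‖x‖ ^ 2 := hmax (subset_closure hz)
  have h2 := hfr x hxfr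
  have h3 : ‖x‖ ^ 2 ≤ R ^ 2 := by gcongr; exact hR x hx
  have h4 : η * ‖x‖ ^ 2 ≤ ε := by
    calc η * ‖x‖ ^ 2 ≤ η * (R ^ 2 + 1) := by gcongr; linarith
      _ = ε := by rw [hη]; field_simp
  nlinarith [mul_nonneg hη0.le (sq_nonneg ‖z‖)]

theorem mem_unitDisc {z : ℂ} : z ∈ unitDisc ↔ ‖z‖ < 1 := Iff.rfl

theorem unitDisc_eq_ball : unitDisc = Metric.ball (0 : ℂ) 1 := by
  ext z; simp [unitDisc]

theorem isOpen_unitDisc : IsOpen unitDisc := unitDisc_eq_ball ▸ Metric.isOpen_ball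

theorem circlePt_eq_circleMap (θ : ℝ) : circlePt θ = circleMap 0 1 θ := by
  simp [circlePt, circleMap]

@[simp] theorem norm_circlePt (θ : ℝ) : ‖circlePt θ‖ = 1 := by
  simp [circlePt, Complex.norm_exp]

theorem continuous_circlePt : Continuous circlePt := by
  unfold circlePt; fun_prop

theorem circlePt_add_two_pi (θ : ℝ) : circlePt (θ + 2 * Real.pi) = circlePt θ := by
  rw [circlePt_eq_circleMap, circlePt_eq_circleMap, periodic_circleMap]

theorem smul_circlePt_mem {r : ℝ} (h0 : 0 ≤ r) (h1 : r < 1) (θ : ℝ) :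
    (r : ℂ) * circlePt θ ∈ unitDisc := by
  rw [mem_unitDisc, norm_mul, norm_circlePt, Complex.norm_real, Real.norm_of_nonneg h0, mul_one]
  exact h1

theorem smul_mem_unitDisc {r : ℝ} (h0 : 0 ≤ r) (h1 : r ≤ 1) {z : ℂ} (hz : z ∈ unitDisc) :
    (r : ℂ) * z ∈ unitDisc := by
  rw [mem_unitDisc, norm_mul, Complex.norm_real, Real.norm_of_nonneg h0]
  rw [mem_unitDisc] at hz
  nlinarith [norm_nonneg z]

/-- Lebesgue measure on the interval of angles `(0, 2π]`. -/
def angM : Measure ℝ := volume.restrict (Ioc 0 (2 * Real.pi))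

instance : IsFiniteMeasure angM := by unfold angM; infer_instance

/-- The Poisson kernel of the unit disc. -/
def pk (z : ℂ) (θ : ℝ) : ℝ := (1 - ‖z‖ ^ 2) / ‖circlePt θ - z‖ ^ 2

/-- Harmonic measure of the disc at `z`, in the angle variable. -/
def pm (z : ℂ) : Measure ℝ :=
  angM.withDensity fun θ => ENNReal.ofReal ((2 * Real.pi)⁻¹ * pk z θ)

theorem circlePt_sub_ne_zero {z : ℂ} (hz : z ∈ unitDisc) (θ : ℝ) : circlePt θ - z ≠ 0 := by
  intro h
  have : ‖z‖ = 1 := by rw [← sub_eq_zero.1 h, norm_circlePt]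
  exact absurd (mem_unitDisc.1 hz) (by rw [this]; exact lt_irrefl _)

theorem pk_pos {z : ℂ} (hz : z ∈ unitDisc) (θ : ℝ) : 0 < pk z θ := by
  have := mem_unitDisc.1 hz
  have h2 : 0 < 1 - ‖z‖ ^ 2 := by nlinarith [norm_nonneg z]
  have := norm_pos_iff.2 (circlePt_sub_ne_zero hz θ)
  unfold pk; positivity

theorem pk_le {z : ℂ} (hz : z ∈ unitDisc) (θ : ℝ) : pk z θ ≤ 2 / (1 - ‖z‖) := by
  have h1 := mem_unitDisc.1 hz
  have h2 : 1 - ‖z‖ ≤ ‖circlePt θ - z‖ := by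
    have := norm_sub_norm_le (circlePt θ) z
    rwa [norm_circlePt] at this
  have h3 : 0 < 1 - ‖z‖ := by linarith
  have h4 := norm_pos_iff.2 (circlePt_sub_ne_zero hz θ)
  unfold pk
  rw [div_le_div_iff₀ (by positivity) h3]
  have : (1 - ‖z‖) ^ 2 ≤ ‖circlePt θ - z‖ ^ 2 := by gcongr
  nlinarith [norm_nonneg z]

theorem continuousOn_pk_uncurry :
    ContinuousOn (fun x : ℂ × ℝ => pk x.1 x.2) (unitDisc ×ˢ univ) := by
  unfold pk
  refine ContinuousOn.div (by fun_prop) ?_ ?_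
  · have := continuous_circlePt
    fun_prop
  · rintro ⟨z, θ⟩ ⟨hz, -⟩
    have := norm_pos_iff.2 (circlePt_sub_ne_zero hz θ)
    positivity

theorem continuous_pk {z : ℂ} (hz : z ∈ unitDisc) : Continuous (pk z) := by
  have : Continuous fun θ : ℝ => ((z, θ) : ℂ × ℝ) := by fun_prop
  exact continuousOn_pk_uncurry.comp_continuous this fun θ => ⟨hz, trivial⟩

theorem measurable_pk_weight {z : ℂ} (hz : z ∈ unitDisc) :
    Measurable fun θ => ENNReal.ofReal ((2 * Real.pi)⁻¹ * pk z θ) :=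
  ((continuous_pk hz).measurable.const_mul _).ennreal_ofReal

theorem integral_pm {E : Type*} [NormedAddCommGroup E] [NormedSpace ℝ E] {z : ℂ}
    (hz : z ∈ unitDisc) (g : ℝ → E) :
    ∫ θ, g θ ∂pm z = ∫ θ, ((2 * Real.pi)⁻¹ * pk z θ) • g θ ∂angM := by
  have h := integral_withDensity_eq_integral_toReal_smul (μ := angM)
    (measurable_pk_weight hz) (Eventually.of_forall fun x => ENNReal.ofReal_lt_top) g
  rw [pm, h]
  refine integral_congr_ae (Eventually.of_forall fun θ => ?_)
  have := (pk_pos hz θ).le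
  simp only
  rw [ENNReal.toReal_ofReal (by positivity)]

theorem pm_absolutelyContinuous (z : ℂ) : pm z ≪ angM := withDensity_absolutelyContinuous _ _

theorem integrable_pm {E : Type*} [NormedAddCommGroup E] [NormedSpace ℝ E] {z : ℂ}
    (hz : z ∈ unitDisc) {g : ℝ → E} (hg : Integrable g angM) : Integrable g (pm z) := by
  unfold pm
  rw [integrable_withDensity_iff_integrable_smul' (measurable_pk_weight hz)
    (Eventually.of_forall fun x => ENNReal.ofReal_lt_top)]
  have hb : ∀ θ, ‖(ENNReal.ofReal ((2 * Real.pi)⁻¹ * pk z θ)).toReal‖ ≤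
      (2 * Real.pi)⁻¹ * (2 / (1 - ‖z‖)) := by
    intro θ
    have := (pk_pos hz θ).le
    rw [ENNReal.toReal_ofReal (by positivity), Real.norm_of_nonneg (by positivity)]
    gcongr
    exact pk_le hz θ
  exact hg.bdd_smul _ (measurable_pk_weight hz).ennreal_toReal.aestronglyMeasurable
    (Eventually.of_forall hb)

theorem Continuous.integrable_angM {E : Type*} [NormedAddCommGroup E]
    {g : ℝ → E} (hg : Continuous g) : Integrable g angM :=
  hg.integrableOn_Ioc

theorem circleAverage_eq_angM {E : Type*} [NormedAddCommGroup E] [NormedSpace ℝ E] (f : ℂ → E) :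
    Real.circleAverage f 0 1 = (2 * Real.pi)⁻¹ • ∫ θ, f (circlePt θ) ∂angM := by
  rw [Real.circleAverage_def, intervalIntegral.integral_of_le Real.two_pi_pos.le]
  simp only [circlePt_eq_circleMap, angM]

/-- Poisson integral formula. -/
theorem poisson_formula {f : ℂ → ℂ} (hf : DiffContOnCl ℂ f (Metric.ball 0 1)) {z : ℂ}
    (hz : z ∈ unitDisc) : ∫ θ, f (circlePt θ) ∂pm z = f z := by
  have h := hf.circleAverage_poissonKernel_smul (unitDisc_eq_ball ▸ hz)
  rw [circleAverage_eq_angM, ← integral_smul] at h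
  rw [integral_pm hz, ← h]
  refine integral_congr_ae (Eventually.of_forall fun θ => ?_)
  simp [poissonKernel, pk, mul_assoc]

theorem isProbabilityMeasure_pm {z : ℂ} (hz : z ∈ unitDisc) : IsProbabilityMeasure (pm z) := by
  have h := poisson_formula (f := fun _ => 1) diffContOnCl_const hz
  have hfin : IsFiniteMeasure (pm z) := by
    have := integrable_pm hz (integrable_const (1 : ℝ))
    simpa [integrable_const_iff] using this
  refine ⟨?_⟩
  have h2 : (pm z).real univ = 1 := by
    rw [integral_const] at h
    simpa using h
  rw [measureReal_def] at h2
  rw [← ENNReal.ofReal_toReal (measure_ne_top (pm z) univ), h2, ENNReal.ofReal_one]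

theorem zero_mem_unitDisc : (0 : ℂ) ∈ unitDisc := by simp [unitDisc]

theorem pk_zero (θ : ℝ) : pk 0 θ = 1 := by simp [pk]

theorem integral_pm_zero {E : Type*} [NormedAddCommGroup E] [NormedSpace ℝ E] (g : ℝ → E) :
    ∫ θ, g θ ∂pm 0 = (2 * Real.pi)⁻¹ • ∫ θ, g θ ∂angM := by
  rw [integral_pm zero_mem_unitDisc, ← integral_smul]
  simp [pk_zero]

theorem ae_pm_of_ae {p : ℝ → Prop} {z : ℂ} (h : ∀ᵐ θ ∂angM, p θ) : ∀ᵐ θ ∂pm z, p θ :=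
  (pm_absolutelyContinuous z).ae_le h

/-- Poisson formula for real parts. -/
theorem poisson_formula_re {f : ℂ → ℂ} (hf : DiffContOnCl ℂ f (Metric.ball 0 1)) {z : ℂ}
    (hz : z ∈ unitDisc) : ∫ θ, (f (circlePt θ)).re ∂pm z = (f z).re := by
  have hc : Continuous fun θ => f (circlePt θ) := by
    refine hf.continuousOn.comp_continuous continuous_circlePt fun θ => ?_
    rw [closure_ball _ one_ne_zero]; simp
  have := Complex.reCLM.integral_comp_comm (integrable_pm hz hc.integrable_angM)
  simp only [Complex.reCLM_apply] at this
  rw [this, poisson_formula hf hz]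

theorem pk_eq_re (z : ℂ) (θ : ℝ) : pk z θ = ((circlePt θ + z) / (circlePt θ - z)).re := by
  have := congrFun (poissonKernel_eq_re_herglotzRieszKernel (c := 0) (w := z)) (circlePt θ)
  simpa [poissonKernel, herglotzRieszKernel, pk] using this

theorem integral_pk_dilate {r : ℝ} (h0 : 0 ≤ r) (h1 : r < 1) {z : ℂ} (hz : z ∈ unitDisc) (ξ : ℝ) :
    ∫ ζ, pk (r * circlePt ζ) ξ ∂pm z = pk (r * z) ξ := by
  have hd : DiffContOnCl ℂ (fun w : ℂ => (circlePt ξ + r * w) / (circlePt ξ - r * w))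
      (Metric.ball 0 1) := by
    refine DifferentiableOn.diffContOnCl ?_
    rw [closure_ball _ one_ne_zero]
    refine DifferentiableOn.div (by fun_prop) (by fun_prop) fun w hw => ?_
    refine circlePt_sub_ne_zero ?_ ξ
    rw [mem_unitDisc, norm_mul, Complex.norm_real, Real.norm_of_nonneg h0]
    have : ‖w‖ ≤ 1 := by simpa using hw
    nlinarith [norm_nonneg w]
  have := poisson_formula_re hd hz
  simpa only [pk_eq_re] using this

theorem continuous_pk_dilate {r : ℝ} (h0 : 0 ≤ r) (h1 : r < 1) :
    Continuous fun x : ℝ × ℝ => pk (r * circlePt x.1) x.2 := by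
  have hc := continuous_circlePt
  have : Continuous fun x : ℝ × ℝ => ((r * circlePt x.1, x.2) : ℂ × ℝ) := by fun_prop
  exact continuousOn_pk_uncurry.comp_continuous this
    fun x => ⟨smul_circlePt_mem h0 h1 _, trivial⟩

theorem integral_pm_semigroup {E : Type*} [NormedAddCommGroup E] [NormedSpace ℝ E]
    [CompleteSpace E] {r : ℝ} (h0 : 0 ≤ r) (h1 : r < 1) {z : ℂ} (hz : z ∈ unitDisc)
    {g : ℝ → E} (hg : Integrable g angM) :
    ∫ ζ, ∫ ξ, g ξ ∂pm (r * circlePt ζ) ∂pm z = ∫ ξ, g ξ ∂pm (r * z) := by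
  have hrz : (r : ℂ) * z ∈ unitDisc := smul_mem_unitDisc h0 h1.le hz
  have e1 : ∀ ζ, ∫ ξ, g ξ ∂pm (r * circlePt ζ) =
      ∫ ξ, ((2 * Real.pi)⁻¹ * pk (r * circlePt ζ) ξ) • g ξ ∂angM :=
    fun ζ => integral_pm (smul_circlePt_mem h0 h1 ζ) g
  simp_rw [e1]
  rw [integral_pm hz, integral_pm hrz]
  simp_rw [← integral_smul]
  rw [integral_integral_swap]
  · refine integral_congr_ae (Eventually.of_forall fun ξ => ?_)
    simp only [smul_smul]
    rw [integral_smul_const]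
    congr 1
    have := integral_pk_dilate h0 h1 hz ξ
    rw [integral_pm hz] at this
    rw [← this, ← integral_const_mul]
    refine integral_congr_ae (Eventually.of_forall fun ζ => ?_)
    simp only [smul_eq_mul]
    ring
  · have hgs : Integrable (fun x : ℝ × ℝ => g x.2) (angM.prod angM) := hg.comp_snd angM
    have hcz := continuous_pk hz
    have hcr := continuous_pk_dilate h0 h1
    have := hgs.bdd_smul (φ := fun x : ℝ × ℝ => ((2 * Real.pi)⁻¹ * pk z x.1) *
      ((2 * Real.pi)⁻¹ * pk (r * circlePt x.1) x.2))
      (((2 * Real.pi)⁻¹ * (2 / (1 - ‖z‖))) * ((2 * Real.pi)⁻¹ * (2 / (1 - r))))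
      (by
        have : Continuous (fun x : ℝ × ℝ => ((2 * Real.pi)⁻¹ * pk z x.1) *
          ((2 * Real.pi)⁻¹ * pk (r * circlePt x.1) x.2)) := by fun_prop
        exact this.aestronglyMeasurable)
      (Eventually.of_forall fun x => by
        have hm := smul_circlePt_mem h0 h1 x.1
        have p1 := (pk_pos hz x.1).le
        have p2 := (pk_pos hm x.2).le
        rw [Real.norm_of_nonneg (by positivity)]
        have q1 := pk_le hz x.1
        have q2 := pk_le hm x.2
        rw [norm_mul, norm_circlePt, Complex.norm_real, Real.norm_of_nonneg h0, mul_one] at q2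
        have : 0 ≤ 2 / (1 - ‖z‖) := p1.trans q1
        exact mul_le_mul (mul_le_mul_of_nonneg_left q1 (by positivity))
          (mul_le_mul_of_nonneg_left q2 (by positivity)) (by positivity) (by positivity))
    refine this.congr (Eventually.of_forall fun x => ?_)
    simp only [Function.uncurry, Pi.smul_apply', smul_smul]

/-- The Herglotz integral of a real boundary function. -/
def herg (g : ℝ → ℝ) (z : ℂ) : ℂ :=
  (2 * Real.pi : ℝ)⁻¹ • ∫ θ, ((circlePt θ + z) / (circlePt θ - z)) * (g θ : ℂ) ∂angM

theorem differentiableOn_herg {g : ℝ → ℝ} (hg : Integrable g angM) :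
    DifferentiableOn ℂ (herg g) unitDisc := by
  set f : ℂ → ℂ := fun ζ => (g (toIocMod Real.two_pi_pos 0 ζ.arg) : ℂ) with hf
  have key : ∀ θ ∈ Ioc 0 (2 * Real.pi), f (circlePt θ) = g θ := by
    intro θ hθ
    have h1 : (circlePt θ).arg = toIocMod Real.two_pi_pos (-Real.pi) θ := by
      rw [circlePt, Complex.arg_exp_mul_I]
    simp only [hf, h1]
    rw [toIocMod_toIocMod, (toIocMod_eq_self Real.two_pi_pos).2 (by simpa using hθ)]
  have hci : CircleIntegrable f 0 1 := by
    rw [CircleIntegrable, intervalIntegrable_iff_integrableOn_Ioc_of_le Real.two_pi_pos.le]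
    have : IntegrableOn (fun θ => (g θ : ℂ)) (Ioc 0 (2 * Real.pi)) := Integrable.ofReal hg
    refine this.congr_fun (fun θ hθ => ?_) measurableSet_Ioc
    simp only
    rw [← key θ hθ, circlePt_eq_circleMap]
  have h := differentiableOn_circleAverage_herglotzRieszKernel_smul hci
  rw [← unitDisc_eq_ball] at h
  refine h.congr fun z _ => ?_
  rw [herg, circleAverage_eq_angM]
  congr 1
  refine setIntegral_congr_fun measurableSet_Ioc fun θ hθ => ?_
  simp only [herglotzRieszKernel, sub_zero, smul_eq_mul]
  rw [key θ hθ]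

theorem herg_kernel_continuous {z : ℂ} (hz : z ∈ unitDisc) :
    Continuous fun θ => (circlePt θ + z) / (circlePt θ - z) := by
  have := continuous_circlePt
  exact Continuous.div (by fun_prop) (by fun_prop) (circlePt_sub_ne_zero hz)

theorem re_herg {g : ℝ → ℝ} (hg : Integrable g angM) {z : ℂ} (hz : z ∈ unitDisc) :
    (herg g z).re = ∫ θ, g θ ∂pm z := by
  have hi : Integrable (fun θ => ((circlePt θ + z) / (circlePt θ - z)) * (g θ : ℂ)) angM := by
    have hb : ∀ θ, ‖(circlePt θ + z) / (circlePt θ - z)‖ ≤ 2 / (1 - ‖z‖) := by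
      intro θ
      have h1 := mem_unitDisc.1 hz
      have h2 := norm_sub_norm_le (circlePt θ) z
      have h3 := norm_add_le (circlePt θ) z
      rw [norm_circlePt] at h2 h3
      rw [norm_div]
      have : 0 < 1 - ‖z‖ := by linarith
      gcongr
      linarith
    exact hg.ofReal.bdd_mul (herg_kernel_continuous hz).aestronglyMeasurable
      (Eventually.of_forall hb)
  have := Complex.reCLM.integral_comp_comm hi
  simp only [Complex.reCLM_apply] at this
  rw [herg, Complex.smul_re, ← this, integral_pm hz, smul_eq_mul, ← integral_const_mul]
  refine integral_congr_ae (Eventually.of_forall fun θ => ?_)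
  simp only [Complex.re_mul_ofReal, ← pk_eq_re, smul_eq_mul, mul_assoc]

theorem hasJet_poisson {g : ℝ → ℝ} (hg : Integrable g angM) {z : ℂ} (hz : z ∈ unitDisc) :
    HasJet (fun w => ∫ θ, g θ ∂pm w) z (deriv (herg g) z) 0 := by
  have h := hasJet_re ((differentiableOn_herg hg).analyticAt (isOpen_unitDisc.mem_nhds hz))
  refine h.congr_eventually ?_
  filter_upwards [isOpen_unitDisc.mem_nhds hz] with w hw
  exact re_herg hg hw

/-- Real parts of entire functions are dense in the continuous real functions on the circle. -/
theorem exists_re_approx {g : ℂ → ℝ} (hg : ContinuousOn g (Metric.sphere 0 1)) {ε : ℝ}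
    (hε : 0 < ε) : ∃ p : ℂ → ℂ, Differentiable ℂ p ∧ (p 0).im = 0 ∧
      ∀ θ, |(p (circlePt θ)).re - g (circlePt θ)| ≤ ε := by
  have : Fact (0 < 2 * Real.pi) := ⟨Real.two_pi_pos⟩
  let c : AddCircle (2 * Real.pi) → ℂ := fun x => (AddCircle.toCircle x : ℂ)
  have hc : Continuous c := continuous_subtype_val.comp AddCircle.continuous_toCircle
  have hcs : ∀ x, c x ∈ Metric.sphere (0 : ℂ) 1 := fun x => by
    rw [mem_sphere_zero_iff_norm]; exact Circle.norm_coe _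
  let G : C(AddCircle (2 * Real.pi), ℂ) :=
    ⟨fun x => (g (c x) : ℂ), Complex.continuous_ofReal.comp (hg.comp_continuous hc hcs)⟩
  have hG : G ∈ (Submodule.span ℂ (range <| @fourier (2 * Real.pi))).topologicalClosure := by
    rw [span_fourier_closure_eq_top]; trivial
  obtain ⟨f, hf, hfd⟩ := Metric.mem_closure_iff.1 hG ε hε
  have hspan : ∀ a : ℂ, ∃ p : ℂ → ℂ, Differentiable ℂ p ∧ ∀ x, (a * f x).re = (p (c x)).re := by
    refine Submodule.span_induction (p := fun f _ => ∀ a : ℂ, ∃ p : ℂ → ℂ,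
      Differentiable ℂ p ∧ ∀ x, (a * f x).re = (p (c x)).re) ?_ ?_ ?_ ?_ hf
    · rintro _ ⟨n, rfl⟩ a
      have hfx : ∀ x, fourier n x = (c x) ^ n := fun x => by
        simp [fourier_apply, AddCircle.toCircle_zsmul, c]
      obtain ⟨m, rfl | rfl⟩ := n.eq_nat_or_neg
      · exact ⟨fun w => a * w ^ m, by fun_prop, fun x => by rw [hfx]; simp⟩
      · refine ⟨fun w => (starRingEnd ℂ) a * w ^ m, by fun_prop, fun x => ?_⟩
        rw [hfx]
        have h1 : ‖c x‖ = 1 := by simpa using hcs x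
        have : (c x)⁻¹ = (starRingEnd ℂ) (c x) := Complex.inv_eq_conj h1
        rw [zpow_neg, zpow_natCast, ← inv_pow, this, ← Complex.conj_re]
        simp
    · exact fun a => ⟨0, by fun_prop, by simp⟩
    · intro f₁ f₂ _ _ h1 h2 a
      obtain ⟨p, hp, hpx⟩ := h1 a
      obtain ⟨q, hq, hqx⟩ := h2 a
      exact ⟨p + q, hp.add hq, fun x => by
        simp only [ContinuousMap.add_apply, mul_add, Complex.add_re, hpx, hqx, Pi.add_apply]⟩
    · intro b f _ h a
      obtain ⟨p, hp, hpx⟩ := h (a * b)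
      exact ⟨p, hp, fun x => by
        rw [← hpx, ContinuousMap.smul_apply, smul_eq_mul, mul_assoc]⟩
  obtain ⟨p, hp, hpx⟩ := hspan 1
  refine ⟨fun w => p w - (p 0).im * Complex.I, by fun_prop, by simp, fun θ => ?_⟩
  have h1 := (ContinuousMap.dist_lt_iff hε).1 hfd (θ : AddCircle (2 * Real.pi))
  have h2 : c (θ : AddCircle (2 * Real.pi)) = circlePt θ := by
    simp only [c, AddCircle.toCircle_apply_mk, circlePt]
    rw [div_self Real.two_pi_pos.ne', one_mul, Circle.coe_exp]
  have h3 := hpx (θ : AddCircle (2 * Real.pi))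
  rw [one_mul, h2] at h3
  rw [dist_eq_norm] at h1
  have h4 := (Complex.abs_re_le_norm _).trans h1.le
  simp only [G, ContinuousMap.coe_mk, Complex.sub_re, Complex.ofReal_re, h2, h3] at h4
  rw [abs_sub_comm]
  simpa using h4

theorem sphere_eq_frontier_unitDisc : frontier unitDisc = Metric.sphere (0 : ℂ) 1 := by
  rw [unitDisc_eq_ball, frontier_ball _ one_ne_zero]

theorem closure_unitDisc : closure unitDisc = Metric.closedBall (0 : ℂ) 1 := by
  rw [unitDisc_eq_ball, closure_ball _ one_ne_zero]

theorem isBounded_unitDisc : Bornology.IsBounded unitDisc :=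
  unitDisc_eq_ball ▸ Metric.isBounded_ball

theorem exists_circlePt_of_norm_eq_one {z : ℂ} (hz : ‖z‖ = 1) : ∃ θ, z = circlePt θ := by
  refine ⟨z.arg, ?_⟩
  have := Complex.norm_mul_exp_arg_mul_I z
  rw [hz] at this
  simpa [circlePt] using this.symm

/-- The Poisson integral of a superharmonic function is a minorant. -/
theorem poisson_le_of_superharmonic {X : ℂ → ℝ} (hc : ContinuousOn X (Metric.closedBall 0 1))
    (hj : ∀ z ∈ unitDisc, ∃ a l, HasJet X z a l ∧ l ≤ 0) {z : ℂ} (hz : z ∈ unitDisc) :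
    ∫ θ, X (circlePt θ) ∂pm z ≤ X z := by
  refine le_of_forall_pos_le_add fun ε hε => ?_
  obtain ⟨p, hp, -, hpX⟩ := exists_re_approx (hc.mono Metric.sphere_subset_closedBall)
    (half_pos hε)
  have h1 : ∀ w ∈ unitDisc, (p w).re - X w ≤ ε / 2 := by
    refine le_of_jet_nonneg isOpen_unitDisc isBounded_unitDisc ?_ ?_ ?_
    · rw [closure_unitDisc]
      exact (Complex.continuous_re.comp hp.continuous).continuousOn.sub hc
    · intro w hw
      obtain ⟨a, l, hjet, hl⟩ := hj w hw
      exact ⟨_, _, (hasJet_re (hp.analyticAt w)).sub hjet, by linarith⟩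
    · intro w hw
      rw [sphere_eq_frontier_unitDisc, mem_sphere_zero_iff_norm] at hw
      obtain ⟨θ, rfl⟩ := exists_circlePt_of_norm_eq_one hw
      exact (le_abs_self _).trans (hpX θ)
  have := isProbabilityMeasure_pm hz
  have hXc : Continuous fun θ => X (circlePt θ) :=
    hc.comp_continuous continuous_circlePt (by simp)
  have hpc : Continuous fun θ => (p (circlePt θ)).re :=
    Complex.continuous_re.comp (hp.continuous.comp continuous_circlePt)
  have h2 : ∫ θ, X (circlePt θ) ∂pm z ≤ ∫ θ, ((p (circlePt θ)).re + ε / 2) ∂pm z := by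
    refine integral_mono (integrable_pm hz hXc.integrable_angM)
      (integrable_pm hz (hpc.add continuous_const).integrable_angM) fun θ => ?_
    have := neg_abs_le ((p (circlePt θ)).re - X (circlePt θ))
    have := hpX θ
    simp only
    linarith
  rw [integral_add (integrable_pm hz hpc.integrable_angM) (integrable_const _),
    poisson_formula_re hp.diffContOnCl hz] at h2
  simp only [integral_const, probReal_univ, smul_eq_mul, one_mul] at h2
  have := h1 z hz
  linarith

section Brouwer

variable {E : Type*} [NormedAddCommGroup E] [InnerProductSpace ℝ E] [FiniteDimensional ℝ E]

theorem exists_polynomial_det_one_add (A : E →L[ℝ] E) :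
    ∃ P : Polynomial ℝ, P.natDegree ≤ Module.finrank ℝ E ∧
      ∀ t : ℝ, P.eval t = (1 + t • A).det := by
  classical
  let b := Module.finBasis ℝ E
  let M := LinearMap.toMatrix b b (A : E →ₗ[ℝ] E)
  refine ⟨_, (Polynomial.natDegree_det_X_add_C_le M 1).trans (by simp), fun t => ?_⟩
  rw [← Polynomial.coe_evalRingHom, RingHom.map_det, ContinuousLinearMap.det,
    ← LinearMap.det_toMatrix b]
  congr 1
  have h : ((1 + t • A : E →L[ℝ] E) : E →ₗ[ℝ] E) = LinearMap.id + t • (A : E →ₗ[ℝ] E) := rfl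
  have h' : LinearMap.toMatrix b b (LinearMap.id + t • (A : E →ₗ[ℝ] E)) = 1 + t • M := by
    simp only [map_add, map_smul, LinearMap.toMatrix_id, M]
  rw [h, h']
  ext i j
  by_cases hij : i = j <;> simp [M, hij, add_comm (1 : ℝ), mul_comm t]

theorem det_one_add_pos {A : E →L[ℝ] E} {t : ℝ} (ht : 0 ≤ t) (hA : t * ‖A‖ < 1) :
    0 < (1 + t • A).det := by
  have hne : ∀ s ∈ Icc 0 t, (1 + s • A).det ≠ 0 := by
    intro s hs
    have h1 : ‖s • A‖ < 1 := by
      rw [norm_smul, Real.norm_of_nonneg hs.1]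
      exact (mul_le_mul_of_nonneg_right hs.2 (norm_nonneg _)).trans_lt hA
    have h2 : IsUnit (1 + s • A) := by
      have := isUnit_one_sub_of_norm_lt_one (x := -(s • A)) (by rwa [norm_neg])
      simpa using this
    have h3 := h2.map (ContinuousLinearMap.toLinearMapRingHom (R₁ := ℝ) (M₁ := E))
    have h4 := h3.map (LinearMap.det : (E →ₗ[ℝ] E) →* ℝ)
    exact h4.ne_zero
  have hc : ContinuousOn (fun s : ℝ => (1 + s • A).det) (Icc 0 t) := by
    obtain ⟨P, -, hP⟩ := exists_polynomial_det_one_add A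
    simp_rw [← hP]
    exact P.continuous.continuousOn
  by_contra hneg
  push Not at hneg
  have h0 : (1 + (0 : ℝ) • A).det = 1 := by simp [ContinuousLinearMap.det]
  obtain ⟨s, hs, hs0⟩ := intermediate_value_Icc' ht hc
    (show (0 : ℝ) ∈ Icc _ _ from ⟨hneg, by simp only [h0]; exact zero_le_one⟩)
  exact hne s hs hs0

theorem exists_det_one_add_interpolation (E : Type*) [NormedAddCommGroup E]
    [InnerProductSpace ℝ E] [FiniteDimensional ℝ E] {τ : ℝ} (hτ : 0 < τ) :
    ∃ (v c : ℕ → ℝ) (n : ℕ), (∀ i, v i ∈ Ioo 0 τ) ∧ ∑ i ∈ Finset.range n, c i = 1 ∧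
      ∀ A : E →L[ℝ] E,
        (1 + A).det = ∑ i ∈ Finset.range n, c i * (1 + v i • A).det := by
  classical
  let n := Module.finrank ℝ E + 1
  let v : ℕ → ℝ := fun i => τ / (i + 2)
  have hv : InjOn v (Finset.range n : Set ℕ) := by
    intro i _ j _ hij
    have h1 : (i : ℝ) + 2 ≠ 0 := by positivity
    have h2 : (j : ℝ) + 2 ≠ 0 := by positivity
    simp only [v] at hij
    rw [div_eq_div_iff h1 h2] at hij
    exact_mod_cast (add_right_cancel (mul_left_cancel₀ hτ.ne' hij)).symm
  have key : ∀ P : Polynomial ℝ, P.natDegree ≤ Module.finrank ℝ E →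
      P.eval 1 = ∑ i ∈ Finset.range n,
        (Lagrange.basis (Finset.range n) v i).eval 1 * P.eval (v i) := by
    intro P hP
    have hd : P.degree < (Finset.range n).card := by
      rw [Finset.card_range]
      exact Polynomial.degree_le_natDegree.trans_lt (by exact_mod_cast Nat.lt_succ_of_le hP)
    conv_lhs => rw [Lagrange.eq_interpolate hv hd, Lagrange.interpolate_apply]
    rw [Polynomial.eval_finsetSum]
    refine Finset.sum_congr rfl fun i _ => ?_
    rw [Polynomial.eval_mul, Polynomial.eval_C, mul_comm]
  refine ⟨v, fun i => (Lagrange.basis (Finset.range n) v i).eval 1, n, fun i => ⟨?_, ?_⟩, ?_, ?_⟩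
  · positivity
  · exact div_lt_self hτ (by have : (0 : ℝ) ≤ i := by positivity
                             linarith)
  · simpa using (key 1 (by simp)).symm
  · intro A
    obtain ⟨P, hP, hPe⟩ := exists_polynomial_det_one_add A
    have := key P hP
    simpa only [hPe, one_smul] using this

theorem not_exists_contDiff_retraction [Nontrivial E] {W : Set E} (hW : IsOpen W)
    (hsub : Metric.closedBall 0 1 ⊆ W) {r : E → E} (hr : ContDiffOn ℝ 1 r W)
    (hid : ∀ x, ‖x‖ = 1 → r x = x) (hnorm : ∀ x, ‖x‖ ≤ 1 → ‖r x‖ = 1) : False := by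
  borelize E
  let U : Set E := Metric.ball 0 1
  have hUW : U ⊆ W := Metric.ball_subset_closedBall.trans hsub
  let φ : E → E := fun x => r x - x
  have hrd : ∀ x ∈ W, HasFDerivAt r (fderiv ℝ r x) x := fun x hx =>
    ((hr.differentiableOn one_ne_zero).differentiableAt (hW.mem_nhds hx)).hasFDerivAt
  let A : E → (E →L[ℝ] E) := fun x => fderiv ℝ r x - 1
  have hφd : ∀ x ∈ W, HasFDerivAt φ (A x) x := fun x hx => (hrd x hx).sub (hasFDerivAt_id x)
  have hAc : ContinuousOn A W :=
    (hr.continuousOn_fderiv_of_isOpen hW le_rfl).sub continuousOn_const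
  obtain ⟨C, hC⟩ := (isCompact_closedBall (0 : E) 1).exists_bound_of_continuousOn (hAc.mono hsub)
  have hC0 : 0 ≤ C := (norm_nonneg _).trans (hC 0 (by simp))
  have hlip : ∀ x ∈ Metric.closedBall (0 : E) 1, ∀ y ∈ Metric.closedBall (0 : E) 1,
      ‖φ y - φ x‖ ≤ C * ‖y - x‖ := fun x hx y hy =>
    (convex_closedBall (0 : E) 1).norm_image_sub_le_of_norm_hasFDerivWithin_le
      (fun z hz => (hφd z (hsub hz)).hasFDerivWithinAt) hC hx hy
  let N : NNReal := ‖((ContinuousLinearEquiv.refl ℝ E).symm : E →L[ℝ] E)‖₊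
  have hN : N = 1 := by
    simp only [N]
    exact ContinuousLinearMap.nnnorm_id
  let τ : ℝ := min 1 (1 / (C + 1))
  have hτ : 0 < τ := by positivity
  obtain ⟨v, c, n, hv, hc1, hdet⟩ := exists_det_one_add_interpolation E hτ
  have hvC : ∀ i, v i * C < 1 := by
    intro i
    have h1 : v i < 1 / (C + 1) := (hv i).2.trans_le (min_le_right _ _)
    rw [lt_div_iff₀ (by positivity)] at h1
    nlinarith [(hv i).1]
  have hpos : ∀ i, ∀ x ∈ U, 0 < (1 + v i • A x).det := fun i x hx =>
    det_one_add_pos (hv i).1.le ((mul_le_mul_of_nonneg_left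
      (hC x (Metric.ball_subset_closedBall hx)) (hv i).1.le).trans_lt (hvC i))
  have hvol : ∀ i, ∫⁻ x in U, ENNReal.ofReal |(1 + v i • A x).det| = volume U := by
    intro i
    let g : E → E := fun x => x + v i • φ x
    have hgd : ∀ x ∈ W, HasFDerivAt g (1 + v i • A x) x := fun x hx =>
      (hasFDerivAt_id x).add ((hφd x hx).const_smul (v i))
    have happ : ApproximatesLinearOn g ((ContinuousLinearEquiv.refl ℝ E : E ≃L[ℝ] E) : E →L[ℝ] E)
        U (Real.toNNReal (v i * C)) := by
      intro x hx y hy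
      have h1 : g x - g y - (x - y) = v i • (φ x - φ y) := by
        simp only [g, smul_sub]; abel
      change ‖g x - g y - (x - y)‖ ≤ _
      rw [h1, norm_smul, Real.norm_of_nonneg (hv i).1.le,
        Real.coe_toNNReal _ (mul_nonneg (hv i).1.le hC0), mul_assoc]
      exact mul_le_mul_of_nonneg_left (hlip y (Metric.ball_subset_closedBall hy) x
        (Metric.ball_subset_closedBall hx)) (hv i).1.le
    have hlt : Real.toNNReal (v i * C) < N⁻¹ := by
      rw [hN, inv_one, ← Real.toNNReal_one]
      exact (Real.toNNReal_lt_toNNReal_iff one_pos).2 (hvC i)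
    have hinj : InjOn g U := happ.injOn (Or.inr hlt)
    have hopen : IsOpen (g '' U) :=
      (happ.toOpenPartialHomeomorph g U (Or.inr hlt) Metric.isOpen_ball).open_target
    have hv1 : v i < 1 := (hv i).2.trans_le (min_le_left _ _)
    have hgeq : ∀ x, g x = (1 - v i) • x + v i • r x := fun x => by
      simp only [g, φ, smul_sub, sub_smul, one_smul]; abel
    have hmaps : ∀ x ∈ U, g x ∈ U := by
      intro x hx
      have hx1 : ‖x‖ < 1 := by simpa [U] using hx
      simp only [U, Metric.mem_ball, dist_zero_right]
      rw [hgeq]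
      refine (norm_add_le _ _).trans_lt ?_
      rw [norm_smul, norm_smul, Real.norm_of_nonneg (hv i).1.le, Real.norm_of_nonneg (by linarith),
        hnorm x hx1.le]
      nlinarith
    have hgc : ContinuousOn g (Metric.closedBall 0 1) := fun x hx =>
      (hgd x (hsub hx)).continuousAt.continuousWithinAt
    have himage : g '' U = U := by
      refine Subset.antisymm (image_subset_iff.2 hmaps) ?_
      refine (convex_ball (0 : E) 1).isPreconnected.subset_of_closure_inter_subset hopen ?_ ?_
      · exact ⟨g 0, hmaps 0 (by simp [U]), mem_image_of_mem _ (by simp [U])⟩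
      · rintro y ⟨hy, hyU⟩
        have hcl : closure (g '' U) ⊆ g '' Metric.closedBall 0 1 :=
          closure_minimal (image_mono Metric.ball_subset_closedBall)
            ((isCompact_closedBall _ _).image_of_continuousOn hgc).isClosed
        obtain ⟨x, hx, rfl⟩ := hcl hy
        refine ⟨x, ?_, rfl⟩
        have hx1 : ‖x‖ ≤ 1 := by simpa using hx
        rcases hx1.lt_or_eq with h | h
        · simpa [U] using h
        · exfalso
          have : g x = x := by simp only [g, φ, hid x h, sub_self, smul_zero, add_zero]
          rw [this] at hyU
          have : ‖x‖ < 1 := by simpa using hyU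
          linarith
    have := lintegral_abs_det_fderiv_eq_addHaar_image (volume : Measure E)
      (measurableSet_ball : MeasurableSet U)
      (fun x hx => (hgd x (hUW hx)).hasFDerivWithinAt) hinj
    rw [this, himage]
  have hUfin : volume U ≠ ⊤ := measure_ball_lt_top.ne
  have hmeas : ∀ i, AEStronglyMeasurable (fun x => (1 + v i • A x).det) (volume.restrict U) := by
    intro i
    refine ContinuousOn.aestronglyMeasurable ?_ measurableSet_ball
    exact ContinuousLinearMap.continuous_det.comp_continuousOn
      (continuousOn_const.add ((hAc.mono hUW).const_smul (v i)))
  have hint : ∀ i, Integrable (fun x => (1 + v i • A x).det) (volume.restrict U) := by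
    intro i
    refine ⟨hmeas i, ?_⟩
    simp only [HasFiniteIntegral, ← ofReal_norm, Real.norm_eq_abs]
    rw [hvol i]
    exact hUfin.lt_top
  have hval : ∀ i, ∫ x in U, (1 + v i • A x).det = volume.real U := by
    intro i
    rw [integral_eq_lintegral_of_nonneg_ae _ (hmeas i), Measure.real, ← hvol i]
    · congr 1
      refine setLIntegral_congr_fun measurableSet_ball fun x hx => ?_
      simp only [abs_of_pos (hpos i x hx)]
    · exact (ae_restrict_iff' measurableSet_ball).2 (Eventually.of_forall fun x hx =>
        (hpos i x hx).le)
  have htotal : ∫ x in U, (1 + A x).det = volume.real U := by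
    rw [show (fun x => (1 + A x).det) = _ from funext fun x => hdet (A x),
      integral_finsetSum _ fun i _ => (hint i).const_mul (c i)]
    simp_rw [integral_const_mul, hval, ← Finset.sum_mul, hc1, one_mul]
  have hzero : ∀ x ∈ U, (1 + A x).det = 0 := by
    intro x hx
    have hA : 1 + A x = fderiv ℝ r x := by simp only [A]; abel
    rw [hA]
    by_contra hne
    have hsurj : Function.Surjective (fderiv ℝ r x) :=
      (LinearMap.equivOfDetNeZero (fderiv ℝ r x : E →ₗ[ℝ] E) hne).surjective
    obtain ⟨w, hw⟩ := hsurj (r x)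
    have h1 := (hrd x (hUW hx)).norm_sq
    have h2 : HasFDerivAt (fun y => ‖r y‖ ^ 2) (0 : E →L[ℝ] ℝ) x := by
      refine (hasFDerivAt_const (1 : ℝ) x).congr_of_eventuallyEq ?_
      filter_upwards [Metric.isOpen_ball.mem_nhds hx] with y hy
      rw [hnorm y (by simpa using (Metric.ball_subset_closedBall hy)), one_pow]
    have h3 := congrArg (fun L : E →L[ℝ] ℝ => L w) (h1.unique h2)
    simp [hw, hnorm x (by simpa using (Metric.ball_subset_closedBall hx))] at h3
  rw [setIntegral_congr_fun measurableSet_ball hzero, integral_zero] at htotal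
  have : 0 < volume.real U :=
    ENNReal.toReal_pos (Metric.measure_ball_pos _ _ one_pos).ne' hUfin
  linarith

theorem exists_fixedPoint_of_contDiff {f : E → E} (hf : ContDiff ℝ 1 f)
    (hb : ∀ x, ‖x‖ ≤ 1 → ‖f x‖ < 1) : ∃ x, ‖x‖ ≤ 1 ∧ f x = x := by
  by_contra! hne
  rcases subsingleton_or_nontrivial E with hE | hE
  · exact hne 0 (by simp) (Subsingleton.elim _ _)
  let u : E → E := fun x => x - f x
  have hu : ContDiff ℝ 1 u := contDiff_id.sub hf
  let p : E → ℝ := fun x => inner ℝ x (u x)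
  have hp : ContDiff ℝ 1 p := contDiff_id.inner ℝ hu
  let d : E → ℝ := fun x => p x ^ 2 + ‖u x‖ ^ 2 * (1 - ‖x‖ ^ 2)
  have hd : ContDiff ℝ 1 d :=
    (hp.pow 2).add ((hu.norm_sq ℝ).mul (contDiff_const.sub (contDiff_id.norm_sq ℝ)))
  let s : E → ℝ := fun x => (-p x + √(d x)) / ‖u x‖ ^ 2
  let r : E → E := fun x => x + s x • u x
  let W : Set E := {x | u x ≠ 0 ∧ 0 < d x}
  have hW : IsOpen W := (isOpen_ne_fun hu.continuous continuous_const).inter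
    (isOpen_lt continuous_const hd.continuous)
  have hu0 : ∀ x, ‖x‖ ≤ 1 → u x ≠ 0 := fun x hx h => hne x hx (sub_eq_zero.1 h).symm
  have hp1 : ∀ x, ‖x‖ = 1 → 0 < p x := by
    intro x hx
    have h1 : p x = 1 - inner ℝ x (f x) := by
      simp only [p, u, inner_sub_right, real_inner_self_eq_norm_sq, hx, one_pow]
    have h2 := real_inner_le_norm x (f x)
    rw [hx, one_mul] at h2
    linarith [hb x hx.le]
  have hd0 : ∀ x, ‖x‖ ≤ 1 → 0 < d x := by
    intro x hx
    have hun : 0 < ‖u x‖ := norm_pos_iff.2 (hu0 x hx)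
    rcases hx.lt_or_eq with h | h
    · have : 0 < 1 - ‖x‖ ^ 2 := by nlinarith [norm_nonneg x]
      positivity
    · have := hp1 x h
      simp only [d, h, one_pow, sub_self, mul_zero, add_zero]
      positivity
  refine not_exists_contDiff_retraction (E := E) hW (r := r) ?_ ?_ ?_ ?_
  · intro x hx
    rw [mem_closedBall_zero_iff] at hx
    exact ⟨hu0 x hx, hd0 x hx⟩
  · intro x hx
    have hun : ‖u x‖ ^ 2 ≠ 0 := pow_ne_zero _ (norm_ne_zero_iff.2 hx.1)
    have hs : ContDiffAt ℝ 1 s x :=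
      (hp.contDiffAt.neg.add (hd.contDiffAt.sqrt hx.2.ne')).div (hu.norm_sq ℝ).contDiffAt hun
    exact (contDiffAt_id.add (hs.smul hu.contDiffAt)).contDiffWithinAt
  · intro x hx
    have : √(d x) = p x := by
      simp only [d, hx, one_pow, sub_self, mul_zero, add_zero]
      exact Real.sqrt_sq (hp1 x hx).le
    simp only [r, s, this, neg_add_cancel, zero_div, zero_smul, add_zero]
  · intro x hx
    have hun : ‖u x‖ ^ 2 ≠ 0 := pow_ne_zero _ (norm_ne_zero_iff.2 (hu0 x hx))
    have h1 : ‖r x‖ ^ 2 = ‖x‖ ^ 2 + 2 * (s x * p x) + s x ^ 2 * ‖u x‖ ^ 2 := by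
      simp only [r, norm_add_sq_real, inner_smul_right, norm_smul, mul_pow, Real.norm_eq_abs,
        sq_abs, p]
    have h2 : s x * ‖u x‖ ^ 2 = -p x + √(d x) := div_mul_cancel₀ _ hun
    have h3 : √(d x) ^ 2 = p x ^ 2 + ‖u x‖ ^ 2 * (1 - ‖x‖ ^ 2) := Real.sq_sqrt (hd0 x hx).le
    have h4 : (‖r x‖ ^ 2 - 1) * ‖u x‖ ^ 2 = 0 := by
      rw [h1]
      have h5 : √(d x) = s x * ‖u x‖ ^ 2 + p x := by rw [h2]; ring
      rw [h5] at h3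
      linear_combination h3
    have h6 : ‖r x‖ ^ 2 = 1 := by
      have := (mul_eq_zero.1 h4).resolve_right hun
      linarith
    exact (pow_eq_one_iff_of_nonneg (norm_nonneg _) two_ne_zero).1 h6

theorem exists_fixedPoint_of_continuous {f : E → E} (hf : Continuous f)
    (hb : ∀ x, ‖f x‖ ≤ 1 / 2) : ∃ x, f x = x := by
  by_contra! hne
  have hK := isCompact_closedBall (0 : E) 1
  obtain ⟨x₀, -, hx₀⟩ := hK.exists_isMinOn ⟨0, by simp⟩
    (f := fun x => ‖f x - x‖) (by fun_prop)
  have hμ : 0 < ‖f x₀ - x₀‖ := norm_pos_iff.2 (sub_ne_zero.2 (hne x₀))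
  let μ := min (1 / 4) (‖f x₀ - x₀‖ / 2)
  have hμ0 : 0 < μ := by positivity
  obtain ⟨δ, hδ, hδf⟩ := Metric.uniformContinuousOn_iff.1
    ((isCompact_closedBall (0 : E) 2).uniformContinuousOn_of_continuous hf.continuousOn) μ hμ0
  obtain ⟨g, hg, hgf⟩ := hf.exists_contDiff_dist_le_of_forall_mem_ball_dist_le
    (lt_min one_pos hδ)
  have hclose : ∀ x, ‖x‖ ≤ 1 → ‖g x - f x‖ ≤ μ := by
    intro x hx
    rw [← dist_eq_norm]
    refine hgf x μ fun y hy => (hδf y ?_ x ?_ ?_).le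
    · have h1 : ‖y - x‖ < 1 := by
        rw [← dist_eq_norm]; exact (Metric.mem_ball.1 hy).trans_le (min_le_left _ _)
      have h2 := norm_add_le (y - x) x
      rw [sub_add_cancel] at h2
      rw [mem_closedBall_zero_iff]
      linarith
    · rw [mem_closedBall_zero_iff]; linarith
    · exact (Metric.mem_ball.1 hy).trans_le (min_le_right _ _)
  obtain ⟨x, hx, hgx⟩ := exists_fixedPoint_of_contDiff (hg.of_le (by norm_cast)) (fun x hx => by
    have h1 := norm_add_le (g x - f x) (f x)
    rw [sub_add_cancel] at h1
    have h2 := hclose x hx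
    have h3 : μ ≤ 1 / 4 := min_le_left _ _
    linarith [hb x])
  have h1 := hclose x hx
  have h2 : ‖f x₀ - x₀‖ ≤ ‖f x - x‖ := hx₀ (by simpa using hx)
  have h3 : μ ≤ ‖f x₀ - x₀‖ / 2 := min_le_right _ _
  rw [hgx, norm_sub_rev] at h1
  linarith

end Brouwer

theorem brouwer_pi {ι : Type*} [Fintype ι] {f : (ι → ℝ) → (ι → ℝ)} (hf : Continuous f) {R : ℝ}
    (hb : ∀ x i, |f x i| ≤ R) : ∃ x, f x = x := by
  rcases isEmpty_or_nonempty ι with hι | ⟨⟨i₀⟩⟩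
  · exact ⟨0, Subsingleton.elim _ _⟩
  have hR : 0 ≤ R := (abs_nonneg _).trans (hb 0 i₀)
  let E := EuclideanSpace ℝ ι
  let S : ℝ := 2 * (Fintype.card ι * R + 1)
  have hS : 0 < S := by positivity
  let g : E → E := fun x => S⁻¹ • WithLp.toLp 2 (f (S • WithLp.ofLp x))
  have hg : Continuous g := by
    have h1 : Continuous (fun x : E => WithLp.ofLp x) := PiLp.continuous_ofLp 2 _
    have h2 : Continuous (fun x : ι → ℝ => (WithLp.toLp 2 x : E)) := PiLp.continuous_toLp 2 _
    exact (h2.comp (hf.comp (h1.const_smul S))).const_smul S⁻¹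
  obtain ⟨x, hx⟩ := exists_fixedPoint_of_continuous hg (fun x => by
    simp only [g]
    rw [norm_smul, norm_inv, Real.norm_of_nonneg hS.le, inv_mul_le_iff₀ hS]
    rw [EuclideanSpace.norm_eq]
    refine Real.sqrt_le_iff.2 ⟨by positivity, ?_⟩
    have h1 : ∀ i, ‖f (S • WithLp.ofLp x) i‖ ^ 2 ≤ R ^ 2 := fun i => by
      rw [Real.norm_eq_abs, sq_abs]; exact sq_le_sq' (abs_le.1 (hb _ i)).1 (abs_le.1 (hb _ i)).2
    refine (Finset.sum_le_card_nsmul _ _ _ fun i _ => h1 i).trans ?_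
    have h2 : (1 : ℝ) ≤ Fintype.card ι := by
      exact_mod_cast Fintype.card_pos_iff.2 ⟨i₀⟩
    simp only [Finset.card_univ, nsmul_eq_mul, S]
    have h3 : 0 ≤ (Fintype.card ι : ℝ) * R ^ 2 := by positivity
    have h4 : 0 ≤ (Fintype.card ι : ℝ) * R := by positivity
    nlinarith [mul_nonneg h3 (sub_nonneg.2 h2)])
  refine ⟨S • WithLp.ofLp x, ?_⟩
  have h := congrArg (fun y : E => S • WithLp.ofLp y) hx
  simp only [g, WithLp.ofLp_smul] at h
  rwa [smul_inv_smul₀ hS.ne'] at h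

theorem norm_circlePt_sub (θ θ₀ : ℝ) :
    ‖circlePt θ - circlePt θ₀‖ = 2 * |Real.sin ((θ - θ₀) / 2)| := by
  have h : circlePt θ - circlePt θ₀ =
      circlePt θ₀ * (Complex.exp (Complex.I * ((θ - θ₀ : ℝ) : ℂ)) - 1) := by
    simp only [circlePt, mul_sub, ← Complex.exp_add, mul_one]
    congr 2
    push_cast
    ring
  rw [h, norm_mul, norm_circlePt, one_mul, Complex.norm_exp_I_mul_ofReal_sub_one]
  simp

theorem norm_circlePt_sub_le (θ θ₀ : ℝ) : ‖circlePt θ - circlePt θ₀‖ ≤ |θ - θ₀| := by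
  rw [norm_circlePt_sub]
  have := Real.abs_sin_le_abs (x := (θ - θ₀) / 2)
  rw [abs_div, abs_two] at this
  linarith

theorem le_norm_circlePt_sub {θ θ₀ : ℝ} (h : |θ - θ₀| ≤ Real.pi) :
    2 / Real.pi * |θ - θ₀| ≤ ‖circlePt θ - circlePt θ₀‖ := by
  rw [norm_circlePt_sub]
  have := Real.mul_abs_le_abs_sin (x := (θ - θ₀) / 2) (by rw [abs_div, abs_two]; linarith)
  rw [abs_div, abs_two] at this
  linarith

theorem one_sub_norm_le_norm_circlePt_sub (z : ℂ) (θ : ℝ) : 1 - ‖z‖ ≤ ‖circlePt θ - z‖ := by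
  have := norm_sub_norm_le (circlePt θ) z
  rwa [norm_circlePt] at this

theorem norm_circlePt_sub_smul {r : ℝ} (h1 : r ≤ 1) (θ : ℝ) :
    ‖circlePt θ - r * circlePt θ‖ = 1 - r := by
  have : circlePt θ - r * circlePt θ = ((1 - r : ℝ) : ℂ) * circlePt θ := by push_cast; ring
  rw [this, norm_mul, norm_circlePt, mul_one, Complex.norm_real, Real.norm_of_nonneg (by linarith)]

theorem norm_smul_circlePt {r : ℝ} (h0 : 0 ≤ r) (θ : ℝ) : ‖(r : ℂ) * circlePt θ‖ = r := by
  rw [norm_mul, norm_circlePt, mul_one, Complex.norm_real, Real.norm_of_nonneg h0]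

theorem pk_le_div_sq {z : ℂ} (hz : z ∈ unitDisc) {θ d : ℝ} (hd : 0 < d)
    (h : d ≤ ‖circlePt θ - z‖) : pk z θ ≤ 2 * (1 - ‖z‖) / d ^ 2 := by
  have hz1 : ‖z‖ < 1 := hz
  have h0 := norm_nonneg z
  unfold pk
  refine div_le_div₀ (by nlinarith) (by nlinarith) (by positivity) ?_
  exact pow_le_pow_left₀ hd.le h 2

theorem le_norm_circlePt_sub_smul {r : ℝ} (h0 : 0 ≤ r) (h1 : r < 1) {θ θ₀ : ℝ}
    (h : |θ - θ₀| ≤ Real.pi) : |θ - θ₀| / Real.pi ≤ ‖circlePt θ - r * circlePt θ₀‖ := by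
  have h2 := le_norm_circlePt_sub h
  have h3 := one_sub_norm_le_norm_circlePt_sub (r * circlePt θ₀) θ
  rw [norm_smul_circlePt h0] at h3
  have h4 := norm_sub_le_norm_sub_add_norm_sub (circlePt θ) (r * circlePt θ₀) (circlePt θ₀)
  rw [norm_sub_rev (r * circlePt θ₀), norm_circlePt_sub_smul h1.le] at h4
  have h5 : 2 / Real.pi * |θ - θ₀| = 2 * (|θ - θ₀| / Real.pi) := by ring
  linarith

theorem pk_le_sum {r : ℝ} (h0 : 0 ≤ r) (h1 : r < 1) {n : ℕ} (hn : 1 ≤ 2 ^ n * (1 - r))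
    {θ θ₀ : ℝ} (h : |θ - θ₀| < Real.pi) :
    pk (r * circlePt θ₀) θ ≤ ∑ k ∈ Finset.range (n + 1),
      8 * (1 / 2) ^ k * ((min (2 ^ k * (1 - r)) 1)⁻¹ *
        (Ioo (θ₀ - Real.pi * min (2 ^ k * (1 - r)) 1)
          (θ₀ + Real.pi * min (2 ^ k * (1 - r)) 1)).indicator 1 θ) := by
  classical
  have hπ := Real.pi_pos
  have hδ : 0 < 1 - r := by linarith
  have hz := smul_circlePt_mem h0 h1 θ₀
  set t : ℕ → ℝ := fun k => min (2 ^ k * (1 - r)) 1 with ht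
  have ht0 : ∀ k, 0 < t k := fun k => lt_min (by positivity) one_pos
  have hmem : ∀ k, θ ∈ Ioo (θ₀ - Real.pi * t k) (θ₀ + Real.pi * t k) ↔ |θ - θ₀| < Real.pi * t k := by
    intro k
    rw [abs_lt, mem_Ioo]
    constructor <;> rintro ⟨h1, h2⟩ <;> constructor <;> linarith
  have hex : ∃ k, |θ - θ₀| < Real.pi * t k := ⟨n, by
    simp only [ht, min_eq_right hn, mul_one]; exact h⟩
  have hN := Nat.find_spec hex
  have hmin := fun j => Nat.find_min hex (m := j)
  have hNn : Nat.find hex ≤ n := Nat.find_min' hex (by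
    simp only [ht, min_eq_right hn, mul_one]; exact h)
  generalize Nat.find hex = N at hN hmin hNn
  have hterm : pk (r * circlePt θ₀) θ ≤ 8 * (1 / 2) ^ N * ((t N)⁻¹ *
      (Ioo (θ₀ - Real.pi * t N) (θ₀ + Real.pi * t N)).indicator 1 θ) := by
    rw [indicator_of_mem ((hmem N).2 hN), Pi.one_apply, mul_one]
    rcases Nat.eq_zero_or_pos N with rfl | hNpos
    · have h3 := pk_le hz θ
      rw [norm_smul_circlePt h0] at h3
      refine h3.trans ?_
      have : t 0 = 1 - r := by simp only [ht, pow_zero, one_mul]; exact min_eq_left (by linarith)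
      rw [this, pow_zero, mul_one, ← div_eq_mul_inv]
      gcongr
      norm_num
    · obtain ⟨m, rfl⟩ : ∃ m, N = m + 1 := ⟨N - 1, by omega⟩
      have h3 := hmin m (Nat.lt_succ_self m)
      push Not at h3
      have htm : t m = 2 ^ m * (1 - r) := by
        rcases min_choice (2 ^ m * (1 - r)) 1 with h4 | h4
        · exact h4
        · exfalso
          simp only [ht] at h3
          rw [h4, mul_one] at h3
          linarith
      rw [htm] at h3
      have h5 : 2 ^ m * (1 - r) ≤ ‖circlePt θ - r * circlePt θ₀‖ := by
        refine le_trans ?_ (le_norm_circlePt_sub_smul h0 h1 h.le)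
        rw [le_div_iff₀ hπ]
        linarith
      have h6 := pk_le_div_sq hz (by positivity) h5
      rw [norm_smul_circlePt h0] at h6
      refine h6.trans ?_
      have h7 : t (m + 1) ≤ 2 ^ (m + 1) * (1 - r) := min_le_left _ _
      rw [← div_eq_mul_inv, div_le_div_iff₀ (by positivity) (ht0 _)]
      have h8 : 2 * (1 - r) * t (m + 1) ≤ 2 * (1 - r) * (2 ^ (m + 1) * (1 - r)) :=
        mul_le_mul_of_nonneg_left h7 (by positivity)
      refine h8.trans (le_of_eq ?_)
      rw [one_div, inv_pow]
      field_simp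
      ring
  refine hterm.trans (Finset.single_le_sum (f := fun k => 8 * (1 / 2) ^ k * ((t k)⁻¹ *
      (Ioo (θ₀ - Real.pi * t k) (θ₀ + Real.pi * t k)).indicator 1 θ)) (fun k _ => ?_)
      (Finset.mem_range.2 (Nat.lt_succ_of_le hNn)))
  have : (0 : ℝ) ≤ (Ioo (θ₀ - Real.pi * t k) (θ₀ + Real.pi * t k)).indicator 1 θ :=
    indicator_nonneg (fun _ _ => zero_le_one) _
  have := (ht0 k).le
  positivity

section Periodic

variable {E : Type*} [NormedAddCommGroup E]

theorem Function.Periodic.locallyIntegrable_of_angM {f : ℝ → E}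
    (hf : Function.Periodic f (2 * Real.pi)) (hi : Integrable f angM) :
    LocallyIntegrable f := by
  have h1 : ∀ a b, IntervalIntegrable f volume a b := by
    refine hf.intervalIntegrable₀ Real.two_pi_pos.ne' ?_
    rw [intervalIntegrable_iff_integrableOn_Ioc_of_le Real.two_pi_pos.le]
    exact hi
  intro x
  refine ⟨Ioc (x - 1) (x + 1), Ioc_mem_nhds (by linarith) (by linarith), ?_⟩
  exact (intervalIntegrable_iff_integrableOn_Ioc_of_le (by linarith)).1 (h1 _ _)

theorem LocallyIntegrable.integrableOn_Ioo' {f : ℝ → E} (hf : LocallyIntegrable f) (a b : ℝ) :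
    IntegrableOn f (Ioo a b) :=
  (hf.integrableOn_isCompact isCompact_Icc).mono_set (Ioo_subset_Icc_self (a := a) (b := b))

theorem Function.Periodic.integral_angM [NormedSpace ℝ E] {f : ℝ → E}
    (hf : Function.Periodic f (2 * Real.pi)) (θ₀ : ℝ) :
    ∫ θ, f θ ∂angM = ∫ θ in Ioo (θ₀ - Real.pi) (θ₀ + Real.pi), f θ := by
  have h := hf.intervalIntegral_add_eq 0 (θ₀ - Real.pi)
  rw [zero_add, intervalIntegral.integral_of_le Real.two_pi_pos.le,
    intervalIntegral.integral_of_le (by linarith [Real.pi_pos])] at h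
  rw [angM, h, integral_Ioc_eq_integral_Ioo]
  congr 3
  ring

end Periodic

theorem pk_periodic (z : ℂ) : Function.Periodic (pk z) (2 * Real.pi) := fun θ => by
  simp only [pk, circlePt_add_two_pi]

/-- The average of a real function over the arc of normalized length `t`. -/
def arcMean (f : ℝ → ℝ) (θ₀ t : ℝ) : ℝ :=
  (2 * Real.pi * t)⁻¹ * ∫ θ in Ioo (θ₀ - Real.pi * t) (θ₀ + Real.pi * t), f θ

theorem arcMean_nonneg {f : ℝ → ℝ} (hf : ∀ θ, 0 ≤ f θ) (θ₀ : ℝ) {t : ℝ} (ht : 0 ≤ t) :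
    0 ≤ arcMean f θ₀ t :=
  mul_nonneg (by have := Real.pi_pos; positivity) (integral_nonneg hf)

theorem integral_pm_le_sum_arcMean {f : ℝ → ℝ} (hf : Function.Periodic f (2 * Real.pi))
    (hi : Integrable f angM) (hpos : ∀ θ, 0 ≤ f θ) {r : ℝ} (h0 : 0 ≤ r) (h1 : r < 1) {n : ℕ}
    (hn : 1 ≤ 2 ^ n * (1 - r)) (θ₀ : ℝ) :
    ∫ θ, f θ ∂pm (r * circlePt θ₀) ≤
      ∑ k ∈ Finset.range (n + 1), 8 * (1 / 2) ^ k * arcMean f θ₀ (min (2 ^ k * (1 - r)) 1) := by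
  have hπ := Real.pi_pos
  have hz := smul_circlePt_mem h0 h1 θ₀
  have hloc := hf.locallyIntegrable_of_angM hi
  set t : ℕ → ℝ := fun k => min (2 ^ k * (1 - r)) 1 with ht
  have ht0 : ∀ k, 0 < t k := fun k => lt_min (by have := sub_pos.2 h1; positivity) one_pos
  have ht1 : ∀ k, t k ≤ 1 := fun k => min_le_right _ _
  let J : ℕ → Set ℝ := fun k => Ioo (θ₀ - Real.pi * t k) (θ₀ + Real.pi * t k)
  have hJ : ∀ k, J k ⊆ Ioo (θ₀ - Real.pi) (θ₀ + Real.pi) := fun k =>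
    Ioo_subset_Ioo (by nlinarith [ht1 k]) (by nlinarith [ht1 k])
  rw [integral_pm hz, Function.Periodic.integral_angM (θ₀ := θ₀)
    (fun θ => by simp only [pk_periodic _ θ, hf θ])]
  have hiJ : ∀ k, IntegrableOn ((J k).indicator f) (Ioo (θ₀ - Real.pi) (θ₀ + Real.pi)) := fun k =>
    (LocallyIntegrable.integrableOn_Ioo' hloc _ _).indicator measurableSet_Ioo
  have hle : ∀ θ ∈ Ioo (θ₀ - Real.pi) (θ₀ + Real.pi),
      ((2 * Real.pi)⁻¹ * pk (r * circlePt θ₀) θ) • f θ ≤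
        ∑ k ∈ Finset.range (n + 1),
          (8 * (1 / 2) ^ k * (2 * Real.pi * t k)⁻¹) * (J k).indicator f θ := by
    intro θ hθ
    have hθ' : |θ - θ₀| < Real.pi := by
      rw [abs_lt]; constructor <;> linarith [hθ.1, hθ.2]
    have h3 := pk_le_sum h0 h1 hn hθ'
    have h4 := mul_le_mul_of_nonneg_left h3
      (mul_nonneg (inv_nonneg.2 Real.two_pi_pos.le) (hpos θ))
    rw [smul_eq_mul]
    calc (2 * Real.pi)⁻¹ * pk (r * circlePt θ₀) θ * f θ
        = (2 * Real.pi)⁻¹ * f θ * pk (r * circlePt θ₀) θ := by ring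
      _ ≤ _ := h4
      _ = _ := by
        rw [Finset.mul_sum]
        refine Finset.sum_congr rfl fun k _ => ?_
        by_cases hk : θ ∈ J k
        · rw [indicator_of_mem hk, indicator_of_mem (s := Ioo _ _) hk, Pi.one_apply, mul_inv]
          simp only [ht]
          ring
        · rw [indicator_of_notMem hk, indicator_of_notMem (s := Ioo _ _) hk]
          ring
  refine (setIntegral_mono_on ?_ ?_ measurableSet_Ioo hle).trans (le_of_eq ?_)
  · refine ((integrableOn_Icc_iff_integrableOn_Ioo).1 ?_)
    exact (hloc.integrableOn_isCompact isCompact_Icc).continuousOn_smul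
      (((continuous_pk hz).const_smul ((2 * Real.pi)⁻¹)).continuousOn) isCompact_Icc
  · exact integrable_finsetSum _ fun k _ => (hiJ k).const_mul _
  · rw [integral_finsetSum _ fun k _ => (hiJ k).const_mul _]
    refine Finset.sum_congr rfl fun k _ => ?_
    rw [integral_const_mul, setIntegral_indicator measurableSet_Ioo,
      inter_eq_self_of_subset_right (hJ k), arcMean]
    ring

theorem arcMean_le_integral_pm {f : ℝ → ℝ} (hf : Function.Periodic f (2 * Real.pi))
    (hi : Integrable f angM) (hpos : ∀ θ, 0 ≤ f θ) {t : ℝ} (h0 : 0 < t) (h1 : t ≤ 1) (θ₀ : ℝ) :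
    arcMean f θ₀ t ≤ 25 * ∫ θ, f θ ∂pm ((1 - t : ℝ) * circlePt θ₀) := by
  have hπ := Real.pi_pos
  have hz := smul_circlePt_mem (sub_nonneg.2 h1) (by linarith : 1 - t < 1) θ₀
  have hnz := norm_smul_circlePt (sub_nonneg.2 h1) θ₀
  set z : ℂ := ((1 - t : ℝ) : ℂ) * circlePt θ₀ with hzdef
  have hloc := hf.locallyIntegrable_of_angM hi
  rw [integral_pm hz, Function.Periodic.integral_angM (θ₀ := θ₀)
    (fun θ => by simp only [pk_periodic _ θ, hf θ]), arcMean, ← integral_const_mul,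
    ← integral_const_mul]
  have hiI : IntegrableOn (fun θ => 25 * (((2 * Real.pi)⁻¹ * pk z θ) • f θ))
      (Ioo (θ₀ - Real.pi) (θ₀ + Real.pi)) := by
    have h : IntegrableOn (fun θ => ((2 * Real.pi)⁻¹ * pk z θ) • f θ)
        (Icc (θ₀ - Real.pi) (θ₀ + Real.pi)) :=
      (hloc.integrableOn_isCompact isCompact_Icc).continuousOn_smul
        (((continuous_pk hz).const_smul ((2 * Real.pi)⁻¹)).continuousOn) isCompact_Icc
    exact ((integrableOn_Icc_iff_integrableOn_Ioo).1 h).const_mul 25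
  have hsub : Ioo (θ₀ - Real.pi * t) (θ₀ + Real.pi * t) ⊆ Ioo (θ₀ - Real.pi) (θ₀ + Real.pi) :=
    Ioo_subset_Ioo (by nlinarith) (by nlinarith)
  have hnn : ∀ θ, 0 ≤ 25 * (((2 * Real.pi)⁻¹ * pk z θ) • f θ) := fun θ => by
    have := pk_pos hz θ
    have := hpos θ
    rw [smul_eq_mul]
    positivity
  refine le_trans ?_ (setIntegral_mono_set hiI (Eventually.of_forall hnn) hsub.eventuallyLE)
  refine setIntegral_mono_on ?_ (hiI.mono_set hsub) measurableSet_Ioo ?_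
  · exact (LocallyIntegrable.integrableOn_Ioo' hloc _ _).const_mul _
  · intro θ hθ
    have h2 : |θ - θ₀| ≤ Real.pi * t := by
      rw [abs_le]; constructor <;> linarith [hθ.1, hθ.2]
    have h3 : ‖circlePt θ - z‖ ≤ 5 * t := by
      have h4 := norm_sub_le_norm_sub_add_norm_sub (circlePt θ) (circlePt θ₀) z
      have h5 := norm_circlePt_sub_le θ θ₀
      have h6 := norm_circlePt_sub_smul (by linarith : 1 - t ≤ 1) θ₀
      nlinarith [Real.pi_lt_d2]
    have h7 : 0 < ‖circlePt θ - z‖ := norm_pos_iff.2 (circlePt_sub_ne_zero hz θ)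
    have h8 : t⁻¹ ≤ 25 * pk z θ := by
      unfold pk
      rw [hnz, ← one_div, ← mul_div_assoc, div_le_div_iff₀ h0 (by positivity)]
      have h9 : ‖circlePt θ - z‖ ^ 2 ≤ (5 * t) ^ 2 := pow_le_pow_left₀ h7.le h3 2
      nlinarith
    have h10 := mul_le_mul_of_nonneg_left h8 (inv_nonneg.2 Real.two_pi_pos.le)
    have h11 := mul_le_mul_of_nonneg_right h10 (hpos θ)
    rw [smul_eq_mul, mul_inv]
    linarith

theorem sum_range_two_mul_add_one_div_pow (n : ℕ) :
    ∑ k ∈ Finset.range n, (1 / 2 : ℝ) ^ k * (2 * k + 1) = 6 - (4 * n + 6) * (1 / 2) ^ n := by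
  induction n with
  | zero => simp
  | succ n ih =>
    rw [Finset.sum_range_succ, ih, pow_succ]
    push_cast
    ring

theorem norm_arcAvg_sub_le {f : ℝ → ℂ} (hf : LocallyIntegrable f) (c : ℂ) (θ₀ : ℝ) {t : ℝ}
    (ht : 0 < t) : ‖arcAvg f θ₀ t - c‖ ≤ arcMean (fun θ => ‖f θ - c‖) θ₀ t := by
  have hπ := Real.pi_pos
  set I := Ioo (θ₀ - Real.pi * t) (θ₀ + Real.pi * t)
  have hvol : volume.real I = 2 * Real.pi * t := by
    simp only [I, Real.volume_real_Ioo_of_le (by nlinarith : θ₀ - Real.pi * t ≤ θ₀ + Real.pi * t)]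
    ring
  have h1 : arcAvg f θ₀ t - c = (2 * Real.pi * t)⁻¹ • ∫ θ in I, (f θ - c) := by
    rw [integral_sub (LocallyIntegrable.integrableOn_Ioo' hf _ _)
      (integrableOn_const (by simp)), setIntegral_const, hvol, smul_sub, smul_smul,
      inv_mul_cancel₀ (by positivity), one_smul]
    rfl
  rw [h1, norm_smul, Real.norm_of_nonneg (by positivity)]
  exact mul_le_mul_of_nonneg_left (norm_integral_le_integral_norm _) (by positivity)

theorem arcMean_norm_sub_le {f : ℝ → ℂ} (hf : LocallyIntegrable f) (c c' : ℂ) (θ₀ : ℝ) {t : ℝ}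
    (ht : 0 < t) : arcMean (fun θ => ‖f θ - c‖) θ₀ t ≤
      arcMean (fun θ => ‖f θ - c'‖) θ₀ t + ‖c' - c‖ := by
  have hπ := Real.pi_pos
  set I := Ioo (θ₀ - Real.pi * t) (θ₀ + Real.pi * t) with hI
  have hvol : volume.real I = 2 * Real.pi * t := by
    simp only [I, Real.volume_real_Ioo_of_le (by nlinarith : θ₀ - Real.pi * t ≤ θ₀ + Real.pi * t)]
    ring
  have hc : ∀ c : ℂ, IntegrableOn (fun _ => c) I := fun c => integrableOn_const (by simp [I])
  have hfI : IntegrableOn f I := LocallyIntegrable.integrableOn_Ioo' hf _ _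
  have h1 : ∫ θ in I, ‖f θ - c‖ ≤ ∫ θ in I, (‖f θ - c'‖ + ‖c' - c‖) :=
    integral_mono (hfI.sub (hc c)).norm ((hfI.sub (hc c')).norm.add
      (integrableOn_const (by simp [I]))) fun θ => norm_sub_le_norm_sub_add_norm_sub _ _ _
  have hn : Integrable (fun θ => ‖f θ - c'‖) (volume.restrict I) := (hfI.sub (hc c')).norm
  rw [integral_add hn (integrableOn_const (by simp [I])), setIntegral_const, hvol, smul_eq_mul] at h1
  have h2 := mul_le_mul_of_nonneg_left h1 (by positivity : 0 ≤ (2 * Real.pi * t)⁻¹)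
  rw [mul_add, inv_mul_cancel_left₀ (by positivity)] at h2
  exact h2

theorem meanOsc_le {f : ℝ → ℂ} (hf : LocallyIntegrable f) (c : ℂ) (θ₀ : ℝ) {t : ℝ}
    (ht : 0 < t) : meanOsc f θ₀ t ≤ 2 * arcMean (fun θ => ‖f θ - c‖) θ₀ t := by
  have h1 := arcMean_norm_sub_le hf (arcAvg f θ₀ t) c θ₀ ht
  have h2 := norm_arcAvg_sub_le hf c θ₀ ht
  rw [norm_sub_rev] at h2
  have h3 : meanOsc f θ₀ t = arcMean (fun θ => ‖f θ - arcAvg f θ₀ t‖) θ₀ t := rfl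
  linarith

theorem arcMean_le_mul_arcMean {g : ℝ → ℝ} (hg : LocallyIntegrable g) (hpos : ∀ θ, 0 ≤ g θ)
    (θ₀ : ℝ) {s t : ℝ} (hs : 0 < s) (hst : s ≤ t) : arcMean g θ₀ s ≤ t / s * arcMean g θ₀ t := by
  have hπ := Real.pi_pos
  have ht := hs.trans_le hst
  have h1 : ∫ θ in Ioo (θ₀ - Real.pi * s) (θ₀ + Real.pi * s), g θ ≤
      ∫ θ in Ioo (θ₀ - Real.pi * t) (θ₀ + Real.pi * t), g θ :=
    setIntegral_mono_set (LocallyIntegrable.integrableOn_Ioo' hg _ _) (Eventually.of_forall hpos)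
      (Ioo_subset_Ioo (by nlinarith) (by nlinarith)).eventuallyLE
  have h2 := mul_le_mul_of_nonneg_left h1 (by positivity : 0 ≤ (2 * Real.pi * s)⁻¹)
  refine h2.trans (le_of_eq ?_)
  rw [arcMean]
  field_simp

theorem exists_two_pow_mul {δ : ℝ} (hδ : 0 < δ) : ∃ n : ℕ, 1 ≤ 2 ^ n * δ := by
  obtain ⟨n, hn⟩ := pow_unbounded_of_one_lt (1 / δ) (one_lt_two : (1 : ℝ) < 2)
  exact ⟨n, by rw [div_lt_iff₀ hδ] at hn; exact hn.le⟩

theorem IsBMO.integrable {f : ℝ → ℂ} (hf : IsBMO f) : Integrable f angM := hf.2.1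

theorem exists_smul_circlePt {z : ℂ} (hz : z ∈ unitDisc) :
    ∃ r θ : ℝ, 0 ≤ r ∧ r < 1 ∧ z = r * circlePt θ :=
  ⟨‖z‖, z.arg, norm_nonneg _, hz, (Complex.norm_mul_exp_arg_mul_I z).symm⟩

theorem IsBMO.exists_integral_pm_le {f : ℝ → ℂ} (hf : IsBMO f) :
    ∃ C, ∀ z ∈ unitDisc, ∫ θ, ‖f θ - ∫ ξ, f ξ ∂pm z‖ ∂pm z ≤ C := by
  have hi := hf.integrable
  obtain ⟨hper, -, M, hM⟩ := hf
  have hloc : LocallyIntegrable f := Function.Periodic.locallyIntegrable_of_angM hper hi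
  refine ⟨2 * (48 * M), fun z hz => ?_⟩
  have hfin : ∀ c : ℂ, Integrable (fun θ => ‖f θ - c‖) angM := fun c =>
    (hi.sub continuous_const.integrable_angM).norm
  have hM0 : 0 ≤ M := le_trans (mul_nonneg (by have := Real.pi_pos; positivity)
    (integral_nonneg fun _ => norm_nonneg _)) (hM 0 1 one_pos le_rfl)
  suffices h : ∃ a : ℂ, ∫ θ, ‖f θ - a‖ ∂pm z ≤ 48 * M by
    obtain ⟨a, ha⟩ := h
    have hP := isProbabilityMeasure_pm hz
    have hi' := integrable_pm hz hi
    have h1 : ‖a - ∫ ξ, f ξ ∂pm z‖ ≤ ∫ θ, ‖f θ - a‖ ∂pm z := by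
      have : (∫ ξ, f ξ ∂pm z) - a = ∫ θ, (f θ - a) ∂pm z := by
        rw [integral_sub hi' (integrable_const _)]; simp
      rw [norm_sub_rev, this]
      exact norm_integral_le_integral_norm _
    have h2 : ∫ θ, ‖f θ - ∫ ξ, f ξ ∂pm z‖ ∂pm z ≤
        ∫ θ, (‖f θ - a‖ + ‖a - ∫ ξ, f ξ ∂pm z‖) ∂pm z :=
      integral_mono (hi'.sub (integrable_const _)).norm
        ((hi'.sub (integrable_const _)).norm.add (integrable_const _))
        fun θ => norm_sub_le_norm_sub_add_norm_sub _ _ _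
    have hn : Integrable (fun θ => ‖f θ - a‖) (pm z) := (hi'.sub (integrable_const _)).norm
    rw [integral_add hn (integrable_const _)] at h2
    simp only [integral_const, probReal_univ, smul_eq_mul, one_mul] at h2
    linarith
  obtain ⟨r, θ₀, h0, h1, rfl⟩ := exists_smul_circlePt hz
  obtain ⟨n, hn⟩ := exists_two_pow_mul (sub_pos.2 h1)
  set t : ℕ → ℝ := fun k => min (2 ^ k * (1 - r)) 1 with ht
  have ht0 : ∀ k, 0 < t k := fun k => lt_min (by have := sub_pos.2 h1; positivity) one_pos
  have ht1 : ∀ k, t k ≤ 1 := fun k => min_le_right _ _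
  have htm : ∀ k, t k ≤ t (k + 1) := fun k => by
    refine min_le_min_right _ (mul_le_mul_of_nonneg_right ?_ (sub_pos.2 h1).le)
    exact pow_le_pow_right₀ one_le_two (Nat.le_succ k)
  have htd : ∀ k, t (k + 1) ≤ 2 * t k := fun k => by
    simp only [ht]
    rw [mul_min_of_nonneg _ _ (by norm_num : (0 : ℝ) ≤ 2)]
    exact min_le_min (by rw [pow_succ]; linarith) (by norm_num)
  have hstep : ∀ k, ‖arcAvg f θ₀ (t (k + 1)) - arcAvg f θ₀ (t k)‖ ≤ 2 * M := by
    intro k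
    rw [norm_sub_rev]
    refine (norm_arcAvg_sub_le hloc _ θ₀ (ht0 k)).trans ?_
    refine (arcMean_le_mul_arcMean ?_ (fun _ => norm_nonneg _) θ₀ (ht0 k) (htm k)).trans ?_
    · exact Function.Periodic.locallyIntegrable_of_angM (fun θ => by rw [hper θ]) (hfin _)
    · have h2 : arcMean (fun θ => ‖f θ - arcAvg f θ₀ (t (k + 1))‖) θ₀ (t (k + 1)) ≤ M :=
        hM θ₀ _ (ht0 _) (ht1 _)
      have h3 : t (k + 1) / t k ≤ 2 := (div_le_iff₀ (ht0 k)).2 (htd k)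
      exact mul_le_mul h3 h2 (arcMean_nonneg (fun _ => norm_nonneg _) _ (ht0 _).le) (by norm_num)
  have hacc : ∀ k : ℕ, ‖arcAvg f θ₀ (t k) - arcAvg f θ₀ (t 0)‖ ≤ 2 * k * M := by
    intro k
    induction k with
    | zero => simp
    | succ k ih =>
      have h2 := norm_sub_le_norm_sub_add_norm_sub (arcAvg f θ₀ (t (k + 1))) (arcAvg f θ₀ (t k))
        (arcAvg f θ₀ (t 0))
      push_cast
      linarith [hstep k]
  have hmean : ∀ k : ℕ, arcMean (fun θ => ‖f θ - arcAvg f θ₀ (t 0)‖) θ₀ (t k) ≤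
      (2 * k + 1) * M := by
    intro k
    have h2 := arcMean_norm_sub_le hloc (arcAvg f θ₀ (t 0)) (arcAvg f θ₀ (t k)) θ₀ (ht0 k)
    have h3 : arcMean (fun θ => ‖f θ - arcAvg f θ₀ (t k)‖) θ₀ (t k) ≤ M := hM θ₀ _ (ht0 _) (ht1 _)
    linarith [hacc k]
  refine ⟨arcAvg f θ₀ (t 0), ?_⟩
  refine (integral_pm_le_sum_arcMean (fun θ => by simp only [hper θ]) (hfin _)
    (fun _ => norm_nonneg _) h0 h1 hn θ₀).trans ?_
  have h4 : ∑ k ∈ Finset.range (n + 1), 8 * (1 / 2) ^ k *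
      arcMean (fun θ => ‖f θ - arcAvg f θ₀ (t 0)‖) θ₀ (t k) ≤
      ∑ k ∈ Finset.range (n + 1), 8 * M * ((1 / 2 : ℝ) ^ k * (2 * k + 1)) := by
    refine Finset.sum_le_sum fun k _ => ?_
    have := mul_le_mul_of_nonneg_left (hmean k) (by positivity : (0 : ℝ) ≤ 8 * (1 / 2) ^ k)
    linarith
  refine h4.trans ?_
  rw [← Finset.mul_sum, sum_range_two_mul_add_one_div_pow]
  have h5 : (0 : ℝ) ≤ (4 * (n + 1 : ℕ) + 6) * (1 / 2) ^ (n + 1) := by positivity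
  nlinarith

theorem tendsto_integral_pm_of_arcMean {g : ℝ → ℝ} (hg : Function.Periodic g (2 * Real.pi))
    (hi : Integrable g angM) (hpos : ∀ θ, 0 ≤ g θ) {θ₀ : ℝ}
    (h : Tendsto (arcMean g θ₀) (𝓝[>] 0) (𝓝 0)) :
    Tendsto (fun r : ℝ => ∫ θ, g θ ∂pm (r * circlePt θ₀)) (𝓝[<] 1) (𝓝 0) := by
  have hloc := hg.locallyIntegrable_of_angM hi
  obtain ⟨D, hD⟩ : ∃ D, ∀ t, 0 < t → t ≤ 1 → arcMean g θ₀ t ≤ D := by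
    have h1 : ∀ᶠ t in 𝓝[>] (0 : ℝ), arcMean g θ₀ t < 1 := h.eventually_lt_const one_pos
    obtain ⟨τ, hτ, hτ'⟩ := mem_nhdsGT_iff_exists_Ioo_subset.1 h1
    have hτ0 : 0 < τ := hτ
    have hnn := arcMean_nonneg hpos θ₀ zero_le_one
    refine ⟨max 1 (1 / τ * arcMean g θ₀ 1), fun t h0 h1 => ?_⟩
    by_cases htτ : t < τ
    · exact (le_of_lt (hτ' ⟨h0, htτ⟩)).trans (le_max_left _ _)
    · refine le_trans ?_ (le_max_right _ _)
      refine (arcMean_le_mul_arcMean hloc hpos θ₀ h0 h1).trans ?_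
      exact mul_le_mul_of_nonneg_right (one_div_le_one_div_of_le hτ0 (not_lt.1 htτ)) hnn
  let F : ℝ → ℕ → ℝ := fun r k => 8 * (1 / 2) ^ k * arcMean g θ₀ (min (2 ^ k * (1 - r)) 1)
  have hev : ∀ᶠ r : ℝ in 𝓝[<] 1, 0 < r ∧ r < 1 := by
    filter_upwards [Ioo_mem_nhdsLT (zero_lt_one (α := ℝ))] with r hr using hr
  have hmin : ∀ {r : ℝ}, r < 1 → ∀ k : ℕ, 0 < min (2 ^ k * (1 - r)) 1 := fun hr k =>
    lt_min (by have := sub_pos.2 hr; positivity) one_pos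
  have hF0 : ∀ {r : ℝ}, r < 1 → ∀ k, 0 ≤ F r k := fun hr k =>
    mul_nonneg (by positivity) (arcMean_nonneg hpos θ₀ (hmin hr k).le)
  have hFb : ∀ {r : ℝ}, r < 1 → ∀ k, F r k ≤ 8 * D * (1 / 2) ^ k := fun hr k => by
    have := mul_le_mul_of_nonneg_left (hD _ (hmin hr k) (min_le_right _ _))
      (by positivity : (0 : ℝ) ≤ 8 * (1 / 2) ^ k)
    simp only [F]
    linarith
  have hsum : Summable fun k : ℕ => 8 * D * (1 / 2 : ℝ) ^ k := summable_geometric_two.mul_left _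
  have hlim : Tendsto (fun r => ∑' k, F r k) (𝓝[<] 1) (𝓝 (∑' _ : ℕ, (0 : ℝ))) := by
    refine tendsto_tsum_of_dominated_convergence hsum (fun k => ?_) ?_
    · have h1 : Tendsto (fun r : ℝ => min (2 ^ k * (1 - r)) 1) (𝓝[<] 1) (𝓝[>] 0) := by
        refine tendsto_nhdsWithin_iff.2 ⟨?_, hev.mono fun r hr => hmin hr.2 k⟩
        have hc : Continuous fun r : ℝ => min (2 ^ k * (1 - r)) 1 := by fun_prop
        have := (hc.tendsto 1).mono_left (nhdsWithin_le_nhds (s := Iio 1))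
        simpa using this
      have := (h.comp h1).const_mul (8 * (1 / 2) ^ k)
      simpa [F] using this
    · filter_upwards [hev] with r hr k
      rw [Real.norm_of_nonneg (hF0 hr.2 k)]
      exact hFb hr.2 k
  rw [tsum_zero] at hlim
  refine tendsto_of_tendsto_of_tendsto_of_le_of_le' tendsto_const_nhds hlim
    (Eventually.of_forall fun r => integral_nonneg hpos) ?_
  filter_upwards [hev] with r hr
  obtain ⟨n, hn⟩ := exists_two_pow_mul (sub_pos.2 hr.2)
  refine (integral_pm_le_sum_arcMean hg hi hpos hr.1.le hr.2 hn θ₀).trans ?_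
  exact (Summable.of_nonneg_of_le (hF0 hr.2) (hFb hr.2) hsum).sum_le_tsum _
    fun k _ => hF0 hr.2 k

/-- Fatou's theorem: Poisson integrals have radial limits almost everywhere. -/
theorem ae_tendsto_integral_pm {E : Type*} [NormedAddCommGroup E] [NormedSpace ℝ E]
    [CompleteSpace E] {g : ℝ → E} (hi : Integrable g angM) :
    ∀ᵐ θ₀ ∂angM, Tendsto (fun r : ℝ => ∫ θ, g θ ∂pm (r * circlePt θ₀)) (𝓝[<] 1) (𝓝 (g θ₀)) := by
  have hπ := Real.pi_pos
  let p : ℝ → E := fun θ => g (toIocMod Real.two_pi_pos 0 θ)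
  have hpg : ∀ θ ∈ Ioc 0 (2 * Real.pi), p θ = g θ := fun θ hθ => by
    have : toIocMod Real.two_pi_pos 0 θ = θ := (toIocMod_eq_self _).2 (by simpa using hθ)
    simp only [p, this]
  have hae : p =ᵐ[angM] g := (ae_restrict_iff' measurableSet_Ioc).2 (Eventually.of_forall hpg)
  have hper : Function.Periodic p (2 * Real.pi) := fun θ => by
    simp only [p, toIocMod_periodic Real.two_pi_pos 0 θ]
  have hip : Integrable p angM := hi.congr hae.symm
  have hloc := hper.locallyIntegrable_of_angM hip
  have hleb := (IsUnifLocDoublingMeasure.ae_tendsto_average_norm_sub (μ := (volume : Measure ℝ)) hloc 1)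
  have hleb' : ∀ᵐ θ₀ ∂angM, ∀ {ι : Type} {l : Filter ι} (w : ι → ℝ) (δ : ι → ℝ)
      (_ : Tendsto δ l (𝓝[>] 0)) (_ : ∀ᶠ j in l, θ₀ ∈ Metric.closedBall (w j) (1 * δ j)),
      Tendsto (fun j => ⨍ y in Metric.closedBall (w j) (δ j), ‖p y - p θ₀‖) l (𝓝 0) :=
    ae_restrict_of_ae hleb
  filter_upwards [hleb', ae_restrict_mem measurableSet_Ioc] with θ₀ hθ₀ hmem
  have hscale : Tendsto (fun t : ℝ => Real.pi * t) (𝓝[>] 0) (𝓝[>] 0) := by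
    refine tendsto_nhdsWithin_iff.2 ⟨?_, ?_⟩
    · have hc : Continuous fun t : ℝ => Real.pi * t := by fun_prop
      simpa using (hc.tendsto 0).mono_left (nhdsWithin_le_nhds (s := Ioi 0))
    · filter_upwards [self_mem_nhdsWithin] with t ht
      exact mul_pos hπ ht
  have h1 := hθ₀ (fun _ => θ₀) (fun t : ℝ => Real.pi * t) hscale (by
    filter_upwards [self_mem_nhdsWithin] with t ht
    have : (0 : ℝ) < t := ht
    exact Metric.mem_closedBall_self (by positivity))
  have h2 : Tendsto (arcMean (fun θ => ‖p θ - p θ₀‖) θ₀) (𝓝[>] 0) (𝓝 0) := by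
    refine h1.congr' ?_
    filter_upwards [self_mem_nhdsWithin] with t ht
    have ht0 : (0 : ℝ) < t := ht
    rw [setAverage_eq, Real.closedBall_eq_Icc, integral_Icc_eq_integral_Ioo,
      Real.volume_real_Icc_of_le (by nlinarith), arcMean, smul_eq_mul]
    congr 2
    ring
  have h3 := tendsto_integral_pm_of_arcMean (fun θ => congrArg (fun x => ‖x - p θ₀‖) (hper θ))
    (hip.sub continuous_const.integrable_angM).norm (fun _ => norm_nonneg _) h2
  rw [tendsto_iff_norm_sub_tendsto_zero]
  refine squeeze_zero' (Eventually.of_forall fun _ => norm_nonneg _) ?_ h3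
  filter_upwards [Ioo_mem_nhdsLT (zero_lt_one (α := ℝ))] with r hr
  have hz := smul_circlePt_mem hr.1.le hr.2 θ₀
  have hP := isProbabilityMeasure_pm hz
  have h4 : (∫ θ, g θ ∂pm (r * circlePt θ₀)) - g θ₀ = ∫ θ, (p θ - p θ₀) ∂pm (r * circlePt θ₀) := by
    rw [integral_sub (integrable_pm hz hip) (integrable_const _),
      integral_congr_ae (ae_pm_of_ae hae), hpg θ₀ hmem]
    simp
  rw [h4]
  exact norm_integral_le_integral_norm _

theorem memLp_two_of_continuous {E : Type*} [NormedAddCommGroup E] {g : ℝ → E} (hg : Continuous g)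
    {z : ℂ} (hz : z ∈ unitDisc) [MeasurableSpace E] [BorelSpace E] [SecondCountableTopology E] :
    MemLp g 2 (pm z) := by
  rw [memLp_two_iff_integrable_sq_norm hg.aestronglyMeasurable]
  exact integrable_pm hz (by fun_prop : Continuous fun x => ‖g x‖ ^ 2).integrable_angM

theorem integral_norm_sub_sq {α E : Type*} [MeasurableSpace α] {μ : Measure α}
    [IsProbabilityMeasure μ] [NormedAddCommGroup E] [InnerProductSpace ℝ E] [CompleteSpace E]
    {g : α → E} (hg : MemLp g 2 μ) (c : E) :
    ∫ x, ‖g x - c‖ ^ 2 ∂μ = ∫ x, ‖g x - ∫ y, g y ∂μ‖ ^ 2 ∂μ + ‖(∫ y, g y ∂μ) - c‖ ^ 2 := by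
  set m := ∫ y, g y ∂μ with hm
  have hi : Integrable g μ := hg.integrable one_le_two
  have hs : Integrable (fun x => ‖g x - m‖ ^ 2) μ := (hg.sub (memLp_const m)).integrable_norm_pow two_ne_zero
  have hin : Integrable (fun x => inner ℝ (m - c) (g x - m)) μ :=
    (hi.sub (integrable_const m)).const_inner _
  have hzero : ∫ x, inner ℝ (m - c) (g x - m) ∂μ = 0 := by
    have : Integrable (fun x => g x - m) μ := hi.sub (integrable_const m)
    rw [integral_inner this, integral_sub hi (integrable_const m)]
    simp [← hm]
  have h1 : ∀ x, ‖g x - c‖ ^ 2 = ‖g x - m‖ ^ 2 + (2 * inner ℝ (m - c) (g x - m) + ‖m - c‖ ^ 2) := by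
    intro x
    have : g x - c = (g x - m) + (m - c) := by abel
    rw [this, norm_add_sq_real, real_inner_comm]
    ring
  simp_rw [h1]
  have h2 : Integrable (fun x => 2 * inner ℝ (m - c) (g x - m) + ‖m - c‖ ^ 2) μ :=
    (hin.const_mul 2).add (integrable_const _)
  rw [integral_add hs h2, integral_add (hin.const_mul 2) (integrable_const _), integral_const_mul, hzero]
  simp

theorem integral_norm_sub_integral_sq {α E : Type*} [MeasurableSpace α] {μ : Measure α}
    [IsProbabilityMeasure μ] [NormedAddCommGroup E] [InnerProductSpace ℝ E] [CompleteSpace E]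
    {g : α → E} (hg : MemLp g 2 μ) :
    ∫ x, ‖g x - ∫ y, g y ∂μ‖ ^ 2 ∂μ = ∫ x, ‖g x‖ ^ 2 ∂μ - ‖∫ y, g y ∂μ‖ ^ 2 := by
  have := integral_norm_sub_sq hg 0
  simp only [sub_zero] at this
  linarith

theorem integral_norm_sq_step {f : ℂ → ℂ} (hf : DiffContOnCl ℂ f (Metric.ball 0 1)) {C S : ℝ}
    (h1 : ∀ z ∈ unitDisc, ∫ θ, ‖f (circlePt θ) - f z‖ ∂pm z ≤ C)
    (h2 : ∀ z ∈ unitDisc, ∫ θ, ‖f (circlePt θ) - f z‖ ^ 2 ∂pm z ≤ S) {z₀ : ℂ}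
    (hz₀ : z₀ ∈ unitDisc) :
    ∫ θ, ‖f (circlePt θ) - f z₀‖ ^ 2 ∂pm z₀ ≤ S / 2 + (2 * (C + 1)) ^ 2 + 1 := by
  have hC : 0 ≤ C := (integral_nonneg fun _ => norm_nonneg _).trans (h1 _ hz₀)
  have hS : 0 ≤ S := (integral_nonneg fun _ => sq_nonneg _).trans (h2 _ hz₀)
  have hfc : ContinuousOn f (Metric.closedBall 0 1) := by
    have := hf.continuousOn
    rwa [closure_ball _ one_ne_zero] at this
  have hsph : Metric.sphere (0 : ℂ) 1 ⊆ Metric.closedBall 0 1 := Metric.sphere_subset_closedBall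
  set c := f z₀
  have hfcirc : Continuous fun θ => f (circlePt θ) :=
    hfc.comp_continuous continuous_circlePt fun θ => by simp
  obtain ⟨p, hp, -, hpa⟩ := exists_re_approx (g := fun z => ‖f z - c‖)
    ((hfc.mono hsph).sub continuousOn_const).norm one_half_pos
  obtain ⟨q, hq, -, hqa⟩ := exists_re_approx (g := fun z => ‖f z - c‖ ^ 2)
    (((hfc.mono hsph).sub continuousOn_const).norm.pow 2) one_half_pos
  have hharm : ∀ {p : ℂ → ℂ}, Differentiable ℂ p → ∀ {z}, z ∈ unitDisc →
      ∫ θ, (p (circlePt θ)).re ∂pm z = (p z).re := fun hp _ hz =>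
    poisson_formula_re hp.diffContOnCl hz
  have hpc : ∀ {p : ℂ → ℂ}, Differentiable ℂ p → Continuous fun θ => (p (circlePt θ)).re :=
    fun hp => Complex.continuous_re.comp (hp.continuous.comp continuous_circlePt)
  have hmono : ∀ {z}, z ∈ unitDisc → ∀ {u v : ℝ → ℝ}, Continuous u → Continuous v →
      (∀ θ, u θ ≤ v θ) → ∫ θ, u θ ∂pm z ≤ ∫ θ, v θ ∂pm z := fun hz _ _ hu hv huv =>
    integral_mono (integrable_pm hz hu.integrable_angM) (integrable_pm hz hv.integrable_angM) huv
  have hconst : ∀ {z}, z ∈ unitDisc → ∀ {u : ℝ → ℝ}, Continuous u → ∀ a : ℝ,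
      ∫ θ, (u θ + a) ∂pm z = ∫ θ, u θ ∂pm z + a := by
    intro z hz u hu a
    have hP := isProbabilityMeasure_pm hz
    rw [integral_add (integrable_pm hz hu.integrable_angM) (integrable_const _)]
    simp
  have hadd : ∀ {u : ℝ → ℝ}, Continuous u → Continuous fun θ => u θ + 1 / 2 :=
    fun hu => hu.add continuous_const
  have hn1 : Continuous fun θ => ‖f (circlePt θ) - c‖ := (hfcirc.sub continuous_const).norm
  have hn2 : Continuous fun θ => ‖f (circlePt θ) - c‖ ^ 2 := hn1.pow 2
  set m : ℂ → ℝ := fun z => (p z).re + 1 / 2 with hm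
  have hmcont : Continuous m := (Complex.continuous_re.comp hp.continuous).add continuous_const
  set Λ : ℝ := 2 * (C + 1) with hΛ
  have hΛ0 : 0 < Λ := by positivity
  let U : Set ℂ := unitDisc ∩ {z | m z < Λ}
  have hUo : IsOpen U := isOpen_unitDisc.inter (isOpen_lt hmcont continuous_const)
  have hmc : ∀ θ, ‖f (circlePt θ) - c‖ ≤ m (circlePt θ) := fun θ => by
    have := (abs_le.1 (hpa θ)).1
    simp only [hm]; linarith
  have hm0 : m z₀ ≤ C + 1 := by
    have h3 := hmono hz₀ (hpc hp) (hadd hn1) fun θ => by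
      have := (abs_le.1 (hpa θ)).2
      linarith
    rw [hharm hp hz₀, hconst hz₀ hn1] at h3
    have := h1 _ hz₀
    simp only [hm]; linarith
  have hfm : ∀ z ∈ unitDisc, ‖f z - c‖ ≤ m z := by
    intro z hz
    have hP := isProbabilityMeasure_pm hz
    have h3 := hmono hz hn1 (hadd (hpc hp)) hmc
    rw [hconst hz (hpc hp), hharm hp hz] at h3
    refine le_trans ?_ h3
    have h4 : f z - c = ∫ θ, (f (circlePt θ) - c) ∂pm z := by
      rw [integral_sub (integrable_pm hz hfcirc.integrable_angM) (integrable_const _),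
        poisson_formula hf hz]
      simp
    rw [h4]
    exact norm_integral_le_integral_norm _
  have hX : (q z₀).re - S / Λ * m z₀ ≤ Λ ^ 2 + 1 / 2 := by
    refine le_of_jet_nonneg (U := U) (f := fun z => (q z).re - S / Λ * m z) hUo
      (isBounded_unitDisc.subset inter_subset_left) ?_ ?_ ?_ z₀ ⟨hz₀, ?_⟩
    · exact ((Complex.continuous_re.comp hq.continuous).sub
        (continuous_const.mul hmcont)).continuousOn
    · intro z hz
      refine ⟨_, _, (hasJet_re (hq.analyticAt z)).sub
        (((hasJet_re (hp.analyticAt z)).add (hasJet_const (1 / 2) z)).const_mul (S / Λ)), ?_⟩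
      simp
    · intro z hz
      have hcl : closure U ⊆ {z | m z ≤ Λ} := closure_minimal (fun w hw => le_of_lt (show m w < Λ from hw.2))
        (isClosed_le hmcont continuous_const)
      have hmΛ : m z ≤ Λ := hcl hz.1
      have hz1 : ‖z‖ ≤ 1 := by
        have : z ∈ closure unitDisc := closure_mono inter_subset_left hz.1
        rw [closure_unitDisc] at this
        simpa using this
      rcases hz1.lt_or_eq with h | h
      · have hzD : z ∈ unitDisc := h
        have hmeq : m z = Λ := by
          refine le_antisymm hmΛ (not_lt.1 fun hlt => ?_)
          have : z ∉ U := by rw [hUo.frontier_eq] at hz; exact hz.2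
          exact this ⟨hzD, hlt⟩
        have hP := isProbabilityMeasure_pm hzD
        have h5 := hmono hzD (hpc hq) (hadd hn2) fun θ => by
          have := (abs_le.1 (hqa θ)).2
          linarith
        rw [hharm hq hzD, hconst hzD hn2, integral_norm_sub_sq (memLp_two_of_continuous hfcirc hzD) c,
          poisson_formula hf hzD] at h5
        have h6 := h2 z hzD
        have h7 : ‖f z - c‖ ^ 2 ≤ Λ ^ 2 :=
          pow_le_pow_left₀ (norm_nonneg _) ((hfm z hzD).trans hmeq.le) 2
        simp only [hmeq, div_mul_cancel₀ _ hΛ0.ne']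
        linarith
      · obtain ⟨θ, rfl⟩ := exists_circlePt_of_norm_eq_one h
        have h5 := (abs_le.1 (hqa θ)).2
        have h6 : ‖f (circlePt θ) - c‖ ^ 2 ≤ Λ ^ 2 :=
          pow_le_pow_left₀ (norm_nonneg _) ((hmc θ).trans hmΛ) 2
        have h7 : 0 ≤ S / Λ * m (circlePt θ) :=
          mul_nonneg (by positivity) ((norm_nonneg _).trans (hmc θ))
        linarith
    · exact hm0.trans_lt (by rw [hΛ]; linarith)
  have h8 := hmono hz₀ hn2 (hadd (hpc hq)) fun θ => by
    have := (abs_le.1 (hqa θ)).1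
    linarith
  rw [hconst hz₀ (hpc hq), hharm hq hz₀] at h8
  have h9 : S / Λ * m z₀ ≤ S / 2 := by
    have := mul_le_mul_of_nonneg_left hm0 (by positivity : 0 ≤ S / Λ)
    refine this.trans (le_of_eq ?_)
    rw [hΛ]
    field_simp
  linarith

theorem integral_norm_sq_le_of_integral_norm_le {f : ℂ → ℂ}
    (hf : DiffContOnCl ℂ f (Metric.ball 0 1)) {C : ℝ}
    (h1 : ∀ z ∈ unitDisc, ∫ θ, ‖f (circlePt θ) - f z‖ ∂pm z ≤ C) {z : ℂ} (hz : z ∈ unitDisc) :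
    ∫ θ, ‖f (circlePt θ) - f z‖ ^ 2 ∂pm z ≤ 2 * ((2 * (C + 1)) ^ 2 + 1) := by
  have hfc : ContinuousOn f (Metric.closedBall 0 1) := by
    have := hf.continuousOn
    rwa [closure_ball _ one_ne_zero] at this
  obtain ⟨M, hM⟩ := (isCompact_closedBall (0 : ℂ) 1).exists_bound_of_continuousOn hfc
  let A := (fun z => ∫ θ, ‖f (circlePt θ) - f z‖ ^ 2 ∂pm z) '' unitDisc
  have hfcirc : Continuous fun θ => f (circlePt θ) :=
    hfc.comp_continuous continuous_circlePt fun θ => by simp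
  have hA : BddAbove A := by
    refine ⟨(M + M) ^ 2, ?_⟩
    rintro _ ⟨w, hw, rfl⟩
    have hP := isProbabilityMeasure_pm hw
    have h3 : ∫ θ, ‖f (circlePt θ) - f w‖ ^ 2 ∂pm w ≤ ∫ _, (M + M) ^ 2 ∂pm w := by
      refine integral_mono (integrable_pm hw
        ((hfcirc.sub continuous_const).norm.pow 2).integrable_angM) (integrable_const _) fun θ => ?_
      refine pow_le_pow_left₀ (norm_nonneg _) ((norm_sub_le _ _).trans (add_le_add ?_ ?_)) 2
      · exact hM _ (by simp)
      · exact hM _ (by simpa using (le_of_lt hw : ‖w‖ ≤ 1))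
    simpa using h3
  have h3 : sSup A ≤ sSup A / 2 + (2 * (C + 1)) ^ 2 + 1 := by
    refine csSup_le ⟨_, mem_image_of_mem _ hz⟩ ?_
    rintro _ ⟨w, hw, rfl⟩
    exact integral_norm_sq_step hf h1 (fun v hv => le_csSup hA (mem_image_of_mem _ hv)) hw
  have h4 := le_csSup hA (mem_image_of_mem _ hz)
  linarith

theorem memLp_pm {E : Type*} [NormedAddCommGroup E] {g : ℝ → E} (hg : MemLp g 2 angM) {z : ℂ}
    (hz : z ∈ unitDisc) : MemLp g 2 (pm z) := by
  rw [memLp_two_iff_integrable_sq_norm (hg.1.mono_ac (pm_absolutelyContinuous z))]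
  exact integrable_pm hz (hg.integrable_norm_pow two_ne_zero)

theorem diffContOnCl_dilate {F : ℂ → ℂ} (hF : DifferentiableOn ℂ F unitDisc) {r : ℝ}
    (h0 : 0 ≤ r) (h1 : r < 1) : DiffContOnCl ℂ (fun z => F (r * z)) (Metric.ball 0 1) := by
  refine DifferentiableOn.diffContOnCl ?_
  rw [closure_ball _ one_ne_zero]
  refine hF.comp (differentiable_id.const_mul _).differentiableOn fun z hz => ?_
  have hz1 : ‖z‖ ≤ 1 := by simpa using hz
  show ‖(r : ℂ) * z‖ < 1
  rw [norm_mul, Complex.norm_real, Real.norm_of_nonneg h0]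
  nlinarith [norm_nonneg z]

theorem continuous_dilate_circlePt {E : Type*} [TopologicalSpace E] {F : ℂ → E}
    (hF : ContinuousOn F unitDisc) {r : ℝ} (h0 : 0 ≤ r) (h1 : r < 1) :
    Continuous fun θ => F (r * circlePt θ) :=
  hF.comp_continuous (continuous_const.mul continuous_circlePt) fun θ => smul_circlePt_mem h0 h1 θ

theorem continuousOn_integral_pm {g : ℝ → ℝ} (hg : Integrable g angM) :
    ContinuousOn (fun z => ∫ θ, g θ ∂pm z) unitDisc :=
  (Complex.continuous_re.comp_continuousOn (differentiableOn_herg hg).continuousOn).congr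
    fun _ hz => (re_herg hg hz).symm

section SquareBounded

variable {α E : Type*} [MeasurableSpace α] {μ : Measure α}
  [NormedAddCommGroup E] {g : ℕ → α → E} {g' : α → E} {M : ℝ}

theorem memLp_two_of_tendsto (hg : ∀ n, MemLp (g n) 2 μ) (hM : ∀ n, ∫ x, ‖g n x‖ ^ 2 ∂μ ≤ M)
    (hlim : ∀ᵐ x ∂μ, Tendsto (fun n => g n x) atTop (𝓝 (g' x))) :
    MemLp g' 2 μ ∧ ∫ x, ‖g' x‖ ^ 2 ∂μ ≤ M := by
  have hm : AEStronglyMeasurable g' μ := aestronglyMeasurable_of_tendsto_ae atTop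
    (fun n => (hg n).1) hlim
  have h0 : 0 ≤ M := (integral_nonneg fun _ => sq_nonneg _).trans (hM 0)
  have h1 : ∫⁻ x, ENNReal.ofReal (‖g' x‖ ^ 2) ∂μ ≤ ENNReal.ofReal M := by
    calc ∫⁻ x, ENNReal.ofReal (‖g' x‖ ^ 2) ∂μ
        = ∫⁻ x, liminf (fun n => ENNReal.ofReal (‖g n x‖ ^ 2)) atTop ∂μ := by
          refine lintegral_congr_ae ?_
          filter_upwards [hlim] with x hx
          exact ((ENNReal.tendsto_ofReal (hx.norm.pow 2)).liminf_eq).symm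
      _ ≤ liminf (fun n => ∫⁻ x, ENNReal.ofReal (‖g n x‖ ^ 2) ∂μ) atTop :=
          lintegral_liminf_le' fun n => ((hg n).1.norm.aemeasurable.pow_const 2).ennreal_ofReal
      _ ≤ ENNReal.ofReal M := by
          refine liminf_le_of_le (by isBoundedDefault) fun b hb => ?_
          obtain ⟨n, hn⟩ := hb.exists
          refine hn.trans ?_
          rw [← ofReal_integral_eq_lintegral_ofReal ((hg n).integrable_norm_pow two_ne_zero)
            (ae_of_all _ fun x => sq_nonneg _)]
          exact ENNReal.ofReal_le_ofReal (hM n)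
  have h2 : Integrable (fun x => ‖g' x‖ ^ 2) μ := by
    refine ⟨(hm.norm.aemeasurable.pow_const 2).aestronglyMeasurable, ?_⟩
    rw [hasFiniteIntegral_iff_ofReal (ae_of_all _ fun x => sq_nonneg _)]
    exact h1.trans_lt ENNReal.ofReal_lt_top
  refine ⟨(memLp_two_iff_integrable_sq_norm hm).2 h2, ?_⟩
  rw [← ofReal_integral_eq_lintegral_ofReal h2 (ae_of_all _ fun x => sq_nonneg _)] at h1
  exact (ENNReal.ofReal_le_ofReal_iff h0).1 h1

theorem tendsto_integral_of_sq_bounded [IsFiniteMeasure μ] [NormedSpace ℝ E] [CompleteSpace E]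
    (hg : ∀ n, MemLp (g n) 2 μ) (hM : ∀ n, ∫ x, ‖g n x‖ ^ 2 ∂μ ≤ M)
    (hlim : ∀ᵐ x ∂μ, Tendsto (fun n => g n x) atTop (𝓝 (g' x))) :
    Tendsto (fun n => ∫ x, g n x ∂μ) atTop (𝓝 (∫ x, g' x ∂μ)) := by
  obtain ⟨hg', hM'⟩ := memLp_two_of_tendsto hg hM hlim
  have h0 : 0 ≤ M := (integral_nonneg fun _ => sq_nonneg _).trans hM'
  have hi : ∀ n, Integrable (g n) μ := fun n => (hg n).integrable one_le_two
  have hi' : Integrable g' μ := hg'.integrable one_le_two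
  have hd : ∀ n, MemLp (fun x => g n x - g' x) 2 μ := fun n => (hg n).sub hg'
  have hd1 : ∀ n, Integrable (fun x => ‖g n x - g' x‖) μ := fun n => ((hi n).sub hi').norm
  have hd2 : ∀ n, Integrable (fun x => ‖g n x - g' x‖ ^ 2) μ := fun n =>
    (hd n).integrable_norm_pow two_ne_zero
  have hsq : ∀ n, ∫ x, ‖g n x - g' x‖ ^ 2 ∂μ ≤ 4 * M := by
    intro n
    have h1 : Integrable (fun x => 2 * ‖g n x‖ ^ 2) μ :=
      ((hg n).integrable_norm_pow two_ne_zero).const_mul 2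
    have h2 : Integrable (fun x => 2 * ‖g' x‖ ^ 2) μ :=
      (hg'.integrable_norm_pow two_ne_zero).const_mul 2
    have h3 : ∫ x, ‖g n x - g' x‖ ^ 2 ∂μ ≤ ∫ x, (2 * ‖g n x‖ ^ 2 + 2 * ‖g' x‖ ^ 2) ∂μ := by
      refine integral_mono (hd2 n) (h1.add h2) fun x => ?_
      have := norm_sub_le (g n x) (g' x)
      simp only
      nlinarith [norm_nonneg (g n x - g' x), sq_nonneg (‖g n x‖ - ‖g' x‖)]
    rw [integral_add h1 h2, integral_const_mul, integral_const_mul] at h3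
    linarith [hM n]
  rw [tendsto_iff_norm_sub_tendsto_zero]
  refine Metric.tendsto_atTop.2 fun ε hε => ?_
  set T : ℝ := (8 * M + 1) / ε with hT
  have hT0 : 0 < T := by positivity
  have hmin : Tendsto (fun n => ∫ x, min ‖g n x - g' x‖ T ∂μ) atTop (𝓝 (∫ _, (0 : ℝ) ∂μ)) := by
    refine tendsto_integral_of_dominated_convergence (fun _ => T)
      (fun n => ((hd1 n).1.aemeasurable.min aemeasurable_const).aestronglyMeasurable)
      (integrable_const _) (fun n => ae_of_all _ fun x => ?_) ?_
    · rw [Real.norm_of_nonneg (le_min (norm_nonneg _) hT0.le)]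
      exact min_le_right _ _
    · filter_upwards [hlim] with x hx
      have h1 := (tendsto_iff_norm_sub_tendsto_zero.1 hx).min (tendsto_const_nhds (x := T))
      rwa [min_eq_left hT0.le] at h1
  rw [integral_zero] at hmin
  obtain ⟨N, hN⟩ := Metric.tendsto_atTop.1 hmin (ε / 2) (half_pos hε)
  refine ⟨N, fun n hn => ?_⟩
  have h1 := hN n hn
  rw [Real.dist_eq, sub_zero] at h1 ⊢
  rw [abs_of_nonneg (norm_nonneg _), ← integral_sub (hi n) hi']
  have hmi : Integrable (fun x => min ‖g n x - g' x‖ T) μ :=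
    (hd1 n).mono' ((hd1 n).1.aemeasurable.min aemeasurable_const).aestronglyMeasurable
      (ae_of_all _ fun x => by
        rw [Real.norm_of_nonneg (le_min (norm_nonneg _) hT0.le)]
        exact min_le_left _ _)
  have hqi : Integrable (fun x => T⁻¹ * ‖g n x - g' x‖ ^ 2) μ := (hd2 n).const_mul _
  have h2 : ∫ x, ‖g n x - g' x‖ ∂μ ≤
      ∫ x, (min ‖g n x - g' x‖ T + T⁻¹ * ‖g n x - g' x‖ ^ 2) ∂μ := by
    refine integral_mono (hd1 n) (hmi.add hqi) fun x => ?_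
    simp only
    rcases le_total ‖g n x - g' x‖ T with h | h
    · rw [min_eq_left h]
      have : 0 ≤ T⁻¹ * ‖g n x - g' x‖ ^ 2 := by positivity
      linarith
    · have h3 : ‖g n x - g' x‖ ≤ T⁻¹ * ‖g n x - g' x‖ ^ 2 := by
        rw [inv_mul_eq_div, le_div_iff₀ hT0]
        nlinarith [norm_nonneg (g n x - g' x)]
      have h4 : 0 ≤ min ‖g n x - g' x‖ T := le_min (norm_nonneg _) hT0.le
      linarith
  rw [integral_add hmi hqi, integral_const_mul] at h2
  have h3 : T⁻¹ * ∫ x, ‖g n x - g' x‖ ^ 2 ∂μ ≤ ε / 2 := by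
    rw [inv_mul_le_iff₀ hT0, hT]
    have h5 : (8 * M + 1) / ε * (ε / 2) = 4 * M + 1 / 2 := by field_simp; ring
    linarith [hsq n]
  have h4 := (abs_lt.1 h1).2
  have h5 := norm_integral_le_integral_norm (μ := μ) fun x => g n x - g' x
  linarith

end SquareBounded

theorem tendsto_one_sub_inv : Tendsto (fun n : ℕ => 1 - 1 / ((n : ℝ) + 2)) atTop (𝓝[<] 1) := by
  refine tendsto_nhdsWithin_iff.2 ⟨?_, Eventually.of_forall fun n => ?_⟩
  · have : Tendsto (fun n : ℕ => 1 / ((n : ℝ) + 2)) atTop (𝓝 0) :=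
      tendsto_const_nhds.div_atTop (tendsto_natCast_atTop_atTop.atTop_add tendsto_const_nhds)
    simpa using tendsto_const_nhds.sub this
  · have : (0 : ℝ) < 1 / ((n : ℝ) + 2) := by positivity
    exact sub_lt_self _ this

theorem one_sub_inv_mem (n : ℕ) : 0 < 1 - 1 / ((n : ℝ) + 2) ∧ 1 - 1 / ((n : ℝ) + 2) < 1 := by
  have h : (0 : ℝ) < (n : ℝ) + 2 := by positivity
  have : (1 : ℝ) / ((n : ℝ) + 2) < 1 := by rw [div_lt_one h]; linarith [n.cast_nonneg (α := ℝ)]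
  have : (0 : ℝ) < 1 / ((n : ℝ) + 2) := by positivity
  constructor <;> linarith

theorem tendsto_dilate {F : ℂ → ℂ} (hF : ContinuousOn F unitDisc) {z : ℂ} (hz : z ∈ unitDisc) :
    Tendsto (fun r : ℝ => F (r * z)) (𝓝[<] 1) (𝓝 (F z)) := by
  have h1 : Tendsto (fun r : ℝ => (r : ℂ) * z) (𝓝[<] 1) (𝓝 z) := by
    have : Continuous fun r : ℝ => (r : ℂ) * z := by fun_prop
    have h2 := this.tendsto 1
    simp only [Complex.ofReal_one, one_mul] at h2
    exact h2.mono_left nhdsWithin_le_nhds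
  exact (hF.continuousAt (isOpen_unitDisc.mem_nhds hz)).tendsto.comp h1

theorem integral_pm_eq_of_hasRadialLimits {F : ℂ → ℂ} {Fb : ℝ → ℂ}
    (hF : DifferentiableOn ℂ F unitDisc) (hlim : HasRadialLimits F Fb) {M : ℝ}
    (hM : ∀ r : ℝ, 0 < r → r < 1 → ∫ θ, ‖F (r * circlePt θ)‖ ^ 2 ∂angM ≤ M) :
    MemLp Fb 2 angM ∧ ∀ z ∈ unitDisc, ∫ θ, Fb θ ∂pm z = F z := by
  have hmem : ∀ n : ℕ, MemLp (fun θ => F ((1 - 1 / ((n : ℝ) + 2) : ℝ) * circlePt θ)) 2 angM := by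
    intro n
    have hc := continuous_dilate_circlePt hF.continuousOn (one_sub_inv_mem n).1.le
      (one_sub_inv_mem n).2
    rw [memLp_two_iff_integrable_sq_norm hc.aestronglyMeasurable]
    exact (hc.norm.pow 2).integrable_angM
  have hl : ∀ᵐ θ ∂angM, Tendsto (fun n : ℕ => F ((1 - 1 / ((n : ℝ) + 2) : ℝ) * circlePt θ)) atTop
      (𝓝 (Fb θ)) := by
    filter_upwards [hlim] with θ hθ
    exact hθ.comp tendsto_one_sub_inv
  have hfin : IsFiniteMeasure angM := by unfold angM; infer_instance
  refine ⟨(memLp_two_of_tendsto hmem (fun n => hM _ (one_sub_inv_mem n).1 (one_sub_inv_mem n).2)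
    hl).1, fun z hz => ?_⟩
  have hP := isProbabilityMeasure_pm hz
  have h1 : ∀ n : ℕ, ∫ θ, ‖F ((1 - 1 / ((n : ℝ) + 2) : ℝ) * circlePt θ)‖ ^ 2 ∂pm z ≤
      (2 * Real.pi)⁻¹ * (2 / (1 - ‖z‖)) * M := by
    intro n
    have hi := (hmem n).integrable_norm_pow two_ne_zero
    have hz' : 0 < 1 - ‖z‖ := sub_pos.2 hz
    have hi' := integrable_pm hz hi
    rw [integral_pm hz]
    calc _ ≤ ∫ θ, (2 * Real.pi)⁻¹ * (2 / (1 - ‖z‖)) *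
          ‖F ((1 - 1 / ((n : ℝ) + 2) : ℝ) * circlePt θ)‖ ^ 2 ∂angM := by
          refine integral_mono_of_nonneg (ae_of_all _ fun θ => ?_) (hi.const_mul _)
            (ae_of_all _ fun θ => ?_)
          · have := pk_pos hz θ
            simp only [smul_eq_mul, Pi.zero_apply]
            positivity
          · have := pk_le hz θ
            simp only [smul_eq_mul]
            gcongr
      _ ≤ _ := by
          rw [integral_const_mul]
          have := hM _ (one_sub_inv_mem n).1 (one_sub_inv_mem n).2
          gcongr
  have h2 := tendsto_integral_of_sq_bounded (fun n => memLp_pm (hmem n) hz) h1 (ae_pm_of_ae hl)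
  have h3 : ∀ n : ℕ, ∫ θ, F ((1 - 1 / ((n : ℝ) + 2) : ℝ) * circlePt θ) ∂pm z =
      F ((1 - 1 / ((n : ℝ) + 2) : ℝ) * z) := fun n =>
    poisson_formula (diffContOnCl_dilate hF (one_sub_inv_mem n).1.le (one_sub_inv_mem n).2) hz
  simp_rw [h3] at h2
  exact tendsto_nhds_unique h2 ((tendsto_dilate hF.continuousOn hz).comp tendsto_one_sub_inv)

theorem MemBMOA.exists_integral_pm_sq_le {F : ℂ → ℂ} {Fb : ℝ → ℂ} (h : MemBMOA F Fb) :
    MemLp Fb 2 angM ∧ (∀ z ∈ unitDisc, ∫ θ, Fb θ ∂pm z = F z) ∧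
      ∃ S, ∀ z ∈ unitDisc, ∫ θ, ‖Fb θ - F z‖ ^ 2 ∂pm z ≤ S := by
  obtain ⟨⟨hF, M, hM⟩, hlim, hB⟩ := h
  have hM' : ∀ r : ℝ, 0 < r → r < 1 → ∫ θ, ‖F (r * circlePt θ)‖ ^ 2 ∂angM ≤ M := by
    intro r h0 h1
    have := hM r h0 h1
    simpa only [hardyIntegral, angM, Real.rpow_two] using this
  obtain ⟨hL, hP⟩ := integral_pm_eq_of_hasRadialLimits hF hlim hM'
  refine ⟨hL, hP, ?_⟩
  obtain ⟨C, hC⟩ := hB.exists_integral_pm_le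
  have hfin : IsFiniteMeasure angM := by unfold angM; infer_instance
  have hi : ∀ c, Integrable (fun θ => Fb θ - c) angM := fun c =>
    hB.integrable.sub (integrable_const c)
  have key : ∀ r : ℝ, 0 < r → r < 1 → ∀ z ∈ unitDisc,
      ∫ θ, ‖F (r * circlePt θ) - F (r * z)‖ ^ 2 ∂pm z ≤ 2 * ((2 * (C + 1)) ^ 2 + 1) := by
    intro r h0 h1 z hz
    refine integral_norm_sq_le_of_integral_norm_le (f := fun z => F (r * z))
      (diffContOnCl_dilate hF h0.le h1) (fun w hw => ?_) hz
    have hrw := smul_mem_unitDisc h0.le h1.le hw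
    refine le_trans ?_ (hC _ hrw)
    rw [hP _ hrw, ← integral_pm_semigroup h0.le h1 hw (hi _).norm]
    have hc := continuous_dilate_circlePt hF.continuousOn h0.le h1
    refine integral_mono (integrable_pm hw (hc.sub continuous_const).norm.integrable_angM)
      (integrable_pm hw (continuous_dilate_circlePt (continuousOn_integral_pm (hi _).norm)
        h0.le h1).integrable_angM) fun θ => ?_
    have hm := smul_circlePt_mem h0.le h1 θ
    have hPr := isProbabilityMeasure_pm hm
    have : F (r * circlePt θ) - F (r * w) = ∫ ξ, (Fb ξ - F (r * w)) ∂pm (r * circlePt θ) := by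
      rw [integral_sub (integrable_pm hm hB.integrable) (integrable_const _), hP _ hm]
      simp
    simp only
    rw [this]
    exact norm_integral_le_integral_norm _
  refine ⟨_, fun z hz => (memLp_two_of_tendsto (μ := pm z) (M := 2 * ((2 * (C + 1)) ^ 2 + 1))
    (g := fun n : ℕ => fun θ => F ((1 - 1 / ((n : ℝ) + 2) : ℝ) * circlePt θ) -
      F ((1 - 1 / ((n : ℝ) + 2) : ℝ) * z)) (fun n => ?_)
    (fun n => key _ (one_sub_inv_mem n).1 (one_sub_inv_mem n).2 z hz) ?_).2⟩
  · exact memLp_two_of_continuous ((continuous_dilate_circlePt hF.continuousOn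
      (one_sub_inv_mem n).1.le (one_sub_inv_mem n).2).sub continuous_const) hz
  · filter_upwards [ae_pm_of_ae hlim] with θ hθ
    exact (hθ.comp tendsto_one_sub_inv).sub
      ((tendsto_dilate hF.continuousOn hz).comp tendsto_one_sub_inv)

theorem pk_le_mul_pk {z w : ℂ} (hz : z ∈ unitDisc) (hzw : ‖w‖ = ‖z‖) {K θ : ℝ}
    (h : ‖circlePt θ - w‖ ≤ K * ‖circlePt θ - z‖) : pk z θ ≤ K ^ 2 * pk w θ := by
  have hw : w ∈ unitDisc := by rw [mem_unitDisc, hzw]; exact hz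
  have h1 : 0 < ‖circlePt θ - z‖ := norm_pos_iff.2 (circlePt_sub_ne_zero hz θ)
  have h2 : 0 < ‖circlePt θ - w‖ := norm_pos_iff.2 (circlePt_sub_ne_zero hw θ)
  have h3 : 0 ≤ 1 - ‖z‖ ^ 2 := by
    have : ‖z‖ < 1 := hz
    nlinarith [norm_nonneg z]
  simp only [pk, hzw]
  rw [← mul_div_assoc, div_le_div_iff₀ (by positivity) (by positivity)]
  have h4 := pow_le_pow_left₀ h2.le h 2
  rw [mul_pow] at h4
  nlinarith

theorem integral_pm_tail_le {z : ℂ} (hz : z ∈ unitDisc) {N : ℝ} (hN : 1 ≤ N)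
    (h : N * (1 - ‖z‖) < 1) :
    ∫ θ, {θ | N * (1 - ‖z‖) ≤ ‖circlePt θ - z‖}.indicator (fun _ => (1 : ℝ)) θ ∂pm z ≤ 8 / N := by
  have hz1 : 0 < 1 - ‖z‖ := sub_pos.2 hz
  obtain ⟨r, θ₀, hr0, hr1, rfl⟩ := exists_smul_circlePt hz
  rw [norm_smul_circlePt hr0] at hz1 h ⊢
  set w : ℂ := (1 - N * (1 - r) : ℝ) * circlePt θ₀ with hw_def
  have hN0 : 0 < N := one_pos.trans_le hN
  have hwn : ‖w‖ = 1 - N * (1 - r) := norm_smul_circlePt (by linarith) θ₀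
  have hw : w ∈ unitDisc := by
    rw [mem_unitDisc, hwn]
    have := mul_pos hN0 hz1
    linarith
  have hPw := isProbabilityMeasure_pm hw
  have hms : MeasurableSet {θ | N * (1 - r) ≤ ‖circlePt θ - r * circlePt θ₀‖} :=
    (isClosed_le continuous_const (continuous_circlePt.sub continuous_const).norm).measurableSet
  have hi : ∀ u ∈ unitDisc, Integrable (pk u) angM := fun u hu => (continuous_pk hu).integrable_angM
  have hwi : ∫ θ, (2 * Real.pi)⁻¹ * pk w θ ∂angM = 1 := by
    have := integral_pm hw fun _ => (1 : ℝ)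
    simpa using this.symm
  rw [integral_pm hz]
  calc _ ≤ ∫ θ, 8 / N * ((2 * Real.pi)⁻¹ * pk w θ) ∂angM := by
        refine integral_mono_of_nonneg (ae_of_all _ fun θ => ?_)
          (((hi w hw).const_mul _).const_mul _) (ae_of_all _ fun θ => ?_)
        · have := (pk_pos hz θ).le
          refine smul_nonneg (by positivity) (indicator_nonneg (fun _ _ => zero_le_one) _)
        · have hpw := (pk_pos hw θ).le
          by_cases hθ : θ ∈ {θ | N * (1 - r) ≤ ‖circlePt θ - r * circlePt θ₀‖}
          · simp only [indicator_of_mem hθ, smul_eq_mul, mul_one]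
            have hd : N * (1 - r) ≤ ‖circlePt θ - r * circlePt θ₀‖ := hθ
            set d := ‖circlePt θ - r * circlePt θ₀‖
            have hd0 : 0 < d := lt_of_lt_of_le (mul_pos hN0 hz1) hd
            have h1 : ‖circlePt θ - w‖ ≤ 2 * d := by
              have h2 : ‖(r : ℂ) * circlePt θ₀ - w‖ = (N - 1) * (1 - r) := by
                rw [hw_def, ← sub_mul, norm_mul, norm_circlePt, mul_one, ← Complex.ofReal_sub,
                  Complex.norm_real, Real.norm_of_nonneg]
                · ring
                · nlinarith
              have h3 := norm_sub_le_norm_sub_add_norm_sub (circlePt θ) (r * circlePt θ₀) w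
              rw [h2] at h3
              have : (N - 1) * (1 - r) ≤ N * (1 - r) := by nlinarith
              linarith
            have h4 : N * (1 - r) / (2 * d) ^ 2 ≤ pk w θ := by
              have h5 : 0 < ‖circlePt θ - w‖ := norm_pos_iff.2 (circlePt_sub_ne_zero hw θ)
              unfold pk
              rw [hwn]
              have h6 : N * (1 - r) ≤ 1 - (1 - N * (1 - r)) ^ 2 := by
                nlinarith [mul_pos hN0 hz1]
              have h7 : 0 ≤ N * (1 - r) := (mul_pos hN0 hz1).le
              have h10 := h7.trans h6
              gcongr
            have h8 : pk (r * circlePt θ₀) θ ≤ 2 * (1 - r) / d ^ 2 := by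
              have := pk_le_div_sq hz hd0 le_rfl
              rwa [norm_smul_circlePt hr0] at this
            have h9 : 2 * (1 - r) / d ^ 2 = 8 / N * (N * (1 - r) / (2 * d) ^ 2) := by
              field_simp
              norm_num
            calc (2 * Real.pi)⁻¹ * pk (r * circlePt θ₀) θ
                ≤ (2 * Real.pi)⁻¹ * (8 / N * pk w θ) := by
                  gcongr
                  rw [h9] at h8
                  exact h8.trans (by gcongr)
              _ = _ := by ring
          · simp only [indicator_of_notMem hθ, smul_zero]
            positivity
    _ = 8 / N := by rw [integral_const_mul, hwi, mul_one]

/-- The angles whose nontangential region of aperture `N` reaches, beyond radius `r`, a point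
where `b` exceeds `1 / N`. -/
def badSet (b : ℂ → ℝ) (N r : ℝ) : Set ℝ :=
  {θ | ∃ z ∈ unitDisc, r < ‖z‖ ∧ 1 / N < b z ∧ ‖circlePt θ - z‖ < N * (1 - ‖z‖)}

theorem isOpen_badSet (b : ℂ → ℝ) (N r : ℝ) : IsOpen (badSet b N r) := by
  have : badSet b N r = ⋃ z ∈ {z ∈ unitDisc | r < ‖z‖ ∧ 1 / N < b z},
      {θ | ‖circlePt θ - z‖ < N * (1 - ‖z‖)} := by
    ext θ
    simp only [badSet, mem_ofPred_eq, mem_iUnion, exists_prop]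
    constructor
    · rintro ⟨z, h1, h2, h3, h4⟩
      exact ⟨z, ⟨h1, h2, h3⟩, h4⟩
    · rintro ⟨z, ⟨h1, h2, h3⟩, h4⟩
      exact ⟨z, h1, h2, h3, h4⟩
  rw [this]
  exact isOpen_biUnion fun z _ =>
    isOpen_lt (continuous_circlePt.sub continuous_const).norm continuous_const

theorem tendsto_measure_badSet {b : ℂ → ℝ}
    (hH : ∀ K : ℝ, 1 ≤ K → ∀ z ∈ unitDisc, ∀ w, ‖w‖ = ‖z‖ →
      (∀ θ, pk z θ ≤ K * pk w θ) → b z ≤ K * b w)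
    (hb : ∀ᵐ θ ∂angM, Tendsto (fun r : ℝ => b (r * circlePt θ)) (𝓝[<] 1) (𝓝 0))
    {N : ℝ} (hN : 1 ≤ N) :
    Tendsto (fun k : ℕ => angM (badSet b N (1 - 1 / ((k : ℝ) + 2)))) atTop (𝓝 0) := by
  have hfin : IsFiniteMeasure angM := by unfold angM; infer_instance
  rw [← measure_empty (μ := angM)]
  refine tendsto_measure_of_ae_tendsto_indicator_of_isFiniteMeasure atTop MeasurableSet.empty
    (fun k => (isOpen_badSet _ _ _).measurableSet) ?_
  filter_upwards [hb] with θ hθ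
  have hN0 : 0 < N := one_pos.trans_le hN
  have hpos : 0 < 1 / N / (N + 2) ^ 2 := by positivity
  have h1 := hθ (Iio_mem_nhds hpos)
  obtain ⟨s, hs1, hs⟩ := mem_nhdsLT_iff_exists_Ioo_subset.1 h1
  have h2 := tendsto_one_sub_inv (Ioo_mem_nhdsLT (show s < 1 from hs1))
  filter_upwards [h2] with k hk
  simp only [mem_empty_iff_false, iff_false]
  rintro ⟨z, hz, hrz, hbz, hd⟩
  have hz1 : 0 < 1 - ‖z‖ := sub_pos.2 hz
  have h3 : b (‖z‖ * circlePt θ) < 1 / N / (N + 2) ^ 2 :=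
    hs ⟨lt_trans hk.1 hrz, show ‖z‖ < 1 from hz⟩
  have h4 : b z ≤ (N + 2) ^ 2 * b (‖z‖ * circlePt θ) := by
    refine hH _ (by nlinarith) z hz _ (norm_smul_circlePt (norm_nonneg z) θ) fun ξ => ?_
    refine pk_le_mul_pk hz (norm_smul_circlePt (norm_nonneg z) θ) ?_
    have h5 := one_sub_norm_le_norm_circlePt_sub z ξ
    have h6 := norm_sub_le_norm_sub_add_norm_sub (circlePt ξ) z (‖z‖ * circlePt θ)
    have h7 := norm_sub_le_norm_sub_add_norm_sub z (circlePt θ) (‖z‖ * circlePt θ)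
    rw [norm_circlePt_sub_smul (le_of_lt hz), norm_sub_rev z (circlePt θ)] at h7
    have h8 := mul_le_mul_of_nonneg_left h5 (by positivity : 0 ≤ N + 1)
    linarith
  rw [lt_div_iff₀ (by positivity)] at h3
  linarith

theorem summable_exp_mul_sub_sq (q : ℝ) :
    Summable fun n : ℕ => Real.exp (q * n) * Real.exp (-(n : ℝ) ^ 2) := by
  refine Summable.of_nonneg_of_le (fun n => by positivity) (fun n => ?_)
    ((Real.summable_exp_neg_nat).mul_left (Real.exp ((q + 1) ^ 2 / 4)))
  rw [← Real.exp_add, ← Real.exp_add, Real.exp_le_exp]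
  nlinarith [sq_nonneg ((n : ℝ) - (q + 1) / 2)]

theorem exists_exp_integrable_weight {A : ℕ → Set ℝ} (hA : ∀ n, MeasurableSet (A n))
    (hm : ∀ n, angM (A n) ≤ ENNReal.ofReal (Real.exp (-(n : ℝ) ^ 2))) :
    ∃ L : ℝ → ℝ, Measurable L ∧ (∀ θ, 0 ≤ L θ) ∧
      (∀ q : ℝ, 0 < q → Integrable (fun θ => Real.exp (q * L θ)) angM) ∧
      ∀ᵐ θ ∂angM, ∀ n, θ ∈ A n → (n : ℝ) ≤ L θ := by
  have hfin : IsFiniteMeasure angM := by unfold angM; infer_instance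
  set Λ : ℝ → ENNReal := fun θ => ⨆ n : ℕ, (A n).indicator (fun _ => (n : ENNReal)) θ with hΛ
  have hΛm : Measurable Λ := Measurable.iSup fun n => measurable_const.indicator (hA n)
  let S : ℝ → ℝ → ENNReal := fun q θ =>
    1 + ∑' n : ℕ, (A n).indicator (fun _ => ENNReal.ofReal (Real.exp (q * n))) θ
  have hSm : ∀ q, Measurable (S q) := fun q => measurable_const.add
    (show Measurable fun θ => ∑' n : ℕ,
      (A n).indicator (fun _ => ENNReal.ofReal (Real.exp (q * n))) θ from
        Measurable.tsum fun n => measurable_const.indicator (hA n))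
  have hSint : ∀ q, ∫⁻ θ, S q θ ∂angM ≠ ⊤ := by
    intro q
    simp only [S]
    rw [lintegral_add_left measurable_const, lintegral_const, one_mul,
      lintegral_tsum fun n => (measurable_const.indicator (hA n)).aemeasurable]
    refine ENNReal.add_ne_top.2 ⟨measure_ne_top _ _, ne_top_of_le_ne_top
      (summable_exp_mul_sub_sq q).tsum_ofReal_ne_top (ENNReal.tsum_le_tsum fun n => ?_)⟩
    rw [lintegral_indicator_const (hA n), ENNReal.ofReal_mul (Real.exp_pos _).le]
    gcongr
    exact hm n
  have hS1 : ∀ q θ, 1 ≤ S q θ := fun q θ => le_self_add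
  have hle : ∀ q θ, 0 < q → S q θ ≠ ⊤ → Λ θ ≤ ENNReal.ofReal (Real.log (S q θ).toReal / q) := by
    intro q θ hq hS
    refine iSup_le fun n => ?_
    by_cases hθ : θ ∈ A n
    · rw [indicator_of_mem hθ, ← ENNReal.ofReal_natCast]
      refine ENNReal.ofReal_le_ofReal ?_
      rw [le_div_iff₀ hq, mul_comm]
      have h1 : ENNReal.ofReal (Real.exp (q * n)) ≤ S q θ := by
        refine le_trans ?_ le_add_self
        refine le_trans (le_of_eq ?_) (ENNReal.le_tsum n)
        rw [indicator_of_mem hθ]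
      have h2 : Real.exp (q * n) ≤ (S q θ).toReal := (ENNReal.ofReal_le_iff_le_toReal hS).1 h1
      exact (Real.le_log_iff_exp_le ((Real.exp_pos _).trans_le h2)).2 h2
    · rw [indicator_of_notMem hθ]
      exact zero_le
  refine ⟨fun θ => (Λ θ).toReal, hΛm.ennreal_toReal, fun θ => ENNReal.toReal_nonneg,
    fun q hq => ?_, ?_⟩
  · have hSi : Integrable (fun θ => (S q θ).toReal) angM :=
      integrable_toReal_of_lintegral_ne_top (hSm q).aemeasurable (hSint q)
    refine hSi.mono'
      (Real.measurable_exp.comp (hΛm.ennreal_toReal.const_mul q)).aestronglyMeasurable ?_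
    filter_upwards [ae_lt_top (hSm q) (hSint q)] with θ hθ
    rw [Real.norm_of_nonneg (Real.exp_pos _).le]
    have h1 : 1 ≤ (S q θ).toReal := by
      simpa using ENNReal.toReal_mono hθ.ne (hS1 q θ)
    have h2 : (Λ θ).toReal ≤ Real.log (S q θ).toReal / q :=
      ENNReal.toReal_le_of_le_ofReal (div_nonneg (Real.log_nonneg h1) hq.le) (hle q θ hq hθ.ne)
    rw [le_div_iff₀ hq, mul_comm] at h2
    exact (Real.le_log_iff_exp_le (one_pos.trans_le h1)).1 h2
  · filter_upwards [ae_lt_top (hSm 1) (hSint 1)] with θ hθ n hn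
    have h1 : Λ θ ≠ ⊤ := ne_top_of_le_ne_top ENNReal.ofReal_ne_top (hle 1 θ one_pos hθ.ne)
    have h2 : (n : ENNReal) ≤ Λ θ := by
      refine le_trans (le_of_eq ?_) (le_iSup _ n)
      rw [indicator_of_mem hn]
    simpa using ENNReal.toReal_mono h1 h2

theorem exists_weight {b : ℂ → ℝ} {C : ℝ} (hbC : ∀ z ∈ unitDisc, 0 ≤ b z ∧ b z ≤ C)
    (hH : ∀ K : ℝ, 1 ≤ K → ∀ z ∈ unitDisc, ∀ w, ‖w‖ = ‖z‖ →
      (∀ θ, pk z θ ≤ K * pk w θ) → b z ≤ K * b w)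
    (hb : ∀ᵐ θ ∂angM, Tendsto (fun r : ℝ => b (r * circlePt θ)) (𝓝[<] 1) (𝓝 0)) :
    ∃ L : ℝ → ℝ, Measurable L ∧ (∀ θ, 0 ≤ L θ) ∧
      (∀ q : ℝ, 0 < q → Integrable (fun θ => Real.exp (q * L θ)) angM) ∧
      ∀ ε : ℝ, 0 < ε → ∃ ρ < 1, ∀ z ∈ unitDisc, ρ < ‖z‖ →
        b z * ∫ θ, Real.exp (-L θ) ∂pm z ≤ ε := by
  have hfin : IsFiniteMeasure angM := by unfold angM; infer_instance
  have hC : 0 ≤ C := (hbC 0 zero_mem_unitDisc).1.trans (hbC 0 zero_mem_unitDisc).2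
  have hex : ∀ n : ℕ, ∃ r : ℝ, 1 - 1 / ((n : ℝ) + 1) ≤ r ∧ r < 1 ∧
      angM (badSet b (n + 1) r) ≤ ENNReal.ofReal (Real.exp (-(n : ℝ) ^ 2)) := by
    intro n
    have h1 := tendsto_measure_badSet hH hb (N := n + 1) (by linarith [n.cast_nonneg (α := ℝ)])
    have h2 : ∀ᶠ k : ℕ in atTop, angM (badSet b (n + 1) (1 - 1 / ((k : ℝ) + 2))) <
        ENNReal.ofReal (Real.exp (-(n : ℝ) ^ 2)) := h1 (Iio_mem_nhds (ENNReal.ofReal_pos.2 (Real.exp_pos (-(n : ℝ) ^ 2))))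
    have h3 : 1 - 1 / ((n : ℝ) + 1) < 1 := by
      have : (0 : ℝ) < 1 / ((n : ℝ) + 1) := by positivity
      linarith
    obtain ⟨k, hk1, hk2⟩ := (h2.and (tendsto_one_sub_inv.eventually (Ioo_mem_nhdsLT h3))).exists
    exact ⟨_, hk2.1.le, hk2.2, le_of_lt hk1⟩
  choose r hr hr1 hrm using hex
  obtain ⟨L, hLm, hL0, hLi, hLA⟩ := exists_exp_integrable_weight
    (fun n => (isOpen_badSet b (n + 1) (r n)).measurableSet) hrm
  refine ⟨L, hLm, hL0, hLi, fun ε hε => ?_⟩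
  obtain ⟨n, hn⟩ := exists_nat_gt ((1 + 9 * C) / ε)
  refine ⟨r n, hr1 n, fun z hz hzr => ?_⟩
  have hP := isProbabilityMeasure_pm hz
  have hn1 : (0 : ℝ) < (n : ℝ) + 1 := by positivity
  have hnε : (1 + 9 * C) / ((n : ℝ) + 1) ≤ ε := by
    rw [div_lt_iff₀ hε] at hn
    rw [div_le_iff₀ hn1]
    nlinarith
  have hei : Integrable (fun θ => Real.exp (-L θ)) (pm z) := by
    refine (integrable_const (1 : ℝ)).mono' (by fun_prop) (ae_of_all _ fun θ => ?_)
    rw [Real.norm_of_nonneg (Real.exp_pos _).le]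
    exact Real.exp_le_one_iff.2 (neg_nonpos.2 (hL0 θ))
  have hv0 : 0 ≤ ∫ θ, Real.exp (-L θ) ∂pm z := integral_nonneg fun _ => (Real.exp_pos _).le
  rcases le_or_gt (b z) (1 / ((n : ℝ) + 1)) with h | h
  · have hv1 : ∫ θ, Real.exp (-L θ) ∂pm z ≤ 1 := by
      have : ∫ θ, Real.exp (-L θ) ∂pm z ≤ ∫ _, (1 : ℝ) ∂pm z :=
        integral_mono hei (integrable_const _) fun θ =>
          Real.exp_le_one_iff.2 (neg_nonpos.2 (hL0 θ))
      simpa using this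
    have h1 : b z * ∫ θ, Real.exp (-L θ) ∂pm z ≤ 1 / ((n : ℝ) + 1) := by
      have := mul_le_mul h hv1 hv0 (by positivity)
      simpa using this
    refine h1.trans (le_trans ?_ hnε)
    gcongr
    linarith
  · have hzn : ((n : ℝ) + 1) * (1 - ‖z‖) < 1 := by
      have h1 := (hr n).trans_lt hzr
      have h2 : 1 - ‖z‖ < 1 / ((n : ℝ) + 1) := by linarith
      rw [lt_div_iff₀ hn1] at h2
      linarith
    have htail := integral_pm_tail_le hz (N := n + 1) (by linarith [n.cast_nonneg (α := ℝ)]) hzn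
    set T := {θ | ((n : ℝ) + 1) * (1 - ‖z‖) ≤ ‖circlePt θ - z‖} with hT
    have hTi : Integrable (T.indicator fun _ => (1 : ℝ)) (pm z) :=
      (integrable_const (1 : ℝ)).indicator (isClosed_le continuous_const
        (continuous_circlePt.sub continuous_const).norm).measurableSet
    have hv : ∫ θ, Real.exp (-L θ) ∂pm z ≤
        ∫ θ, (Real.exp (-n) + T.indicator (fun _ => (1 : ℝ)) θ) ∂pm z := by
      refine integral_mono_ae hei ((integrable_const _).add hTi) ?_
      filter_upwards [ae_pm_of_ae hLA] with θ hθ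
      by_cases hθT : θ ∈ T
      · rw [indicator_of_mem hθT]
        have := Real.exp_le_one_iff.2 (neg_nonpos.2 (hL0 θ))
        have := Real.exp_pos (-(n : ℝ))
        linarith
      · rw [indicator_of_notMem hθT, add_zero, Real.exp_le_exp, neg_le_neg_iff]
        exact hθ n ⟨z, hz, hzr, h, not_le.1 hθT⟩
    rw [integral_add (integrable_const _) hTi] at hv
    simp only [integral_const, probReal_univ, one_smul] at hv
    have hexp : Real.exp (-(n : ℝ)) ≤ 1 / ((n : ℝ) + 1) := by
      rw [Real.exp_neg, ← one_div]
      exact one_div_le_one_div_of_le hn1 (Real.add_one_le_exp _)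
    have hv' : ∫ θ, Real.exp (-L θ) ∂pm z ≤ 9 / ((n : ℝ) + 1) := by
      have : (9 : ℝ) / ((n : ℝ) + 1) = 1 / ((n : ℝ) + 1) + 8 / ((n : ℝ) + 1) := by ring
      linarith
    calc b z * ∫ θ, Real.exp (-L θ) ∂pm z ≤ C * (9 / ((n : ℝ) + 1)) :=
          mul_le_mul (hbC z hz).2 hv' hv0 hC
      _ ≤ (1 + 9 * C) / ((n : ℝ) + 1) := by
          rw [← mul_div_assoc]
          gcongr
          linarith
      _ ≤ ε := hnε

theorem HasJet.sqrt_mul {f g : ℂ → ℝ} {z a a' : ℂ} {l : ℝ} (hf : HasJet f z a l)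
    (hg : HasJet g z a' 0) (hf0 : 0 < f z) (hg0 : 0 < g z) :
    ∃ A l', HasJet (fun w => √(f w * g w)) z A l' ∧ l' ≤ g z / (2 * √(f z * g z)) * l := by
  have hx : 0 < f z * g z := mul_pos hf0 hg0
  have h1 : ∀ᶠ x in 𝓝 (f z * g z), HasDerivAt (fun y : ℝ => √y) (1 / (2 * √x)) x := by
    filter_upwards [lt_mem_nhds hx] with x hx
    exact Real.hasDerivAt_sqrt hx.ne'
  set s := √(f z * g z) with hs
  have hs0 : 0 < s := Real.sqrt_pos.2 hx
  have hs2 : s ^ 2 = f z * g z := Real.sq_sqrt hx.le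
  have h2 : HasDerivAt (fun x : ℝ => 1 / (2 * √x)) (-(1 / (4 * s ^ 3))) (f z * g z) := by
    have h3 := ((Real.hasDerivAt_sqrt hx.ne').const_mul 2).fun_inv (by positivity)
    simp only [one_div]
    refine h3.congr_deriv ?_
    rw [← hs]
    field_simp
    norm_num
  refine ⟨_, _, (hf.mul hg).comp h1 h2, ?_⟩
  rw [← hs]
  have h4 : 4 * (f z * g z) * (a * starRingEnd ℂ a').re ≤ ‖(f z : ℂ) * a' + g z * a‖ ^ 2 := by
    have h5 : 0 ≤ ‖(f z : ℂ) * a' - g z * a‖ ^ 2 := sq_nonneg _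
    rw [← Complex.normSq_eq_norm_sq] at h5 ⊢
    simp only [Complex.normSq_apply, Complex.sub_re, Complex.sub_im, Complex.add_re,
      Complex.add_im, Complex.mul_re, Complex.mul_im, Complex.ofReal_re, Complex.ofReal_im,
      Complex.conj_re, Complex.conj_im] at h5 ⊢
    nlinarith
  have h6 : 1 / (2 * s) * (1 / 2 * (a * starRingEnd ℂ a').re) =
      1 / (16 * s ^ 3) * (4 * (f z * g z) * (a * starRingEnd ℂ a').re) := by
    rw [← hs2]
    field_simp
    ring
  have h7 : 1 / (16 * s ^ 3) * (4 * (f z * g z) * (a * starRingEnd ℂ a').re) ≤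
      1 / (16 * s ^ 3) * ‖(f z : ℂ) * a' + g z * a‖ ^ 2 := by gcongr
  have h8 : -(1 / (4 * s ^ 3)) / 4 * ‖(f z : ℂ) * a' + g z * a‖ ^ 2 =
      -(1 / (16 * s ^ 3) * ‖(f z : ℂ) * a' + g z * a‖ ^ 2) := by ring
  have h9 : g z / (2 * s) * l = 1 / (2 * s) * (g z * l) := by ring
  rw [h8, h9, mul_zero, zero_add, mul_add]
  linarith

theorem exp_integral_pm_le {g : ℝ → ℝ} {z : ℂ} (hz : z ∈ unitDisc) (hg : Integrable g angM)
    (he : Integrable (fun θ => Real.exp (g θ)) angM) :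
    Real.exp (∫ θ, g θ ∂pm z) ≤ ∫ θ, Real.exp (g θ) ∂pm z := by
  have hP := isProbabilityMeasure_pm hz
  exact convexOn_exp.map_integral_le Real.continuous_exp.continuousOn isClosed_univ
    (ae_of_all _ fun _ => mem_univ _) (integrable_pm hz hg) (integrable_pm hz he)

theorem integral_angM_semigroup {r : ℝ} (h0 : 0 ≤ r) (h1 : r < 1) {g : ℝ → ℝ}
    (hg : Integrable g angM) :
    ∫ ζ, ∫ ξ, g ξ ∂pm (r * circlePt ζ) ∂angM = ∫ ξ, g ξ ∂angM := by
  have h := integral_pm_semigroup h0 h1 zero_mem_unitDisc hg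
  rw [mul_zero, integral_pm_zero, integral_pm_zero] at h
  exact smul_right_injective _ (by positivity) h

theorem exists_multiplier {F : ℂ → ℂ} {b : ℂ → ℝ} {C : ℝ}
    (hbC : ∀ z ∈ unitDisc, 0 < b z ∧ b z ≤ C)
    (hH : ∀ K : ℝ, 1 ≤ K → ∀ z ∈ unitDisc, ∀ w, ‖w‖ = ‖z‖ →
      (∀ θ, pk z θ ≤ K * pk w θ) → b z ≤ K * b w)
    (hb : ∀ᵐ θ ∂angM, Tendsto (fun r : ℝ => b (r * circlePt θ)) (𝓝[<] 1) (𝓝 0))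
    (hj : ∀ z ∈ unitDisc, ∃ a l, HasJet b z a l ∧ l ≤ -‖deriv F z‖ ^ 2) :
    ∃ (E : ℂ → ℂ) (B : ℂ → ℝ) (C' : ℝ), DifferentiableOn ℂ E unitDisc ∧
      (∀ z ∈ unitDisc, E z ≠ 0 ∧ ‖E z‖ ≤ 1) ∧
      (∀ q : ℝ, 0 < q → ∃ M, ∀ r : ℝ, 0 < r → r < 1 →
        ∫ θ, ‖E (r * circlePt θ)‖ ^ (-q) ∂angM ≤ M) ∧
      (∀ z ∈ unitDisc, 0 ≤ B z ∧ B z ≤ C') ∧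
      (∀ z ∈ unitDisc, ∃ a l, HasJet B z a l ∧ l ≤ -‖deriv F z * E z‖ ^ 2) ∧
      ∀ ε : ℝ, 0 < ε → ∃ ρ < 1, ∀ z ∈ unitDisc, ρ < ‖z‖ → B z ≤ ε := by
  obtain ⟨L, hLm, hL0, hLi, hL⟩ := exists_weight (fun z hz => ⟨(hbC z hz).1.le, (hbC z hz).2⟩) hH hb
  have hfin : IsFiniteMeasure angM := by unfold angM; infer_instance
  have hC : 0 < C := (hbC 0 zero_mem_unitDisc).1.trans_le (hbC 0 zero_mem_unitDisc).2
  have hLint : Integrable L angM := by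
    refine (hLi 1 one_pos).mono' hLm.aestronglyMeasurable (ae_of_all _ fun θ => ?_)
    rw [Real.norm_of_nonneg (hL0 θ), one_mul]
    linarith [Real.add_one_le_exp (L θ)]
  have hei : Integrable (fun θ => Real.exp (-L θ)) angM := by
    refine (integrable_const (1 : ℝ)).mono' (by fun_prop) (ae_of_all _ fun θ => ?_)
    rw [Real.norm_of_nonneg (Real.exp_pos _).le]
    exact Real.exp_le_one_iff.2 (neg_nonpos.2 (hL0 θ))
  set v : ℂ → ℝ := fun z => ∫ θ, Real.exp (-L θ) ∂pm z with hv
  have hvE : ∀ z ∈ unitDisc, Real.exp (-∫ θ, L θ ∂pm z) ≤ v z := fun z hz => by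
    rw [← integral_neg]
    exact exp_integral_pm_le hz hLint.neg hei
  have hv0 : ∀ z ∈ unitDisc, 0 < v z := fun z hz => (Real.exp_pos _).trans_le (hvE z hz)
  have hv1 : ∀ z ∈ unitDisc, v z ≤ 1 := fun z hz => by
    have hP := isProbabilityMeasure_pm hz
    have : v z ≤ ∫ _, (1 : ℝ) ∂pm z := integral_mono (integrable_pm hz hei) (integrable_const _)
      fun θ => Real.exp_le_one_iff.2 (neg_nonpos.2 (hL0 θ))
    simpa using this
  have hEn : ∀ z ∈ unitDisc, ‖Complex.exp (-(1 / 4) * herg L z)‖ =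
      Real.exp (-(1 / 4) * ∫ θ, L θ ∂pm z) := fun z hz => by
    rw [Complex.norm_exp, ← re_herg hLint hz]
    congr 1
    simp [Complex.mul_re]
  refine ⟨fun z => Complex.exp (-(1 / 4) * herg L z), fun z => 2 * √C * √(b z * v z), 2 * √C * √C,
    ((differentiableOn_herg hLint).const_mul _).cexp, fun z hz => ⟨Complex.exp_ne_zero _, ?_⟩,
    fun q hq => ⟨∫ θ, Real.exp (q / 4 * L θ) ∂angM, fun r h0 h1 => ?_⟩, fun z hz => ⟨?_, ?_⟩,
    fun z hz => ?_, fun ε hε => ?_⟩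
  · rw [hEn z hz, Real.exp_le_one_iff]
    have : 0 ≤ ∫ θ, L θ ∂pm z := integral_nonneg hL0
    linarith
  · have hi := hLi (q / 4) (by positivity)
    rw [← integral_angM_semigroup h0.le h1 hi]
    refine integral_mono_of_nonneg (ae_of_all _ fun θ => by positivity)
      (continuous_dilate_circlePt (continuousOn_integral_pm hi) h0.le h1).integrable_angM
      (ae_of_all _ fun θ => ?_)
    have hm := smul_circlePt_mem h0.le h1 θ
    have h2 := exp_integral_pm_le hm (hLint.const_mul (q / 4)) hi
    simp only
    rw [hEn _ hm, ← Real.exp_mul]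
    rw [integral_const_mul] at h2
    refine le_trans (le_of_eq ?_) h2
    congr 1
    ring
  · positivity
  · have : b z * v z ≤ C := by
      have := mul_le_mul (hbC z hz).2 (hv1 z hz) (hv0 z hz).le hC.le
      simpa using this
    exact mul_le_mul_of_nonneg_left (Real.sqrt_le_sqrt this) (by positivity)
  · obtain ⟨a, l, hjb, hl⟩ := hj z hz
    obtain ⟨A, l', hj', hl'⟩ := hjb.sqrt_mul (hasJet_poisson hei hz) (hbC z hz).1 (hv0 z hz)
    refine ⟨_, _, hj'.const_mul (2 * √C), ?_⟩
    have hbz := (hbC z hz).1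
    have hvz := hv0 z hz
    have hlneg : l' ≤ v z / (2 * √(b z * v z)) * -‖deriv F z‖ ^ 2 :=
      hl'.trans (mul_le_mul_of_nonneg_left hl (by positivity))
    have hE2 : ‖Complex.exp (-(1 / 4) * herg L z)‖ ^ 2 ≤ √(v z) := by
      rw [hEn z hz]
      refine Real.le_sqrt_of_sq_le (le_trans (le_of_eq ?_) (hvE z hz))
      rw [← pow_mul, ← Real.exp_nat_mul]
      congr 1
      push_cast
      ring
    have hfac : √(v z) ≤ 2 * √C * (v z / (2 * √(b z * v z))) := by
      rw [Real.sqrt_mul hbz.le]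
      have h1 : 0 < √(v z) := Real.sqrt_pos.2 hvz
      have h2 : 0 < √(b z) := Real.sqrt_pos.2 hbz
      have h3 : √(b z) ≤ √C := Real.sqrt_le_sqrt (hbC z hz).2
      have h4 : 2 * √C * (v z / (2 * (√(b z) * √(v z)))) = √C / √(b z) * √(v z) := by
        nth_rewrite 1 [← Real.sq_sqrt hvz.le]
        field_simp
      rw [h4]
      exact le_mul_of_one_le_left h1.le ((one_le_div h2).2 h3)
    calc 2 * √C * l' ≤ 2 * √C * (v z / (2 * √(b z * v z)) * -‖deriv F z‖ ^ 2) :=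
          mul_le_mul_of_nonneg_left hlneg (by positivity)
      _ = -(2 * √C * (v z / (2 * √(b z * v z))) * ‖deriv F z‖ ^ 2) := by ring
      _ ≤ -(‖Complex.exp (-(1 / 4) * herg L z)‖ ^ 2 * ‖deriv F z‖ ^ 2) := by
          rw [neg_le_neg_iff]
          exact mul_le_mul_of_nonneg_right (hE2.trans hfac) (sq_nonneg _)
      _ = _ := by rw [norm_mul, mul_pow, mul_comm]
  · obtain ⟨ρ, hρ, h⟩ := hL ((ε / (2 * √C)) ^ 2) (by positivity)
    refine ⟨ρ, hρ, fun z hz hzρ => ?_⟩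
    have h1 := Real.sqrt_le_sqrt (h z hz hzρ)
    rw [Real.sqrt_sq (by positivity)] at h1
    have h2 : 0 < 2 * √C := by positivity
    rw [le_div_iff₀ h2] at h1
    linarith

theorem MemBMOA.exists_multiplier {F : ℂ → ℂ} {Fb : ℝ → ℂ} (h : MemBMOA F Fb) :
    ∃ (E : ℂ → ℂ) (B : ℂ → ℝ) (C : ℝ), DifferentiableOn ℂ E unitDisc ∧
      (∀ z ∈ unitDisc, E z ≠ 0 ∧ ‖E z‖ ≤ 1) ∧
      (∀ q : ℝ, 0 < q → ∃ M, ∀ r : ℝ, 0 < r → r < 1 →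
        ∫ θ, ‖E (r * circlePt θ)‖ ^ (-q) ∂angM ≤ M) ∧
      (∀ z ∈ unitDisc, 0 ≤ B z ∧ B z ≤ C) ∧
      (∀ z ∈ unitDisc, ∃ a l, HasJet B z a l ∧ l ≤ -‖deriv F z * E z‖ ^ 2) ∧
      ∀ ε : ℝ, 0 < ε → ∃ ρ < 1, ∀ z ∈ unitDisc, ρ < ‖z‖ → B z ≤ ε := by
  obtain ⟨hL2, hP, S, hS⟩ := h.exists_integral_pm_sq_le
  have hF : DifferentiableOn ℂ F unitDisc := h.1.1
  have hsq : Integrable (fun θ => ‖Fb θ‖ ^ 2) angM := hL2.integrable_norm_pow two_ne_zero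
  set b : ℂ → ℝ := fun z => ∫ θ, ‖Fb θ‖ ^ 2 ∂pm z - ‖F z‖ ^ 2 + (1 - ‖z‖ ^ 2) with hb
  have hfin : IsFiniteMeasure angM := by unfold angM; infer_instance
  have hvar : ∀ z ∈ unitDisc, ∫ θ, ‖Fb θ‖ ^ 2 ∂pm z - ‖F z‖ ^ 2 = ∫ θ, ‖Fb θ - F z‖ ^ 2 ∂pm z := by
    intro z hz
    have hPr := isProbabilityMeasure_pm hz
    rw [← hP z hz, integral_norm_sub_integral_sq (memLp_pm hL2 hz)]
  have hz1 : ∀ z ∈ unitDisc, 0 < 1 - ‖z‖ ^ 2 ∧ 1 - ‖z‖ ^ 2 ≤ 1 := fun z hz => by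
    have : ‖z‖ < 1 := hz
    constructor <;> nlinarith [norm_nonneg z]
  refine _root_.exists_multiplier (F := F) (b := b) (C := S + 1) (fun z hz => ?_) ?_ ?_ ?_
  · have h0 : 0 ≤ ∫ θ, ‖Fb θ - F z‖ ^ 2 ∂pm z := integral_nonneg fun _ => sq_nonneg _
    have h1 := hS z hz
    have h2 := hz1 z hz
    simp only [hb, hvar z hz]
    constructor <;> linarith
  · intro K hK z hz w hwz hpk
    have hw : w ∈ unitDisc := by rw [mem_unitDisc, hwz]; exact hz
    have hPr := isProbabilityMeasure_pm hz
    have h1 := integral_norm_sub_sq (memLp_pm hL2 hz) (F w)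
    rw [hP z hz] at h1
    have hi : Integrable (fun θ => ‖Fb θ - F w‖ ^ 2) angM :=
      (hL2.sub (memLp_const (F w))).integrable_norm_pow two_ne_zero
    have h2 : ∫ θ, ‖Fb θ - F w‖ ^ 2 ∂pm z ≤ K * ∫ θ, ‖Fb θ - F w‖ ^ 2 ∂pm w := by
      rw [integral_pm hz, integral_pm hw, ← integral_const_mul]
      have hK0 : 0 ≤ K := zero_le_one.trans hK
      refine integral_mono_of_nonneg (ae_of_all _ fun θ => ?_) ?_ (ae_of_all _ fun θ => ?_)
      · have := (pk_pos hz θ).le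
        simp only [smul_eq_mul, Pi.zero_apply]
        positivity
      · have h3 := integrable_pm hw hi
        refine Integrable.const_mul ?_ K
        exact (integrable_withDensity_iff_integrable_smul₀' (measurable_pk_weight hw).aemeasurable
          (ae_of_all _ fun _ => ENNReal.ofReal_lt_top)).1 h3 |>.congr (ae_of_all _ fun θ => by
            have := (pk_pos hw θ).le
            simp only
            rw [ENNReal.toReal_ofReal (by positivity)])
      · simp only [smul_eq_mul]
        have := hpk θ
        calc (2 * Real.pi)⁻¹ * pk z θ * ‖Fb θ - F w‖ ^ 2
            ≤ (2 * Real.pi)⁻¹ * (K * pk w θ) * ‖Fb θ - F w‖ ^ 2 := by gcongr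
          _ = _ := by ring
    have h3 := sq_nonneg ‖F z - F w‖
    have h4 := (hz1 w hw).1
    simp only [hb, hvar z hz, hvar w hw]
    rw [← hwz]
    nlinarith
  · filter_upwards [ae_tendsto_integral_pm hsq, h.2.1] with θ h1 h2
    have h3 : Tendsto (fun r : ℝ => 1 - ‖(r : ℂ) * circlePt θ‖ ^ 2) (𝓝[<] 1) (𝓝 0) := by
      have : Continuous fun r : ℝ => 1 - ‖(r : ℂ) * circlePt θ‖ ^ 2 := by fun_prop
      have h4 := this.tendsto 1
      simp only [Complex.ofReal_one, one_mul, norm_circlePt, one_pow, sub_self] at h4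
      exact h4.mono_left nhdsWithin_le_nhds
    have h4 := (h1.sub (h2.norm.pow 2)).add h3
    rw [sub_self, add_zero] at h4
    exact h4
  · intro z hz
    have hFa : AnalyticAt ℂ F z := hF.analyticAt (isOpen_unitDisc.mem_nhds hz)
    refine ⟨_, _, ((hasJet_poisson hsq hz).sub (hasJet_norm_sq hFa)).add
      ((hasJet_const 1 z).sub (hasJet_id_sq z)), ?_⟩
    linarith

theorem DifferentiableOn.exists_primitive {g : ℂ → ℂ} {R : ℝ}
    (hg : DifferentiableOn ℂ g (Metric.ball 0 R)) :
    ∃ G : ℂ → ℂ, G 0 = 0 ∧ ∀ z ∈ Metric.ball (0 : ℂ) R, HasDerivAt G (g z) z := by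
  obtain ⟨G, hG⟩ := hg.isExactOn_ball
  refine ⟨fun z => G z - G 0, sub_self _, fun z hz => ?_⟩
  simpa using (hG z hz).sub_const (G 0)

theorem integral_segment_eq {g G : ℂ → ℂ} {R : ℝ} (hg : ContinuousOn g (Metric.ball 0 R))
    (h0 : G 0 = 0) (hG : ∀ z ∈ Metric.ball (0 : ℂ) R, HasDerivAt G (g z) z) {z : ℂ}
    (hz : z ∈ Metric.ball (0 : ℂ) R) : ∫ t in (0 : ℝ)..1, z * g (t * z) = G z := by
  have hmem : ∀ t ∈ uIcc (0 : ℝ) 1, (t : ℂ) * z ∈ Metric.ball (0 : ℂ) R := by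
    intro t ht
    rw [uIcc_of_le zero_le_one] at ht
    rw [mem_ball_zero_iff] at hz ⊢
    rw [norm_mul, Complex.norm_real, Real.norm_of_nonneg ht.1]
    nlinarith [norm_nonneg z, ht.2]
  have hd : ∀ t ∈ uIcc (0 : ℝ) 1, HasDerivAt (fun s : ℝ => G (s * z)) (z * g (t * z)) t := by
    intro t ht
    have h1 : HasDerivAt (fun s : ℝ => (s : ℂ) * z) z t := by
      simpa using (Complex.ofRealCLM.hasDerivAt (x := t)).mul_const z
    have h2 := (hG _ (hmem t ht)).comp t h1
    rwa [mul_comm] at h2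
  rw [intervalIntegral.integral_eq_sub_of_hasDerivAt hd]
  · simp [h0]
  · refine ContinuousOn.intervalIntegrable (continuousOn_const.mul (hg.comp ?_ hmem))
    fun_prop

theorem re_le_of_re_circlePt_le {p : ℂ → ℂ} (hp : Differentiable ℂ p) {c : ℝ}
    (h : ∀ θ, (p (circlePt θ)).re ≤ c) {z : ℂ} (hz : ‖z‖ ≤ 1) : (p z).re ≤ c := by
  rcases hz.lt_or_eq with hz | hz
  · have hzD : z ∈ unitDisc := hz
    have hP := isProbabilityMeasure_pm hzD
    rw [← poisson_formula_re hp.diffContOnCl hzD]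
    have h1 : Continuous fun θ => (p (circlePt θ)).re :=
      Complex.continuous_re.comp (hp.continuous.comp continuous_circlePt)
    have : ∫ θ, (p (circlePt θ)).re ∂pm z ≤ ∫ _, c ∂pm z :=
      integral_mono (integrable_pm hzD h1.integrable_angM) (integrable_const _) h
    simpa using this
  · obtain ⟨θ, rfl⟩ := exists_circlePt_of_norm_eq_one hz
    exact h θ

/-- A finite partition of unity on the circle subordinate to small balls. -/
theorem exists_circle_partition {δ : ℝ} (hδ : 0 < δ) :
    ∃ (t : Finset ℂ) (φ : t → ℂ → ℝ), (∀ j : t, ‖(j : ℂ)‖ = 1) ∧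
      (∀ j : t, ContinuousOn (φ j) (Metric.sphere 0 1)) ∧ (∀ (j : t) z, 0 ≤ φ j z) ∧
      (∀ z ∈ Metric.sphere (0 : ℂ) 1, ∑ j, φ j z = 1) ∧ ∀ (j : t) (z : ℂ), δ ≤ ‖z - (j : ℂ)‖ → φ j z = 0 := by
  obtain ⟨s, hs, hsf, hcov⟩ := (isCompact_sphere (0 : ℂ) 1).finite_cover_balls hδ
  let t : Finset ℂ := hsf.toFinset
  let ψ : t → ℂ → ℝ := fun j z => max 0 (δ - ‖z - (j : ℂ)‖)
  have hψ0 : ∀ j z, 0 ≤ ψ j z := fun j z => le_max_left _ _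
  have hψc : ∀ j, Continuous (ψ j) := fun j => by fun_prop
  have hsum : ∀ z ∈ Metric.sphere (0 : ℂ) 1, 0 < ∑ j, ψ j z := by
    intro z hz
    obtain ⟨w, hw, hzw⟩ := mem_iUnion₂.1 (hcov hz)
    rw [mem_ball_iff_norm] at hzw
    refine Finset.sum_pos' (fun j _ => hψ0 j z) ⟨⟨w, hsf.mem_toFinset.2 hw⟩, Finset.mem_univ _, ?_⟩
    exact lt_max_of_lt_right (sub_pos.2 hzw)
  refine ⟨t, fun j z => ψ j z / ∑ i, ψ i z, fun j => ?_, fun j => ?_, fun j z => ?_,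
    fun z hz => ?_, fun j z h => ?_⟩
  · simpa using hs (hsf.mem_toFinset.1 j.2)
  · exact (hψc j).continuousOn.div (continuous_finsetSum _ fun i _ => hψc i).continuousOn
      fun z hz => (hsum z hz).ne'
  · exact div_nonneg (hψ0 _ _) (Finset.sum_nonneg fun i _ => hψ0 _ _)
  · rw [← Finset.sum_div, div_self (hsum z hz).ne']
  · have : ψ j z = 0 := max_eq_left (by linarith)
    simp only [this, zero_div]

theorem exists_exp_solution {f : ℂ → ℂ} {R : ℝ} (hR : 1 < R)
    (hf : DifferentiableOn ℂ f (Metric.ball 0 R)) {W : ℝ → ℝ} (hW : Continuous W)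
    (hW0 : ∀ s, 0 ≤ W s) {η : ℝ} (hη : 0 < η) (hη1 : η ≤ 1) :
    ∃ h G : ℂ → ℂ, Differentiable ℂ h ∧ (h 0).im = 0 ∧ G 0 = 0 ∧
      (∀ z ∈ Metric.ball (0 : ℂ) R, HasDerivAt G (f z * Complex.exp (h z)) z) ∧
      ∀ θ, |(h (circlePt θ)).re + W ‖G (circlePt θ)‖| ≤ η := by
  have hsub : Metric.closedBall (0 : ℂ) 1 ⊆ Metric.ball 0 R :=
    Metric.closedBall_subset_ball hR
  obtain ⟨M₀, hM₀⟩ := (isCompact_closedBall (0 : ℂ) 1).exists_bound_of_continuousOn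
    (hf.continuousOn.mono hsub)
  have hM₀0 : 0 ≤ M₀ := (norm_nonneg _).trans (hM₀ 0 (by simp))
  set M := M₀ * Real.exp 1 with hM
  have hM0 : 0 ≤ M := by positivity
  obtain ⟨V, hV⟩ := (isCompact_Icc (a := 0) (b := M)).exists_bound_of_continuousOn hW.continuousOn
  have hVW : ∀ s, 0 ≤ s → s ≤ M → W s ≤ V := fun s h0 h1 => (le_abs_self _).trans (hV s ⟨h0, h1⟩)
  have hV0 : 0 ≤ V := (hW0 0).trans (hVW 0 le_rfl hM0)
  obtain ⟨δ', hδ', hWδ⟩ := Metric.uniformContinuousOn_iff.1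
    (isCompact_Icc.uniformContinuousOn_of_continuous (hW.continuousOn (s := Icc 0 M))) (η / 2)
    (half_pos hη)
  set δ := δ' / (M + 1) with hδdef
  have hδ : 0 < δ := by positivity
  obtain ⟨t, φ, ht, hφc, hφ0, hφ1, hφs⟩ := exists_circle_partition hδ
  set ε := η / 2 / (t.card * V + 1) with hε
  have hε0 : 0 < ε := by positivity
  have hεV : t.card * V * ε ≤ η / 2 := by
    rw [hε, ← mul_div_assoc, div_le_iff₀ (by positivity)]
    nlinarith [mul_nonneg (Nat.cast_nonneg (α := ℝ) t.card) hV0]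
  choose p hp hp0 hpφ using fun j => exists_re_approx (hφc j) hε0
  let h : (t → ℝ) → ℂ → ℂ := fun x z => ∑ j, (x j : ℂ) * p j z
  have hh : ∀ x, Differentiable ℂ (h x) := fun x =>
    Differentiable.fun_sum fun j _ => (hp j).const_mul _
  have hhc : Continuous fun y : (t → ℝ) × ℂ => h y.1 y.2 := by
    refine continuous_finsetSum _ fun j _ => ?_
    have := (hp j).continuous
    fun_prop
  have hG : ∀ x, ∃ G : ℂ → ℂ, G 0 = 0 ∧
      ∀ z ∈ Metric.ball (0 : ℂ) R, HasDerivAt G (f z * Complex.exp (h x z)) z := fun x =>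
    (hf.mul (hh x).cexp.differentiableOn).exists_primitive
  choose G hG0 hGd using hG
  have hball : ∀ j : t, (j : ℂ) ∈ Metric.ball (0 : ℂ) R := fun j => by
    rw [mem_ball_zero_iff, ht]; exact hR
  have hGc : ∀ j : t, Continuous fun x => G x j := by
    intro j
    have h1 : ∀ x, G x j = ∫ s in (0 : ℝ)..1,
        (j : ℂ) * (f ((projIcc 0 1 zero_le_one s : ℝ) * j) *
          Complex.exp (h x ((projIcc 0 1 zero_le_one s : ℝ) * j))) := by
      intro x
      rw [← integral_segment_eq (hf.mul (hh x).cexp.differentiableOn).continuousOn (hG0 x) (hGd x)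
        (hball j)]
      refine intervalIntegral.integral_congr fun s hs => ?_
      rw [uIcc_of_le zero_le_one] at hs
      simp only [projIcc_of_mem zero_le_one hs, Pi.mul_apply]
    simp_rw [h1]
    refine intervalIntegral.continuous_parametric_intervalIntegral_of_continuous' ?_ 0 1
    have h2 : Continuous fun s : ℝ => f ((projIcc 0 1 zero_le_one s : ℝ) * j) := by
      refine hf.continuousOn.comp_continuous (by fun_prop) fun s => hsub ?_
      have hs := (projIcc (0 : ℝ) 1 zero_le_one s).2
      rw [mem_closedBall_zero_iff, norm_mul, ht, mul_one, Complex.norm_real,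
        Real.norm_of_nonneg hs.1]
      exact hs.2
    have h3 : Continuous fun y : (t → ℝ) × ℝ => h y.1 ((projIcc 0 1 zero_le_one y.2 : ℝ) * j) :=
      hhc.comp (by fun_prop : Continuous fun y : (t → ℝ) × ℝ =>
        (y.1, ((projIcc 0 1 zero_le_one y.2 : ℝ) : ℂ) * (j : ℂ)))
    exact continuous_const.mul ((h2.comp continuous_snd).mul h3.cexp)
  obtain ⟨x, hx⟩ := brouwer_pi (f := fun x (j : t) => -W (min ‖G x j‖ M)) (R := V)
    (continuous_pi fun j => (hW.comp ((hGc j).norm.min continuous_const)).neg) fun x j => by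
      rw [abs_neg, abs_of_nonneg (hW0 _)]
      exact hVW _ (le_min (norm_nonneg _) hM0) (min_le_right _ _)
  have hxj : ∀ j, x j = -W (min ‖G x j‖ M) := fun j => (congrFun hx j).symm
  have hx0 : ∀ j, x j ≤ 0 := fun j => by rw [hxj]; linarith [hW0 (min ‖G x j‖ M)]
  have hxV : ∀ j, |x j| ≤ V := fun j => by
    rw [hxj, abs_neg, abs_of_nonneg (hW0 _)]
    exact hVW _ (le_min (norm_nonneg _) hM0) (min_le_right _ _)
  have hsph : ∀ θ, circlePt θ ∈ Metric.sphere (0 : ℂ) 1 := fun θ => by simp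
  have hre : ∀ θ, |(h x (circlePt θ)).re - ∑ j, x j * φ j (circlePt θ)| ≤ η / 2 := by
    intro θ
    have h1 : (h x (circlePt θ)).re - ∑ j, x j * φ j (circlePt θ) =
        ∑ j, x j * ((p j (circlePt θ)).re - φ j (circlePt θ)) := by
      simp only [h, Complex.re_sum, Complex.re_ofReal_mul, mul_sub, Finset.sum_sub_distrib]
    rw [h1]
    refine (Finset.abs_sum_le_sum_abs _ _).trans ?_
    calc ∑ j, |x j * ((p j (circlePt θ)).re - φ j (circlePt θ))| ≤ ∑ _j : t, V * ε := by
          refine Finset.sum_le_sum fun j _ => ?_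
          rw [abs_mul]
          exact mul_le_mul (hxV j) (hpφ j θ) (abs_nonneg _) hV0
      _ = t.card * V * ε := by simp [mul_assoc]
      _ ≤ η / 2 := hεV
  have hreη : ∀ z, ‖z‖ ≤ 1 → (h x z).re ≤ 1 := by
    refine fun z hz => re_le_of_re_circlePt_le (hh x) (fun θ => ?_) hz
    have h1 := (abs_le.1 (hre θ)).2
    have h2 : ∑ j, x j * φ j (circlePt θ) ≤ 0 :=
      Finset.sum_nonpos fun j _ => mul_nonpos_of_nonpos_of_nonneg (hx0 j) (hφ0 j _)
    linarith
  have hGlip : ∀ z w, ‖z‖ ≤ 1 → ‖w‖ ≤ 1 → ‖G x z - G x w‖ ≤ M * ‖z - w‖ := by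
    intro z w hz hw
    refine (convex_closedBall (0 : ℂ) 1).norm_image_sub_le_of_norm_hasDerivWithin_le
      (f' := fun u => f u * Complex.exp (h x u)) (fun u hu => (hGd x u (hsub hu)).hasDerivWithinAt)
      (fun u hu => ?_) (by simpa using hw) (by simpa using hz)
    rw [norm_mul, Complex.norm_exp]
    exact mul_le_mul (hM₀ u hu) (Real.exp_le_exp.2 (hreη u (by simpa using hu)))
      (Real.exp_pos _).le hM₀0
  have hGM : ∀ z, ‖z‖ = 1 → ‖G x z‖ ≤ M := fun z hz => by
    have := hGlip z 0 hz.le (by simp)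
    rwa [hG0, sub_zero, sub_zero, hz, mul_one] at this
  refine ⟨h x, G x, hh x, ?_, hG0 x, hGd x, fun θ => ?_⟩
  · simp only [h, Complex.im_sum, Complex.im_ofReal_mul, hp0, mul_zero, Finset.sum_const_zero]
  · set ζ := circlePt θ with hζ
    have hζ1 : ‖ζ‖ = 1 := norm_circlePt θ
    have h1 : |∑ j, x j * φ j ζ + W ‖G x ζ‖| ≤ η / 2 := by
      have h2 : ∑ j, x j * φ j ζ + W ‖G x ζ‖ = ∑ j, φ j ζ * (W ‖G x ζ‖ - W ‖G x j‖) := by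
        have h3 : ∀ j, x j = -W ‖G x j‖ := fun j => by
          rw [hxj, min_eq_left (hGM _ (ht j))]
        simp only [mul_sub, Finset.sum_sub_distrib, ← Finset.sum_mul, hφ1 ζ (hsph θ), one_mul]
        simp only [h3, neg_mul, Finset.sum_neg_distrib, mul_comm (W _)]
        ring
      rw [h2]
      refine (Finset.abs_sum_le_sum_abs _ _).trans ?_
      calc ∑ j, |φ j ζ * (W ‖G x ζ‖ - W ‖G x j‖)| ≤ ∑ j, φ j ζ * (η / 2) := by
            refine Finset.sum_le_sum fun j _ => ?_
            rw [abs_mul, abs_of_nonneg (hφ0 j ζ)]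
            rcases le_or_gt δ ‖ζ - j‖ with hd | hd
            · simp [hφs j ζ hd]
            · refine mul_le_mul_of_nonneg_left ?_ (hφ0 j ζ)
              refine (hWδ _ ⟨norm_nonneg _, hGM _ hζ1⟩ _ ⟨norm_nonneg _, hGM _ (ht j)⟩ ?_).le
              rw [Real.dist_eq]
              refine (abs_norm_sub_norm_le _ _).trans_lt
                ((hGlip ζ j hζ1.le (ht j).le).trans_lt ?_)
              rw [hδdef, lt_div_iff₀ (by positivity)] at hd
              nlinarith [norm_nonneg (ζ - (j : ℂ))]
        _ = η / 2 := by rw [← Finset.sum_mul, hφ1 ζ (hsph θ), one_mul]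
    have h4 := hre θ
    have h5 : (h x ζ).re + W ‖G x ζ‖ = ((h x ζ).re - ∑ j, x j * φ j ζ) +
        (∑ j, x j * φ j ζ + W ‖G x ζ‖) := by ring
    rw [h5]
    refine (abs_add_le _ _).trans ?_
    linarith

/-- The Taylor polynomial of degree `k` of `s ↦ -log (1 - s)`. -/
def logTaylor (k : ℕ) (s : ℝ) : ℝ := ∑ j ∈ Finset.range k, s ^ (j + 1) / (j + 1)

/-- The derivative of `logTaylor k`. -/
def geomTaylor (k : ℕ) (s : ℝ) : ℝ := ∑ j ∈ Finset.range k, s ^ j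

/-- The second derivative of `logTaylor k`. -/
def geomTaylorDeriv (k : ℕ) (s : ℝ) : ℝ := ∑ j ∈ Finset.range k, j * s ^ (j - 1)

theorem hasDerivAt_logTaylor (k : ℕ) (s : ℝ) : HasDerivAt (logTaylor k) (geomTaylor k s) s := by
  refine HasDerivAt.fun_sum fun j _ => ?_
  have h := (hasDerivAt_pow (j + 1) s).div_const ((j : ℝ) + 1)
  have hj : (j : ℝ) + 1 ≠ 0 := by positivity
  have h' : ((j + 1 : ℕ) : ℝ) * s ^ (j + 1 - 1) / ((j : ℝ) + 1) = s ^ j := by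
    rw [Nat.add_sub_cancel]
    push_cast
    field_simp
  rwa [h'] at h

theorem hasDerivAt_geomTaylor (k : ℕ) (s : ℝ) :
    HasDerivAt (geomTaylor k) (geomTaylorDeriv k s) s :=
  HasDerivAt.fun_sum fun j _ => hasDerivAt_pow j s

theorem continuous_logTaylor (k : ℕ) : Continuous (logTaylor k) := by
  unfold logTaylor
  fun_prop

theorem logTaylor_nonneg (k : ℕ) {s : ℝ} (hs : 0 ≤ s) : 0 ≤ logTaylor k s :=
  Finset.sum_nonneg fun _ _ => by positivity

theorem logTaylor_mono {k l : ℕ} (hkl : k ≤ l) {s : ℝ} (hs : 0 ≤ s) :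
    logTaylor k s ≤ logTaylor l s :=
  Finset.sum_le_sum_of_subset_of_nonneg (Finset.range_mono hkl) fun _ _ _ => by positivity

theorem le_logTaylor {k : ℕ} (hk : 1 ≤ k) {s : ℝ} (hs : 0 ≤ s) : s ≤ logTaylor k s := by
  simpa [logTaylor] using logTaylor_mono hk hs

theorem geomTaylor_succ (k : ℕ) (s : ℝ) : geomTaylor (k + 1) s = 1 + s * geomTaylor k s := by
  simp only [geomTaylor, Finset.sum_range_succ', Finset.mul_sum, pow_succ', pow_zero]
  ring

theorem geomTaylorDeriv_succ (k : ℕ) (s : ℝ) :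
    geomTaylorDeriv (k + 1) s = geomTaylor k s + s * geomTaylorDeriv k s := by
  simp only [geomTaylorDeriv, geomTaylor, Finset.sum_range_succ', Finset.mul_sum]
  simp only [Nat.cast_add, Nat.cast_one, Nat.add_sub_cancel, Nat.cast_zero, zero_mul, add_zero,
    ← Finset.sum_add_distrib]
  refine Finset.sum_congr rfl fun j _ => ?_
  cases j with
  | zero => simp
  | succ j => simp only [Nat.add_sub_cancel, pow_succ]; ring

theorem geomTaylor_nonneg (k : ℕ) {s : ℝ} (hs : 0 ≤ s) : 0 ≤ geomTaylor k s :=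
  Finset.sum_nonneg fun _ _ => by positivity

theorem geomTaylorDeriv_nonneg (k : ℕ) {s : ℝ} (hs : 0 ≤ s) : 0 ≤ geomTaylorDeriv k s :=
  Finset.sum_nonneg fun _ _ => by positivity

theorem geomTaylorDeriv_le (k : ℕ) {s : ℝ} (hs : 0 ≤ s) :
    geomTaylorDeriv k s ≤ geomTaylor k s ^ 2 := by
  induction k with
  | zero => simp [geomTaylorDeriv, geomTaylor]
  | succ k ih =>
    have h1 : geomTaylor (k + 1) s = geomTaylor k s + s ^ k := Finset.sum_range_succ _ _
    have h2 := geomTaylor_succ k s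
    have h3 := geomTaylor_nonneg k hs
    have h4 : 0 ≤ s ^ k := by positivity
    calc geomTaylorDeriv (k + 1) s ≤ geomTaylor k s * geomTaylor (k + 1) s := by
          rw [geomTaylorDeriv_succ, h2]
          nlinarith [mul_le_mul_of_nonneg_left ih hs]
      _ ≤ geomTaylor (k + 1) s ^ 2 := by
          rw [sq]
          exact mul_le_mul_of_nonneg_right (by linarith) (by linarith)

theorem geomTaylor_add_le (k : ℕ) {s : ℝ} (hs : 0 ≤ s) :
    geomTaylor k s + s * geomTaylorDeriv k s ≤ geomTaylor k s ^ 2 := by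
  cases k with
  | zero => simp [geomTaylorDeriv, geomTaylor]
  | succ k =>
    rw [geomTaylorDeriv_succ, geomTaylor_succ]
    nlinarith [mul_le_mul_of_nonneg_left (geomTaylorDeriv_le k hs) (sq_nonneg s)]

theorem geomTaylor_le_exp (k : ℕ) {s : ℝ} (hs : 0 ≤ s) :
    geomTaylor k s ≤ Real.exp (logTaylor k s) := by
  have hd : ∀ x, HasDerivAt (fun x => geomTaylor k x * Real.exp (-logTaylor k x))
      (geomTaylorDeriv k x * Real.exp (-logTaylor k x) +
        geomTaylor k x * (Real.exp (-logTaylor k x) * -geomTaylor k x)) x := fun x =>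
    (hasDerivAt_geomTaylor k x).mul (hasDerivAt_logTaylor k x).fun_neg.exp
  have hanti : AntitoneOn (fun x => geomTaylor k x * Real.exp (-logTaylor k x)) (Ici 0) := by
    refine antitoneOn_of_deriv_nonpos (convex_Ici 0) (fun x _ => (hd x).continuousAt.continuousWithinAt)
      (fun x _ => (hd x).differentiableAt.differentiableWithinAt) fun x hx => ?_
    rw [interior_Ici] at hx
    rw [(hd x).deriv]
    have := geomTaylorDeriv_le k (le_of_lt hx)
    nlinarith [mul_le_mul_of_nonneg_right this (Real.exp_pos (-logTaylor k x)).le]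
  have h0 := hanti (mem_Ici.2 le_rfl) hs hs
  have h1 : geomTaylor k 0 ≤ 1 := by
    cases k with
    | zero => simp [geomTaylor]
    | succ k => rw [geomTaylor_succ]; simp
  have h2 : logTaylor k 0 = 0 := Finset.sum_eq_zero fun j _ => by simp
  simp only [h2, neg_zero, Real.exp_zero, mul_one, Real.exp_neg] at h0
  rw [← div_eq_mul_inv, div_le_iff₀ (Real.exp_pos _)] at h0
  nlinarith [Real.exp_pos (logTaylor k s)]

theorem hasJet_logTaylor {G : ℂ → ℂ} {z : ℂ} (hG : AnalyticAt ℂ G z) (k : ℕ) :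
    ∃ a l, HasJet (fun w => logTaylor k (‖G w‖ ^ 2)) z a l ∧ 0 ≤ l ∧
      l ≤ Real.exp (2 * logTaylor k (‖G z‖ ^ 2)) * ‖deriv G z‖ ^ 2 := by
  refine ⟨_, _, (hasJet_norm_sq hG).comp (Eventually.of_forall (hasDerivAt_logTaylor k))
    (hasDerivAt_geomTaylor k _), ?_⟩
  set s := ‖G z‖ ^ 2 with hs
  have hs0 : 0 ≤ s := sq_nonneg _
  have h1 : geomTaylor k s * ‖deriv G z‖ ^ 2 +
      geomTaylorDeriv k s / 4 * ‖2 * (starRingEnd ℂ) (G z) * deriv G z‖ ^ 2 =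
      (geomTaylor k s + s * geomTaylorDeriv k s) * ‖deriv G z‖ ^ 2 := by
    rw [norm_mul, norm_mul, RCLike.norm_conj, mul_pow, mul_pow, ← hs]
    norm_num
    ring
  rw [h1]
  have h2 := geomTaylor_nonneg k hs0
  have h3 := geomTaylorDeriv_nonneg k hs0
  refine ⟨by positivity, mul_le_mul_of_nonneg_right ?_ (sq_nonneg _)⟩
  refine (geomTaylor_add_le k hs0).trans ?_
  rw [two_mul, Real.exp_add, ← sq]
  exact pow_le_pow_left₀ h2 (geomTaylor_le_exp k hs0) 2

theorem exists_approx_solution {f : ℂ → ℂ} {B : ℂ → ℝ} {C : ℝ}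
    (hf : DifferentiableOn ℂ f unitDisc) (hB : ∀ z ∈ unitDisc, 0 ≤ B z ∧ B z ≤ C)
    (hBj : ∀ z ∈ unitDisc, ∃ a l, HasJet B z a l ∧ l ≤ -‖f z‖ ^ 2) {r : ℝ} (h0 : 0 < r)
    (h1 : r < 1) (k : ℕ) {η : ℝ} (hη : 0 < η) (hη1 : η ≤ 1) :
    ∃ h G : ℂ → ℂ, DifferentiableOn ℂ h unitDisc ∧ (h 0).im = 0 ∧ G 0 = 0 ∧
      (∀ z ∈ unitDisc, HasDerivAt G (r * f (r * z) * Complex.exp (h z)) z) ∧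
      ∀ z ∈ unitDisc, -η - Real.exp (2 * η) * C ≤ (h z).re + logTaylor k (‖G z‖ ^ 2) ∧
        (h z).re + logTaylor k (‖G z‖ ^ 2) ≤ η := by
  have hmaps : MapsTo (fun z : ℂ => (r : ℂ) * z) (Metric.ball 0 r⁻¹) unitDisc := by
    intro z hz
    rw [mem_ball_zero_iff, ← one_div, lt_div_iff₀ h0] at hz
    rwa [mem_unitDisc, norm_mul, Complex.norm_real, Real.norm_of_nonneg h0.le, mul_comm]
  have hfr : DifferentiableOn ℂ (fun z => r * f (r * z)) (Metric.ball 0 r⁻¹) :=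
    (hf.comp (by fun_prop) hmaps).const_mul _
  have hR : 1 < r⁻¹ := (one_lt_inv₀ h0).2 h1
  have hsub : Metric.closedBall (0 : ℂ) 1 ⊆ Metric.ball 0 r⁻¹ := Metric.closedBall_subset_ball hR
  obtain ⟨h, G, hh, him, hG0, hG, hb⟩ := exists_exp_solution hR hfr
    (W := fun s => logTaylor k (s ^ 2)) ((continuous_logTaylor k).comp (continuous_pow 2))
    (fun s => logTaylor_nonneg k (sq_nonneg s)) hη hη1
  have hDsub : unitDisc ⊆ Metric.ball 0 r⁻¹ := by
    rw [unitDisc_eq_ball]; exact Metric.ball_subset_ball hR.le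
  refine ⟨h, G, hh.differentiableOn, him, hG0, fun z hz => hG z (hDsub hz), ?_⟩
  have hGan : ∀ z ∈ Metric.ball (0 : ℂ) r⁻¹, AnalyticAt ℂ G z := fun z hz =>
    DifferentiableOn.analyticAt (s := Metric.ball 0 r⁻¹)
      (fun w hw => (hG w hw).differentiableAt.differentiableWithinAt) (Metric.isOpen_ball.mem_nhds hz)
  have hlc : ContinuousOn (fun z => (h z).re + logTaylor k (‖G z‖ ^ 2))
      (Metric.closedBall 0 1) := by
    refine (Complex.continuous_re.comp hh.continuous).continuousOn.add
      ((continuous_logTaylor k).comp_continuousOn (ContinuousOn.pow (ContinuousOn.norm ?_) 2))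
    exact fun z hz => (hG z (hsub hz)).continuousAt.continuousWithinAt
  have hup : ∀ z ∈ unitDisc, (h z).re + logTaylor k (‖G z‖ ^ 2) ≤ η := by
    refine le_of_jet_nonneg isOpen_unitDisc isBounded_unitDisc (by rwa [closure_unitDisc])
      (fun z hz => ?_) fun z hz => ?_
    · obtain ⟨a, l, hj, hl, -⟩ := hasJet_logTaylor (hGan z (hDsub hz)) k
      exact ⟨_, _, (hasJet_re (hh.analyticAt z)).add hj, by linarith⟩
    · rw [sphere_eq_frontier_unitDisc, mem_sphere_zero_iff_norm] at hz
      obtain ⟨θ, rfl⟩ := exists_circlePt_of_norm_eq_one hz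
      exact (abs_le.1 (hb θ)).2
  refine fun z hz => ⟨?_, hup z hz⟩
  have hrz : ∀ z ∈ Metric.closedBall (0 : ℂ) 1, (r : ℂ) * z ∈ unitDisc := fun z hz =>
    hmaps (hsub hz)
  have hlow : ∀ z ∈ unitDisc, -((h z).re + logTaylor k (‖G z‖ ^ 2) +
      Real.exp (2 * η) * B (r * z)) ≤ η := by
    refine le_of_jet_nonneg isOpen_unitDisc isBounded_unitDisc ?_
      (fun z hz => ?_) fun z hz => ?_
    · rw [closure_unitDisc]
      refine (hlc.add (continuousOn_const.mul fun z hz => ?_)).neg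
      obtain ⟨a, l, hj, -⟩ := hBj _ (hrz z hz)
      exact (hj.dilate r).continuousAt.continuousWithinAt
    · obtain ⟨a, l, hj, -, hl⟩ := hasJet_logTaylor (hGan z (hDsub hz)) k
      obtain ⟨a', l', hj', hl'⟩ := hBj _ (hmaps (hDsub hz))
      refine ⟨_, _, (((hasJet_re (hh.analyticAt z)).add hj).add
        ((hj'.dilate r).const_mul (Real.exp (2 * η)))).neg, ?_⟩
      have h3 : l ≤ Real.exp (2 * η) * (r ^ 2 * ‖f (r * z)‖ ^ 2) := by
        refine hl.trans ?_
        rw [(hG z (hDsub hz)).deriv, norm_mul, norm_mul, Complex.norm_exp, mul_pow, mul_pow,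
          Complex.norm_real, Real.norm_of_nonneg h0.le, ← Real.exp_nat_mul, mul_comm, mul_assoc,
          ← Real.exp_add, mul_comm]
        refine mul_le_mul_of_nonneg_right (Real.exp_le_exp.2 ?_) (by positivity)
        have := hup z hz
        push_cast
        linarith
      have h4 : Real.exp (2 * η) * (r ^ 2 * l') ≤
          Real.exp (2 * η) * (r ^ 2 * -‖f (r * z)‖ ^ 2) := by gcongr
      linarith
    · rw [sphere_eq_frontier_unitDisc, mem_sphere_zero_iff_norm] at hz
      have h5 : 0 ≤ Real.exp (2 * η) * B (r * z) :=
        mul_nonneg (Real.exp_pos _).le (hB _ (hrz z (by simp [hz]))).1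
      obtain ⟨θ, rfl⟩ := exists_circlePt_of_norm_eq_one hz
      have := (abs_le.1 (hb θ)).1
      linarith
  have h6 : Real.exp (2 * η) * B (r * z) ≤ Real.exp (2 * η) * C :=
    mul_le_mul_of_nonneg_left (hB _ (hmaps (hDsub hz))).2 (Real.exp_pos _).le
  linarith [hlow z hz]

theorem locally_lipschitz_of_locally_bounded {ι : Type*} {g : ι → ℂ → ℂ}
    (hg : ∀ n, DifferentiableOn ℂ (g n) unitDisc)
    (hb : ∀ ρ < 1, ∃ M, ∀ n z, ‖z‖ ≤ ρ → ‖g n z‖ ≤ M) {x : ℂ} (hx : x ∈ unitDisc) :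
    ∃ δ > 0, ∃ L > 0, Metric.ball x δ ⊆ unitDisc ∧
      ∀ n, ∀ y ∈ Metric.ball x δ, ‖g n y - g n x‖ ≤ L * ‖y - x‖ := by
  rw [mem_unitDisc] at hx
  set δ := (1 - ‖x‖) / 3 with hδ
  have hδ0 : 0 < δ := by rw [hδ]; linarith
  obtain ⟨M, hM⟩ := hb (‖x‖ + 2 * δ) (by linarith)
  have hy : ∀ y ∈ Metric.ball x δ, ‖y‖ < ‖x‖ + δ := fun y hy => by
    rw [mem_ball_iff_norm] at hy
    linarith [norm_sub_norm_le y x]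
  have hsub : Metric.ball x δ ⊆ unitDisc := fun y h => by
    rw [mem_unitDisc]
    linarith [hy y h]
  refine ⟨δ, hδ0, |M| / δ + 1, by positivity, hsub, fun n y hyx => ?_⟩
  refine (convex_ball x δ).norm_image_sub_le_of_norm_deriv_le (𝕜 := ℂ)
    (fun w hw => (hg n).differentiableAt (isOpen_unitDisc.mem_nhds (hsub hw))) (fun w hw => ?_)
    (Metric.mem_ball_self hδ0) hyx
  have hcl : ∀ v ∈ Metric.closedBall w δ, ‖v‖ ≤ ‖x‖ + 2 * δ := fun v hv => by
    rw [mem_closedBall_iff_norm] at hv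
    linarith [norm_sub_norm_le v w, hy w hw]
  have h1 : ‖deriv (g n) w‖ ≤ M / δ := by
    refine Complex.norm_deriv_le_of_forall_mem_sphere_norm_le hδ0 ?_
      fun v hv => hM n v (hcl v (Metric.sphere_subset_closedBall hv))
    refine DifferentiableOn.diffContOnCl ((hg n).mono fun v hv => ?_)
    have := hcl v (Metric.closure_ball_subset_closedBall hv)
    rw [mem_unitDisc]
    linarith
  have h2 : M / δ ≤ |M| / δ := by gcongr; exact le_abs_self M
  linarith

/-- Montel's theorem along an ultrafilter. -/
theorem exists_ultrafilter_limit {ι : Type*} (U : Ultrafilter ι) {g : ι → ℂ → ℂ}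
    (hg : ∀ n, DifferentiableOn ℂ (g n) unitDisc)
    (hb : ∀ ρ < 1, ∃ M, ∀ n z, ‖z‖ ≤ ρ → ‖g n z‖ ≤ M) :
    ∃ f : ℂ → ℂ, DifferentiableOn ℂ f unitDisc ∧
      ∀ z ∈ unitDisc, Tendsto (fun n => g n z) U (𝓝 (f z)) ∧
        Tendsto (fun n => deriv (g n) z) U (𝓝 (deriv f z)) := by
  have hp : ∀ z, ∃ w, z ∈ unitDisc → Tendsto (fun n => g n z) U (𝓝 w) := by
    intro z
    by_cases hz : z ∈ unitDisc
    · obtain ⟨M, hM⟩ := hb ‖z‖ hz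
      obtain ⟨w, -, hw⟩ := isCompact_iff_ultrafilter_le_nhds.1 (isCompact_closedBall (0 : ℂ) M)
        (U.map fun n => g n z) (le_principal_iff.2 (Ultrafilter.mem_map.2
          (univ_mem' fun n => mem_closedBall_zero_iff.2 (hM n z le_rfl))))
      exact ⟨w, fun _ => hw⟩
    · exact ⟨0, fun h => absurd h hz⟩
  choose f hf using hp
  have hloc : TendstoLocallyUniformlyOn g f U unitDisc := by
    rw [Metric.tendstoLocallyUniformlyOn_iff]
    intro ε hε x hx
    obtain ⟨δ, hδ, L, hL, hsub, hlip⟩ := locally_lipschitz_of_locally_bounded hg hb hx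
    have hlim : ∀ y ∈ Metric.ball x δ, ‖f y - f x‖ ≤ L * ‖y - x‖ := fun y hy =>
      le_of_tendsto ((hf y (hsub hy)).sub (hf x hx)).norm (Eventually.of_forall fun n => hlip n y hy)
    have hρ : 0 < min δ (ε / (3 * L)) := lt_min hδ (by positivity)
    refine ⟨Metric.ball x (min δ (ε / (3 * L))),
      mem_nhdsWithin_of_mem_nhds (Metric.ball_mem_nhds x hρ), ?_⟩
    filter_upwards [(Metric.tendsto_nhds.1 (hf x hx)) (ε / 3) (by positivity)] with n hn y hy
    have hyδ : y ∈ Metric.ball x δ := Metric.ball_subset_ball (min_le_left _ _) hy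
    have hLε : L * ‖y - x‖ < ε / 3 := by
      have h1 : ‖y - x‖ < ε / (3 * L) :=
        (mem_ball_iff_norm.1 hy).trans_le (min_le_right _ _)
      rw [lt_div_iff₀ (by positivity)] at h1
      linarith
    rw [dist_eq_norm] at hn ⊢
    have h2 : f y - g n y = (f y - f x) - (g n x - f x) - (g n y - g n x) := by ring
    rw [h2]
    have h3 := norm_sub_le (f y - f x - (g n x - f x)) (g n y - g n x)
    have h4 := norm_sub_le (f y - f x) (g n x - f x)
    linarith [hlim y hyδ, hlip n y hyδ]
  have hgU : ∀ᶠ n in (U : Filter ι), DifferentiableOn ℂ (g n) unitDisc := Eventually.of_forall hg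
  refine ⟨f, hloc.differentiableOn hgU isOpen_unitDisc, fun z hz => ⟨hf z hz, ?_⟩⟩
  exact (hloc.deriv hgU isOpen_unitDisc).tendsto_at hz

theorem lt_one_of_logTaylor_le {s c : ℝ} (hs : 0 ≤ s) (h : ∀ k, logTaylor k s ≤ c) :
    s < 1 ∧ -Real.log (1 - s) ≤ c := by
  have h1 : s < 1 := by
    by_contra! hs1
    obtain ⟨k, hk⟩ := (Real.tendsto_sum_range_one_div_nat_succ_atTop.eventually_gt_atTop c).exists
    refine absurd (hk.trans_le ?_) (h k).not_gt
    exact Finset.sum_le_sum fun j _ =>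
      div_le_div_of_nonneg_right (one_le_pow₀ hs1) (by positivity)
  refine ⟨h1, le_of_tendsto' (Real.hasSum_pow_div_log_of_abs_lt_one
    (by rwa [abs_of_nonneg hs])).tendsto_sum_nat h⟩

theorem logTaylor_le_neg_log (k : ℕ) {s : ℝ} (hs : 0 ≤ s) (h1 : s < 1) :
    logTaylor k s ≤ -Real.log (1 - s) :=
  sum_le_hasSum _ (fun _ _ => by positivity)
    (Real.hasSum_pow_div_log_of_abs_lt_one (by rwa [abs_of_nonneg hs]))

theorem exists_log_solution {f : ℂ → ℂ} {B : ℂ → ℝ} {C : ℝ}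
    (hf : DifferentiableOn ℂ f unitDisc) (hB : ∀ z ∈ unitDisc, 0 ≤ B z ∧ B z ≤ C)
    (hBj : ∀ z ∈ unitDisc, ∃ a l, HasJet B z a l ∧ l ≤ -‖f z‖ ^ 2) :
    ∃ h G : ℂ → ℂ, DifferentiableOn ℂ h unitDisc ∧
      (∀ z ∈ unitDisc, HasDerivAt G (f z * Complex.exp (h z)) z) ∧
      ∀ z ∈ unitDisc, ‖G z‖ < 1 ∧ Real.log (1 - ‖G z‖ ^ 2) - C ≤ (h z).re ∧
        (h z).re ≤ Real.log (1 - ‖G z‖ ^ 2) := by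
  have hη : ∀ n : ℕ, (0 : ℝ) < 1 / ((n : ℝ) + 1) ∧ 1 / ((n : ℝ) + 1) ≤ 1 := fun n =>
    ⟨by positivity, by
      rw [div_le_one (by positivity)]
      linarith [n.cast_nonneg (α := ℝ)]⟩
  choose h G hh him hG0 hGd hb using fun n : ℕ => exists_approx_solution hf hB hBj
    (one_sub_inv_mem n).1 (one_sub_inv_mem n).2 (n + 1) (hη n).1 (hη n).2
  have hC : 0 ≤ C := (hB 0 zero_mem_unitDisc).1.trans (hB 0 zero_mem_unitDisc).2
  have hre1 : ∀ n, ∀ z ∈ unitDisc, (h n z).re ≤ 1 := fun n z hz => by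
    linarith [(hb n z hz).2, (hη n).2, logTaylor_nonneg (n + 1) (sq_nonneg ‖G n z‖)]
  set K := 1 + Real.exp 2 * C with hK
  have hK0 : 0 ≤ K := by positivity
  have h0K : ∀ n, ‖h n 0‖ ≤ K := fun n => by
    have h1 := (hb n 0 zero_mem_unitDisc).1
    have h2 : logTaylor (n + 1) (‖G n 0‖ ^ 2) = 0 := by
      rw [hG0]
      exact Finset.sum_eq_zero fun j _ => by simp
    have h3 : Real.exp (2 * (1 / ((n : ℝ) + 1))) * C ≤ Real.exp 2 * C :=
      mul_le_mul_of_nonneg_right (Real.exp_le_exp.2 (by linarith [(hη n).2])) hC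
    have h4 : h n 0 = ((h n 0).re : ℂ) := Complex.ext rfl (him n)
    rw [h4, Complex.norm_real, Real.norm_eq_abs, abs_le]
    constructor
    · linarith [(hη n).2]
    · have : 0 ≤ Real.exp 2 * C := by positivity
      linarith [hre1 n 0 zero_mem_unitDisc]
  have hbh : ∀ ρ < 1, ∃ M, ∀ n z, ‖z‖ ≤ ρ → ‖h n z‖ ≤ M := by
    intro ρ hρ
    refine ⟨(2 + 2 * K) / (1 - ρ), fun n z hz => ?_⟩
    have hzD : z ∈ unitDisc := hz.trans_lt hρ
    rw [mem_unitDisc] at hzD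
    have h1 := Complex.borelCaratheodory one_pos (unitDisc_eq_ball ▸ hh n)
      (fun w hw => hre1 n w (by rwa [unitDisc_eq_ball])) one_pos (by simpa using hzD)
    refine h1.trans ?_
    rw [← add_div]
    refine div_le_div₀ (by positivity) ?_ (by linarith) (by linarith)
    nlinarith [h0K n, norm_nonneg z, norm_nonneg (h n 0)]
  have hbG : ∀ ρ < 1, ∃ M, ∀ n z, ‖z‖ ≤ ρ → ‖G n z‖ ≤ M := by
    intro ρ hρ
    obtain ⟨M, hM⟩ := hbh ρ hρ
    refine ⟨2 + M, fun n z hz => ?_⟩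
    have hzD : z ∈ unitDisc := hz.trans_lt hρ
    have h1 := le_logTaylor (k := n + 1) (by omega) (sq_nonneg ‖G n z‖)
    have h2 := (abs_le.1 ((Complex.abs_re_le_norm (h n z)).trans (hM n z hz))).1
    nlinarith [(hb n z hzD).2, (hη n).2, norm_nonneg (G n z), sq_nonneg (‖G n z‖ - 1)]
  have hGdiff : ∀ n, DifferentiableOn ℂ (G n) unitDisc := fun n z hz =>
    (hGd n z hz).differentiableAt.differentiableWithinAt
  obtain ⟨h', hh', hlim⟩ := exists_ultrafilter_limit (hyperfilter ℕ) hh hbh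
  obtain ⟨G', hG', hGlim⟩ := exists_ultrafilter_limit (hyperfilter ℕ) hGdiff hbG
  have hηlim : Tendsto (fun n : ℕ => 1 / ((n : ℝ) + 1)) (hyperfilter ℕ) (𝓝 0) :=
    tendsto_one_div_add_atTop_nhds_zero_nat.mono_left Nat.hyperfilter_le_atTop
  have hrlim : Tendsto (fun n : ℕ => 1 - 1 / ((n : ℝ) + 2)) (hyperfilter ℕ) (𝓝[<] 1) :=
    tendsto_one_sub_inv.mono_left Nat.hyperfilter_le_atTop
  have hup : ∀ z ∈ unitDisc, ∀ k, logTaylor k (‖G' z‖ ^ 2) ≤ -(h' z).re := by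
    intro z hz k
    have h1 : Tendsto (fun n => logTaylor k (‖G n z‖ ^ 2)) (hyperfilter ℕ)
        (𝓝 (logTaylor k (‖G' z‖ ^ 2))) :=
      ((continuous_logTaylor k).tendsto _).comp ((hGlim z hz).1.norm.pow 2)
    have h2 : Tendsto (fun n : ℕ => 1 / ((n : ℝ) + 1) - (h n z).re) (hyperfilter ℕ)
        (𝓝 (0 - (h' z).re)) :=
      hηlim.sub ((Complex.continuous_re.tendsto _).comp (hlim z hz).1)
    rw [zero_sub] at h2
    refine le_of_tendsto_of_tendsto h1 h2 ?_
    filter_upwards [Nat.hyperfilter_le_atTop (eventually_ge_atTop k)] with n hn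
    linarith [(hb n z hz).2, logTaylor_mono (hn.trans n.le_succ) (sq_nonneg ‖G n z‖)]
  refine ⟨h', G', hh', fun z hz => ?_, fun z hz => ?_⟩
  · have h1 : Tendsto (fun n => deriv (G n) z) (hyperfilter ℕ)
        (𝓝 (f z * Complex.exp (h' z))) := by
      have h2 : ∀ n, deriv (G n) z = ((1 - 1 / ((n : ℝ) + 2) : ℝ) : ℂ) *
          f (((1 - 1 / ((n : ℝ) + 2) : ℝ) : ℂ) * z) * Complex.exp (h n z) := fun n =>
        (hGd n z hz).deriv
      simp_rw [h2]
      have h3 : Tendsto (fun n : ℕ => ((1 - 1 / ((n : ℝ) + 2) : ℝ) : ℂ)) (hyperfilter ℕ)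
          (𝓝 ((1 : ℝ) : ℂ)) :=
        (Complex.continuous_ofReal.tendsto 1).comp (tendsto_nhdsWithin_iff.1 hrlim).1
      have h4 : Tendsto (fun n : ℕ => f (((1 - 1 / ((n : ℝ) + 2) : ℝ) : ℂ) * z)) (hyperfilter ℕ)
          (𝓝 (f z)) := (tendsto_dilate hf.continuousOn hz).comp hrlim
      simpa using (h3.mul h4).mul (hlim z hz).1.cexp
    rw [← tendsto_nhds_unique (hGlim z hz).2 h1]
    exact (hG'.differentiableAt (isOpen_unitDisc.mem_nhds hz)).hasDerivAt
  · obtain ⟨hs1, hle⟩ := lt_one_of_logTaylor_le (sq_nonneg _) (hup z hz)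
    refine ⟨by nlinarith [norm_nonneg (G' z)], ?_, by linarith⟩
    have hs : Tendsto (fun n => 1 - ‖G n z‖ ^ 2) (hyperfilter ℕ) (𝓝 (1 - ‖G' z‖ ^ 2)) :=
      ((hGlim z hz).1.norm.pow 2).const_sub 1
    have h1 : Tendsto (fun n => (h n z).re - Real.log (1 - ‖G n z‖ ^ 2)) (hyperfilter ℕ)
        (𝓝 ((h' z).re - Real.log (1 - ‖G' z‖ ^ 2))) :=
      ((Complex.continuous_re.tendsto _).comp (hlim z hz).1).sub (hs.log (by linarith))
    have h2 : Tendsto (fun n : ℕ => -(1 / ((n : ℝ) + 1)) -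
        Real.exp (2 * (1 / ((n : ℝ) + 1))) * C) (hyperfilter ℕ) (𝓝 (-0 - Real.exp (2 * 0) * C)) :=
      hηlim.neg.sub ((hηlim.const_mul 2).rexp.mul_const C)
    have h3 := le_of_tendsto_of_tendsto h2 h1 (by
      filter_upwards [hs.eventually (lt_mem_nhds (by linarith : 0 < 1 - ‖G' z‖ ^ 2))] with n hn
      linarith [(hb n z hz).1, logTaylor_le_neg_log (n + 1) (sq_nonneg ‖G n z‖) (by linarith)])
    rw [mul_zero, Real.exp_zero] at h3
    linarith

theorem hasJet_exp_neg_mul_log {G : ℂ → ℂ} {z : ℂ} (hG : AnalyticAt ℂ G z) (h1 : ‖G z‖ < 1)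
    {q : ℝ} (hq : 0 < q) :
    ∃ a l, HasJet (fun w => Real.exp (-q * Real.log (1 - ‖G w‖ ^ 2))) z a l ∧
      l ≤ (q ^ 2 + 2 * q) * Real.exp (-q * Real.log (1 - ‖G z‖ ^ 2)) *
        (‖deriv G z‖ / (1 - ‖G z‖ ^ 2)) ^ 2 := by
  set s := ‖G z‖ ^ 2 with hs
  have hs0 : 0 ≤ s := sq_nonneg _
  have hs1 : s < 1 := by nlinarith [norm_nonneg (G z)]
  have hd : ∀ x < (1 : ℝ), HasDerivAt (fun x => Real.exp (-q * Real.log (1 - x)))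
      (q * (1 - x)⁻¹ * Real.exp (-q * Real.log (1 - x))) x := by
    intro x hx
    have hx' : (1 : ℝ) - x ≠ 0 := by linarith
    refine ((((hasDerivAt_id' x).const_sub 1).log hx').const_mul (-q)).exp.congr_deriv ?_
    ring
  have hd2 : HasDerivAt (fun x => q * (1 - x)⁻¹ * Real.exp (-q * Real.log (1 - x)))
      ((q ^ 2 + q) * ((1 - s) ^ 2)⁻¹ * Real.exp (-q * Real.log (1 - s))) s := by
    have hx' : (1 : ℝ) - s ≠ 0 := by linarith
    refine (((((hasDerivAt_id' s).const_sub 1).fun_inv hx').const_mul q).mul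
      (hd s hs1)).congr_deriv ?_
    field_simp
    ring
  refine ⟨_, _, (hasJet_norm_sq hG).comp
    (φ' := fun x => q * (1 - x)⁻¹ * Real.exp (-q * Real.log (1 - x)))
    (by filter_upwards [gt_mem_nhds hs1] with x hx using hd x hx) hd2, ?_⟩
  rw [norm_mul, norm_mul, RCLike.norm_conj, mul_pow, mul_pow, ← hs]
  have hx' : 0 < 1 - s := by linarith
  set P := Real.exp (-q * Real.log (1 - s)) with hP
  have hP0 : 0 < P := Real.exp_pos _
  have h2 : q * (1 - s)⁻¹ * P * ‖deriv G z‖ ^ 2 +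
      (q ^ 2 + q) * ((1 - s) ^ 2)⁻¹ * P / 4 * (‖(2 : ℂ)‖ ^ 2 * s * ‖deriv G z‖ ^ 2) =
      (q * (1 - s) + (q ^ 2 + q) * s) * P * (‖deriv G z‖ / (1 - s)) ^ 2 := by
    rw [Complex.norm_ofNat]
    field_simp
    ring
  rw [h2]
  refine mul_le_mul_of_nonneg_right (mul_le_mul_of_nonneg_right ?_ hP0.le) (sq_nonneg _)
  nlinarith [mul_nonneg (sq_nonneg q) hx'.le]

theorem HasJet.exp {f : ℂ → ℝ} {z a : ℂ} {l : ℝ} (hf : HasJet f z a l) :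
    HasJet (fun w => Real.exp (f w)) z (Real.exp (f z) * a)
      (Real.exp (f z) * l + Real.exp (f z) / 4 * ‖a‖ ^ 2) :=
  hf.comp (Eventually.of_forall Real.hasDerivAt_exp) (Real.hasDerivAt_exp _)

theorem analyticAt_of_hasDerivAt {G G' : ℂ → ℂ} (hG : ∀ z ∈ unitDisc, HasDerivAt G (G' z) z) {z : ℂ}
    (hz : z ∈ unitDisc) : AnalyticAt ℂ G z :=
  DifferentiableOn.analyticAt (s := unitDisc)
    (fun w hw => (hG w hw).differentiableAt.differentiableWithinAt) (isOpen_unitDisc.mem_nhds hz)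

theorem exists_integral_exp_neg_le {f h G : ℂ → ℂ} {B : ℂ → ℝ} {C : ℝ}
    (hf : DifferentiableOn ℂ f unitDisc) (hB : ∀ z ∈ unitDisc, 0 ≤ B z ∧ B z ≤ C)
    (hBj : ∀ z ∈ unitDisc, ∃ a l, HasJet B z a l ∧ l ≤ -‖f z‖ ^ 2)
    (hB0 : ∀ ε : ℝ, 0 < ε → ∃ ρ < 1, ∀ z ∈ unitDisc, ρ < ‖z‖ → B z ≤ ε)
    (hh : DifferentiableOn ℂ h unitDisc)
    (hG : ∀ z ∈ unitDisc, HasDerivAt G (f z * Complex.exp (h z)) z)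
    (hGh : ∀ z ∈ unitDisc, ‖G z‖ < 1 ∧ Real.log (1 - ‖G z‖ ^ 2) - C ≤ (h z).re ∧
      (h z).re ≤ Real.log (1 - ‖G z‖ ^ 2)) {q : ℝ} (hq : 0 < q) :
    ∃ M, ∀ r : ℝ, 0 < r → r < 1 → ∫ θ, Real.exp (-q * (h (r * circlePt θ)).re) ∂angM ≤ M := by
  set A := q ^ 2 + 2 * q with hA
  have hA0 : 0 < A := by positivity
  set N := 2 * A * Real.exp 1 * Real.exp (q * C) with hN
  have hN0 : 0 < N := by positivity
  set κ := Real.exp (-(q * C)) / 2 with hκ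
  have hκ0 : 0 < κ := by positivity
  have hκN : κ * N * Real.exp (-1) = A := by
    rw [hκ, hN, Real.exp_neg, Real.exp_neg]
    field_simp
  obtain ⟨ρ, hρ, hρB⟩ := hB0 N⁻¹ (by positivity)
  let Y : ℂ → ℝ := fun z => Real.exp (-q * Real.log (1 - ‖G z‖ ^ 2))
  let Z : ℂ → ℝ := fun z => Real.exp (-N * B z + -q * (h z).re)
  have hY : ∀ z ∈ unitDisc, ∃ a l, HasJet Y z a l ∧ l ≤ A * Y z * ‖f z‖ ^ 2 := by
    intro z hz
    obtain ⟨h1, -, h3⟩ := hGh z hz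
    obtain ⟨a, l, hj, hl⟩ := hasJet_exp_neg_mul_log (analyticAt_of_hasDerivAt hG hz) h1 hq
    refine ⟨a, l, hj, hl.trans ?_⟩
    have h4 : 0 < 1 - ‖G z‖ ^ 2 := by nlinarith [norm_nonneg (G z)]
    refine mul_le_mul_of_nonneg_left (pow_le_pow_left₀ (by positivity) ?_ 2) (by positivity)
    rw [div_le_iff₀ h4, (hG z hz).deriv, norm_mul, Complex.norm_exp]
    refine mul_le_mul_of_nonneg_left ?_ (norm_nonneg _)
    rwa [← Real.le_log_iff_exp_le h4]
  have hZ : ∀ z ∈ unitDisc, ∃ a l, HasJet Z z a l ∧ N * Z z * ‖f z‖ ^ 2 ≤ l := by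
    intro z hz
    obtain ⟨a, l, hj, hl⟩ := hBj z hz
    refine ⟨_, _, ((hj.const_mul (-N)).add ((hasJet_re (hh.analyticAt
      (isOpen_unitDisc.mem_nhds hz))).const_mul (-q))).exp, ?_⟩
    have h1 : N * ‖f z‖ ^ 2 ≤ -N * l + -q * 0 := by nlinarith
    have h2 := mul_le_mul_of_nonneg_left h1 (Real.exp_pos (-N * B z + -q * (h z).re)).le
    have h3 : N * Z z * ‖f z‖ ^ 2 = Z z * (N * ‖f z‖ ^ 2) := by ring
    rw [h3]
    exact h2.trans (le_add_of_nonneg_right (by positivity))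
  have hYc : ∀ z ∈ unitDisc, ContinuousAt Y z := fun z hz => by
    obtain ⟨a, l, hj, -⟩ := hY z hz
    exact hj.continuousAt
  obtain ⟨K, hK⟩ : ∃ K, ∀ z ∈ Metric.closedBall (0 : ℂ) ρ, ‖A * Y z * ‖f z‖ ^ 2‖ ≤ K := by
    refine (isCompact_closedBall (0 : ℂ) ρ).exists_bound_of_continuousOn fun z hz => ?_
    have hzD : z ∈ unitDisc := (mem_closedBall_zero_iff.1 hz).trans_lt hρ
    have h2 : ContinuousAt f z := hf.continuousOn.continuousAt (isOpen_unitDisc.mem_nhds hzD)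
    exact ((continuousAt_const.mul (hYc z hzD)).mul (h2.norm.pow 2)).continuousWithinAt
  let X : ℂ → ℝ := fun z => Y z - κ * Z z - |K| * ‖z‖ ^ 2
  have hX : ∀ z ∈ unitDisc, ∃ a l, HasJet X z a l ∧ l ≤ 0 := by
    intro z hz
    obtain ⟨a, l, hj, hl⟩ := hY z hz
    obtain ⟨a', l', hj', hl'⟩ := hZ z hz
    refine ⟨_, _, (hj.sub (hj'.const_mul κ)).sub ((hasJet_id_sq z).const_mul |K|), ?_⟩
    have h0 : 0 ≤ κ * (N * Z z * ‖f z‖ ^ 2) := by positivity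
    have h1 := mul_le_mul_of_nonneg_left hl' hκ0.le
    rcases le_or_gt ‖z‖ ρ with hzρ | hzρ
    · have h2 := (le_abs_self _).trans (hK z (mem_closedBall_zero_iff.2 hzρ))
      linarith [le_abs_self K]
    · have h2 : Real.exp (-1) * Y z ≤ Z z := by
        rw [← Real.exp_add]
        refine Real.exp_le_exp.2 ?_
        have h3 := mul_le_mul_of_nonneg_left (hρB z hz hzρ) hN0.le
        rw [mul_inv_cancel₀ hN0.ne'] at h3
        nlinarith [mul_le_mul_of_nonneg_left (hGh z hz).2.2 hq.le]
      have h3 : A * Y z * ‖f z‖ ^ 2 ≤ κ * (N * Z z * ‖f z‖ ^ 2) := by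
        rw [← hκN]
        have := mul_le_mul_of_nonneg_left h2 (by positivity : 0 ≤ κ * N * ‖f z‖ ^ 2)
        linarith
      linarith [abs_nonneg K]
  have hXW : ∀ z ∈ unitDisc, κ * Real.exp (-q * (h z).re) - |K| ≤ X z := by
    intro z hz
    have h1 : 2 * κ * Real.exp (-q * (h z).re) ≤ Y z := by
      rw [hκ, mul_div_cancel₀ _ two_ne_zero, ← Real.exp_add]
      refine Real.exp_le_exp.2 ?_
      nlinarith [mul_le_mul_of_nonneg_left (hGh z hz).2.1 hq.le]
    have h2 : Z z ≤ Real.exp (-q * (h z).re) := by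
      refine Real.exp_le_exp.2 ?_
      nlinarith [mul_nonneg hN0.le (hB z hz).1]
    have h3 : ‖z‖ ^ 2 ≤ 1 := by
      rw [mem_unitDisc] at hz
      nlinarith [norm_nonneg z]
    have h4 := mul_le_mul_of_nonneg_left h2 hκ0.le
    have h5 := mul_le_mul_of_nonneg_left h3 (abs_nonneg K)
    change _ ≤ Y z - κ * Z z - |K| * ‖z‖ ^ 2
    linarith
  refine ⟨2 * Real.pi * ((X 0 + |K|) / κ), fun r h0 h1 => ?_⟩
  have hrz : ∀ z ∈ Metric.closedBall (0 : ℂ) 1, (r : ℂ) * z ∈ unitDisc := fun z hz => by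
    rw [mem_closedBall_zero_iff] at hz
    rw [mem_unitDisc, norm_mul, Complex.norm_real, Real.norm_of_nonneg h0.le]
    nlinarith
  have hXc : ContinuousOn (fun z => X (r * z)) (Metric.closedBall 0 1) := fun z hz => by
    obtain ⟨a, l, hj, -⟩ := hX _ (hrz z hz)
    exact (hj.dilate r).continuousAt.continuousWithinAt
  have hP := isProbabilityMeasure_pm zero_mem_unitDisc
  have h2 : ∫ θ, X (r * circlePt θ) ∂pm 0 ≤ X 0 := by
    have := poisson_le_of_superharmonic hXc (fun z hz => ?_) zero_mem_unitDisc
    · simpa using this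
    · obtain ⟨a, l, hj, hl⟩ := hX _ (hrz z (mem_closedBall_zero_iff.2 (mem_unitDisc.1 hz).le))
      exact ⟨_, _, hj.dilate r, mul_nonpos_of_nonneg_of_nonpos (sq_nonneg r) hl⟩
  have hWc : Continuous fun θ => Real.exp (-q * (h (r * circlePt θ)).re) :=
    Real.continuous_exp.comp (continuous_const.mul (Complex.continuous_re.comp
      (continuous_dilate_circlePt hh.continuousOn h0.le h1)))
  have hXcc : Continuous fun θ => X (r * circlePt θ) :=
    hXc.comp_continuous continuous_circlePt fun θ => by simp
  have hWi := integrable_pm zero_mem_unitDisc hWc.integrable_angM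
  have h3 : ∫ θ, (κ * Real.exp (-q * (h (r * circlePt θ)).re) - |K|) ∂pm 0 ≤ X 0 :=
    (integral_mono ((hWi.const_mul κ).sub (integrable_const _))
      (integrable_pm zero_mem_unitDisc hXcc.integrable_angM)
      fun θ => hXW _ (smul_circlePt_mem h0.le h1 θ)).trans h2
  rw [integral_sub (hWi.const_mul κ) (integrable_const _), integral_const_mul, integral_const,
    probReal_univ, one_smul, integral_pm_zero, smul_eq_mul] at h3
  have h4 : κ * ((2 * Real.pi)⁻¹ * ∫ θ, Real.exp (-q * (h (r * circlePt θ)).re) ∂angM) ≤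
      X 0 + |K| := by linarith
  rw [mul_comm, ← le_div_iff₀ hκ0] at h4
  rwa [← inv_mul_le_iff₀ (by positivity)]

theorem integral_norm_dilate_sub_le {G : ℂ → ℂ} {B : ℂ → ℝ} {C : ℝ}
    (hG : DifferentiableOn ℂ G unitDisc) (hB : ∀ z ∈ unitDisc, 0 ≤ B z ∧ B z ≤ C)
    (hBj : ∀ z ∈ unitDisc, ∃ a l, HasJet B z a l ∧ l ≤ -‖deriv G z‖ ^ 2) {s : ℝ} (h0 : 0 < s)
    (h1 : s < 1) {z : ℂ} (hz : z ∈ unitDisc) :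
    ∫ θ, ‖G (s * circlePt θ) - G (s * z)‖ ∂pm z ≤ √(B (s * z)) := by
  have hP := isProbabilityMeasure_pm hz
  have hsz : ∀ z ∈ Metric.closedBall (0 : ℂ) 1, (s : ℂ) * z ∈ unitDisc := fun z hz => by
    rw [mem_closedBall_zero_iff] at hz
    rw [mem_unitDisc, norm_mul, Complex.norm_real, Real.norm_of_nonneg h0.le]
    nlinarith
  have hj : ∀ z ∈ unitDisc, ∃ a l, HasJet (fun w => B w + ‖G w‖ ^ 2) z a l ∧ l ≤ 0 := by
    intro z hz
    obtain ⟨a, l, hj, hl⟩ := hBj z hz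
    exact ⟨_, _, hj.add (hasJet_norm_sq (hG.analyticAt (isOpen_unitDisc.mem_nhds hz))), by linarith⟩
  have hXc : ContinuousOn (fun z => B (s * z) + ‖G (s * z)‖ ^ 2) (Metric.closedBall 0 1) :=
    fun z hz => by
      obtain ⟨a, l, hj, -⟩ := hj _ (hsz z hz)
      exact (hj.dilate s).continuousAt.continuousWithinAt
  have h2 := poisson_le_of_superharmonic hXc (fun z hz => by
    obtain ⟨a, l, hj, hl⟩ := hj _ (hsz z (mem_closedBall_zero_iff.2 (mem_unitDisc.1 hz).le))
    exact ⟨_, _, hj.dilate s, mul_nonpos_of_nonneg_of_nonpos (sq_nonneg s) hl⟩) hz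
  have hGc := continuous_dilate_circlePt hG.continuousOn h0.le h1
  have h3 : ∫ θ, ‖G (s * circlePt θ)‖ ^ 2 ∂pm z ≤ B (s * z) + ‖G (s * z)‖ ^ 2 := by
    refine (integral_mono (integrable_pm hz (hGc.norm.pow 2).integrable_angM) (integrable_pm hz
      (hXc.comp_continuous continuous_circlePt fun θ => by simp).integrable_angM)
      fun θ => ?_).trans h2
    exact le_add_of_nonneg_left (hB _ (smul_circlePt_mem h0.le h1 θ)).1
  have hmean : ∫ θ, G (s * circlePt θ) ∂pm z = G (s * z) :=
    poisson_formula (diffContOnCl_dilate hG h0.le h1) hz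
  have h4 := integral_norm_sub_integral_sq (memLp_two_of_continuous hGc hz)
  rw [hmean] at h4
  have hc : Continuous fun θ => ‖G (s * circlePt θ) - G (s * z)‖ :=
    (hGc.sub continuous_const).norm
  have h5 := integral_norm_sub_integral_sq (memLp_two_of_continuous hc hz)
  have h6 : 0 ≤ ∫ x, ‖‖G (s * circlePt x) - G (s * z)‖ -
      ∫ y, ‖G (s * circlePt y) - G (s * z)‖ ∂pm z‖ ^ 2 ∂pm z :=
    integral_nonneg fun _ => sq_nonneg _
  rw [h5] at h6
  simp only [Real.norm_eq_abs, sq_abs] at h6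
  refine Real.le_sqrt_of_sq_le ?_
  linarith

theorem exists_integral_norm_dilate_sub_dilate_le {G : ℂ → ℂ} {B : ℂ → ℝ} {C : ℝ}
    (hG : DifferentiableOn ℂ G unitDisc) (hB : ∀ z ∈ unitDisc, 0 ≤ B z ∧ B z ≤ C)
    (hBj : ∀ z ∈ unitDisc, ∃ a l, HasJet B z a l ∧ l ≤ -‖deriv G z‖ ^ 2)
    (hB0 : ∀ ε : ℝ, 0 < ε → ∃ ρ < 1, ∀ z ∈ unitDisc, ρ < ‖z‖ → B z ≤ ε) {ε : ℝ} (hε : 0 < ε) :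
    ∃ t < (1 : ℝ), ∀ s, t < s → s < 1 → ∀ s', t < s' → s' < 1 →
      ∫ θ, ‖G (s * circlePt θ) - G (s' * circlePt θ)‖ ∂angM ≤ ε := by
  set e := ε / (3 * (angM.real univ + 1)) with he
  have he0 : 0 < e := by positivity
  obtain ⟨ρ, hρ, hρB⟩ := hB0 (e ^ 2) (by positivity)
  obtain ⟨r, hr, hr1⟩ := exists_between (max_lt hρ one_pos)
  have hρr : ρ < r := (le_max_left _ _).trans_lt hr
  have hr0 : 0 < r := (le_max_right _ _).trans_lt hr
  have hsub : Metric.closedBall (0 : ℂ) r ⊆ unitDisc := fun z hz =>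
    (mem_closedBall_zero_iff.1 hz).trans_lt hr1
  obtain ⟨δ, hδ, hGδ⟩ := Metric.uniformContinuousOn_iff.1
    ((isCompact_closedBall (0 : ℂ) r).uniformContinuousOn_of_continuous
      (hG.continuousOn.mono hsub)) e he0
  have hρr1 : ρ / r < 1 := (div_lt_one hr0).2 hρr
  refine ⟨max (max (ρ / r) 0) (1 - δ), max_lt (max_lt hρr1 one_pos) (by linarith),
    fun s hs hs1 s' hs' hs1' => ?_⟩
  simp only [max_lt_iff] at hs hs'
  have hcirc : ∀ ζ, (r : ℂ) * circlePt ζ ∈ unitDisc := smul_circlePt_mem hr0.le hr1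
  have key : ∀ s, ρ / r < s → 0 < s → s < 1 → ∀ ζ,
      ∫ ξ, ‖G (s * circlePt ξ) - G (s * (r * circlePt ζ))‖ ∂pm (r * circlePt ζ) ≤ e := by
    intro s hs h0 h1 ζ
    refine (integral_norm_dilate_sub_le hG hB hBj h0 h1 (hcirc ζ)).trans ?_
    rw [← Real.sqrt_sq he0.le]
    refine Real.sqrt_le_sqrt (hρB _ (smul_mem_unitDisc h0.le h1.le (hcirc ζ)) ?_)
    rw [norm_mul, norm_mul, norm_circlePt, Complex.norm_real, Complex.norm_real,
      Real.norm_of_nonneg h0.le, Real.norm_of_nonneg hr0.le, mul_one]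
    exact (div_lt_iff₀ hr0).1 hs
  have hc : Continuous fun θ => G (s * circlePt θ) :=
    continuous_dilate_circlePt hG.continuousOn hs.1.2.le hs1
  have hc' : Continuous fun θ => G (s' * circlePt θ) :=
    continuous_dilate_circlePt hG.continuousOn hs'.1.2.le hs1'
  have hin : ∀ ζ, ∫ ξ, ‖G (s * circlePt ξ) - G (s' * circlePt ξ)‖ ∂pm (r * circlePt ζ) ≤ 3 * e := by
    intro ζ
    have hP := isProbabilityMeasure_pm (hcirc ζ)
    set w := (r : ℂ) * circlePt ζ with hw
    have hwr : ‖w‖ = r := norm_smul_circlePt hr0.le ζ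
    have hmem : ∀ s : ℝ, 0 < s → s < 1 → (s : ℂ) * w ∈ Metric.closedBall (0 : ℂ) r := by
      intro s h0 h1
      rw [mem_closedBall_zero_iff, norm_mul, Complex.norm_real, Real.norm_of_nonneg h0.le, hwr]
      nlinarith
    have h3 : ‖G (s * w) - G (s' * w)‖ ≤ e := by
      rw [← dist_eq_norm]
      refine (hGδ _ (hmem s hs.1.2 hs1) _ (hmem s' hs'.1.2 hs1') ?_).le
      rw [dist_eq_norm, ← sub_mul, norm_mul, hwr, ← Complex.ofReal_sub, Complex.norm_real,
        Real.norm_eq_abs]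
      have : |s - s'| < δ := abs_lt.2 ⟨by linarith [hs.2], by linarith [hs'.2]⟩
      nlinarith [abs_nonneg (s - s')]
    have hi : Integrable (fun ξ => ‖G (s * circlePt ξ) - G (s * w)‖) (pm w) :=
      integrable_pm (hcirc ζ) (hc.sub continuous_const).norm.integrable_angM
    have hi' : Integrable (fun ξ => ‖G (s' * circlePt ξ) - G (s' * w)‖) (pm w) :=
      integrable_pm (hcirc ζ) (hc'.sub continuous_const).norm.integrable_angM
    have hii : Integrable (fun ξ => ‖G (s * circlePt ξ) - G (s * w)‖ +
      ‖G (s' * circlePt ξ) - G (s' * w)‖) (pm w) := hi.add hi'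
    have h4 : ∫ ξ, ‖G (s * circlePt ξ) - G (s' * circlePt ξ)‖ ∂pm w ≤
        ∫ ξ, ((‖G (s * circlePt ξ) - G (s * w)‖ + ‖G (s' * circlePt ξ) - G (s' * w)‖) + e)
          ∂pm w := by
      refine integral_mono (integrable_pm (hcirc ζ) (hc.sub hc').norm.integrable_angM)
        (hii.add (integrable_const _)) fun ξ => ?_
      have h5 : G (s * circlePt ξ) - G (s' * circlePt ξ) = (G (s * circlePt ξ) - G (s * w)) -
        (G (s' * circlePt ξ) - G (s' * w)) + (G (s * w) - G (s' * w)) := by ring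
      change ‖G (s * circlePt ξ) - G (s' * circlePt ξ)‖ ≤ _
      rw [h5]
      exact (norm_add_le _ _).trans (add_le_add (norm_sub_le _ _) h3)
    rw [integral_add hii (integrable_const _), integral_add hi hi', integral_const,
      probReal_univ, one_smul] at h4
    linarith [key s hs.1.1 hs.1.2 hs1 ζ, key s' hs'.1.1 hs'.1.2 hs1' ζ]
  have h6 := norm_integral_le_of_norm_le_const (μ := angM) (C := 3 * e)
    (f := fun ζ => ∫ ξ, ‖G (s * circlePt ξ) - G (s' * circlePt ξ)‖ ∂pm (r * circlePt ζ))
    (Eventually.of_forall fun ζ => by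
      rw [Real.norm_of_nonneg (integral_nonneg fun _ => norm_nonneg _)]
      exact hin ζ)
  have hcc : Continuous fun θ => ‖G (s * circlePt θ) - G (s' * circlePt θ)‖ := (hc.sub hc').norm
  rw [integral_angM_semigroup hr0.le hr1 hcc.integrable_angM] at h6
  refine (le_abs_self _).trans (h6.trans ?_)
  rw [he]
  have h7 : 0 ≤ angM.real univ := measureReal_nonneg
  rw [show 3 * (ε / (3 * (angM.real univ + 1))) * angM.real univ =
    ε * (angM.real univ / (angM.real univ + 1)) by field_simp]
  exact mul_le_of_le_one_right hε.le ((div_le_one (by positivity)).2 (by linarith))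

theorem ae_exists_radial_limit {G : ℂ → ℂ} {B : ℂ → ℝ} {C : ℝ}
    (hG : DifferentiableOn ℂ G unitDisc) (hG1 : ∀ z ∈ unitDisc, ‖G z‖ ≤ 1)
    (hB : ∀ z ∈ unitDisc, 0 ≤ B z ∧ B z ≤ C)
    (hBj : ∀ z ∈ unitDisc, ∃ a l, HasJet B z a l ∧ l ≤ -‖deriv G z‖ ^ 2)
    (hB0 : ∀ ε : ℝ, 0 < ε → ∃ ρ < 1, ∀ z ∈ unitDisc, ρ < ‖z‖ → B z ≤ ε) :
    ∀ᵐ θ ∂angM, ∃ l, Tendsto (fun r : ℝ => G (r * circlePt θ)) (𝓝[<] 1) (𝓝 l) := by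
  let u : ℕ → ℝ := fun n => 1 - 1 / ((n : ℝ) + 2)
  have hu : ∀ n, 0 < u n ∧ u n < 1 := one_sub_inv_mem
  have hul : Tendsto u atTop (𝓝[<] 1) := tendsto_one_sub_inv
  have hGc : ∀ n, Continuous fun θ => G (u n * circlePt θ) := fun n =>
    continuous_dilate_circlePt hG.continuousOn (hu n).1.le (hu n).2
  obtain ⟨φ, hφ, hφc⟩ : ∃ φ : ℕ → ℕ, StrictMono φ ∧ ∀ N, ∀ i ≥ φ N, ∀ j ≥ φ N,
      ∫ θ, ‖G (u i * circlePt θ) - G (u j * circlePt θ)‖ ∂angM ≤ (1 / 2) ^ (N + 1) := by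
    refine extraction_forall_of_eventually' (P := fun N n => ∀ i ≥ n, ∀ j ≥ n,
      ∫ θ, ‖G (u i * circlePt θ) - G (u j * circlePt θ)‖ ∂angM ≤ (1 / 2) ^ (N + 1)) fun N => ?_
    obtain ⟨t, ht, hts⟩ := exists_integral_norm_dilate_sub_dilate_le hG hB hBj hB0
      (ε := (1 / 2) ^ (N + 1)) (by positivity)
    have hev : ∀ᶠ n in atTop, t < u n :=
      (tendsto_nhdsWithin_iff.1 hul).1.eventually (lt_mem_nhds ht)
    obtain ⟨k, hk⟩ := eventually_atTop.1 hev
    exact ⟨k, fun m hm i hi j hj => hts _ (hk i (hm.trans hi)) (hu i).2 _ (hk j (hm.trans hj))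
      (hu j).2⟩
  have hae : ∀ᵐ θ ∂angM, ∃ l, Tendsto (fun n => G (u (φ n) * circlePt θ)) atTop (𝓝 l) := by
    refine Lp.ae_tendsto_of_cauchy_eLpNorm (p := 1) (f := fun n θ => G (u (φ n) * circlePt θ))
      (fun n => (hGc _).aestronglyMeasurable) le_rfl
      (B := fun N => ENNReal.ofReal ((1 / 2) ^ N)) ?_ fun N n m hn hm => ?_
    · rw [← ENNReal.ofReal_tsum_of_nonneg (fun _ => by positivity) summable_geometric_two]
      exact ENNReal.ofReal_ne_top
    · rw [eLpNorm_one_eq_lintegral_enorm]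
      have hi : Integrable ((fun θ => G (u (φ n) * circlePt θ)) -
          fun θ => G (u (φ m) * circlePt θ)) angM := ((hGc _).sub (hGc _)).integrable_angM
      rw [← ofReal_integral_norm_eq_lintegral_enorm hi]
      refine (ENNReal.ofReal_lt_ofReal_iff (by positivity)).2 ?_
      refine (hφc N _ (hφ.monotone hn) _ (hφ.monotone hm)).trans_lt ?_
      rw [pow_succ]
      have : (0 : ℝ) < (1 / 2) ^ N := by positivity
      linarith
  have hch : ∀ θ, ∃ l, (∃ l, Tendsto (fun n => G (u (φ n) * circlePt θ)) atTop (𝓝 l)) →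
      Tendsto (fun n => G (u (φ n) * circlePt θ)) atTop (𝓝 l) := fun θ => by
    by_cases h : ∃ l, Tendsto (fun n => G (u (φ n) * circlePt θ)) atTop (𝓝 l)
    · exact ⟨h.choose, fun _ => h.choose_spec⟩
    · exact ⟨0, fun h' => absurd h' h⟩
  choose g hg using hch
  have hglim : ∀ᵐ θ ∂angM, Tendsto (fun n => G (u (φ n) * circlePt θ)) atTop (𝓝 (g θ)) :=
    hae.mono hg
  have hL2 : ∀ n, ∀ z ∈ unitDisc, ∫ θ, ‖G (u (φ n) * circlePt θ)‖ ^ 2 ∂pm z ≤ 1 := by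
    intro n z hz
    have hP := isProbabilityMeasure_pm hz
    refine (integral_mono (integrable_pm hz ((hGc _).norm.pow 2).integrable_angM)
      (integrable_const 1) fun θ => ?_).trans (by simp)
    exact pow_le_one₀ (norm_nonneg _) (hG1 _ (smul_circlePt_mem (hu _).1.le (hu _).2 θ))
  have hP0 := isProbabilityMeasure_pm zero_mem_unitDisc
  have hgi : Integrable g angM := by
    have hmeas : AEStronglyMeasurable g angM :=
      aestronglyMeasurable_of_tendsto_ae atTop (fun n => (hGc (φ n)).aestronglyMeasurable) hglim
    refine Integrable.of_bound hmeas 1 (hglim.mono fun θ hθ => ?_)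
    exact le_of_tendsto' hθ.norm fun n => hG1 _ (smul_circlePt_mem (hu _).1.le (hu _).2 θ)
  have hrep : ∀ z ∈ unitDisc, ∫ θ, g θ ∂pm z = G z := by
    intro z hz
    have hP := isProbabilityMeasure_pm hz
    have h1 := tendsto_integral_of_sq_bounded (fun n => memLp_two_of_continuous (hGc (φ n)) hz)
      (fun n => hL2 n z hz) (ae_pm_of_ae hglim)
    have h2 : ∀ n, ∫ θ, G (u (φ n) * circlePt θ) ∂pm z = G (u (φ n) * z) := fun n =>
      poisson_formula (diffContOnCl_dilate hG (hu _).1.le (hu _).2) hz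
    simp_rw [h2] at h1
    exact tendsto_nhds_unique h1
      ((tendsto_dilate hG.continuousOn hz).comp (hul.comp hφ.tendsto_atTop))
  filter_upwards [ae_tendsto_integral_pm hgi] with θ hθ
  refine ⟨g θ, hθ.congr' ?_⟩
  filter_upwards [Ioo_mem_nhdsLT one_pos] with r hr
  exact hrep _ (smul_circlePt_mem hr.1.le hr.2 θ)

theorem exists_memQA {G : ℂ → ℂ} {B : ℂ → ℝ} {C : ℝ}
    (hG : DifferentiableOn ℂ G unitDisc) (hG1 : ∀ z ∈ unitDisc, ‖G z‖ ≤ 1)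
    (hB : ∀ z ∈ unitDisc, 0 ≤ B z ∧ B z ≤ C)
    (hBj : ∀ z ∈ unitDisc, ∃ a l, HasJet B z a l ∧ l ≤ -‖deriv G z‖ ^ 2)
    (hB0 : ∀ ε : ℝ, 0 < ε → ∃ ρ < 1, ∀ z ∈ unitDisc, ρ < ‖z‖ → B z ≤ ε) :
    ∃ Gb, MemQA G Gb := by
  have hch : ∀ ζ : ℂ, ∃ l : ℂ, (∃ l, Tendsto (fun r : ℝ => G (r * ζ)) (𝓝[<] 1) (𝓝 l)) →
      Tendsto (fun r : ℝ => G (r * ζ)) (𝓝[<] 1) (𝓝 l) := fun ζ => by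
    by_cases h : ∃ l, Tendsto (fun r : ℝ => G (r * ζ)) (𝓝[<] 1) (𝓝 l)
    · exact ⟨h.choose, fun _ => h.choose_spec⟩
    · exact ⟨0, fun h' => absurd h' h⟩
  choose b hb using hch
  set Gb : ℝ → ℂ := fun θ => b (circlePt θ) with hGb
  have hlim : HasRadialLimits G Gb :=
    (ae_exists_radial_limit hG hG1 hB hBj hB0).mono fun θ hθ => hb _ hθ
  let u : ℕ → ℝ := fun n => 1 - 1 / ((n : ℝ) + 2)
  have hu : ∀ n, 0 < u n ∧ u n < 1 := one_sub_inv_mem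
  have hul : Tendsto u atTop (𝓝[<] 1) := tendsto_one_sub_inv
  have hGc : ∀ n, Continuous fun θ => G (u n * circlePt θ) := fun n =>
    continuous_dilate_circlePt hG.continuousOn (hu n).1.le (hu n).2
  have hlimu : ∀ᵐ θ ∂angM, Tendsto (fun n => G (u n * circlePt θ)) atTop (𝓝 (Gb θ)) :=
    hlim.mono fun θ hθ => hθ.comp hul
  have hi : Integrable Gb angM := by
    have hmeas : AEStronglyMeasurable Gb angM :=
      aestronglyMeasurable_of_tendsto_ae atTop (fun n => (hGc n).aestronglyMeasurable) hlimu
    refine Integrable.of_bound hmeas 1 (hlimu.mono fun θ hθ => ?_)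
    exact le_of_tendsto' hθ.norm fun n => hG1 _ (smul_circlePt_mem (hu _).1.le (hu _).2 θ)
  have hper : ∀ θ, Gb (θ + 2 * Real.pi) = Gb θ := fun θ => by
    simp only [hGb, circlePt_add_two_pi]
  have hosc : ∀ z ∈ unitDisc, ∫ θ, ‖Gb θ - G z‖ ∂pm z ≤ √(B z) := by
    intro z hz
    have hP := isProbabilityMeasure_pm hz
    have hGz : Tendsto (fun n => G (u n * z)) atTop (𝓝 (G z)) :=
      (tendsto_dilate hG.continuousOn hz).comp hul
    have h1 : Tendsto (fun n => ∫ θ, ‖G (u n * circlePt θ) - G (u n * z)‖ ∂pm z) atTop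
        (𝓝 (∫ θ, ‖Gb θ - G z‖ ∂pm z)) := by
      refine tendsto_integral_of_dominated_convergence (fun _ => 2)
        (fun n => ((hGc n).sub continuous_const).norm.aestronglyMeasurable) (integrable_const _)
        (fun n => Eventually.of_forall fun θ => ?_) ?_
      · rw [norm_norm]
        refine (norm_sub_le _ _).trans ?_
        linarith [hG1 _ (smul_circlePt_mem (hu n).1.le (hu n).2 θ),
          hG1 _ (smul_mem_unitDisc (hu n).1.le (hu n).2.le hz)]
      · exact (ae_pm_of_ae hlimu).mono fun θ hθ => (hθ.sub hGz).norm
    have h2 : Tendsto (fun n => √(B (u n * z))) atTop (𝓝 √(B z)) := by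
      obtain ⟨a, l, hj, -⟩ := hBj z hz
      have h3 : Tendsto (fun n => (u n : ℂ) * z) atTop (𝓝 z) :=
        (tendsto_dilate (F := id) continuousOn_id hz).comp hul
      exact (hj.continuousAt.tendsto.comp h3).sqrt
    exact le_of_tendsto_of_tendsto' h1 h2 fun n =>
      integral_norm_dilate_sub_le hG hB hBj (hu n).1 (hu n).2 hz
  have hmean : ∀ θ₀ t : ℝ, 0 < t → t ≤ 1 →
      meanOsc Gb θ₀ t ≤ 50 * √(B ((1 - t : ℝ) * circlePt θ₀)) := by
    intro θ₀ t h0 h1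
    set w := ((1 - t : ℝ) : ℂ) * circlePt θ₀ with hw
    have hwD : w ∈ unitDisc := smul_circlePt_mem (by linarith) (by linarith) θ₀
    have h2 := meanOsc_le (Function.Periodic.locallyIntegrable_of_angM hper hi) (G w) θ₀ h0
    have h3 := arcMean_le_integral_pm (f := fun θ => ‖Gb θ - G w‖) (fun θ => by simp only [hper])
      (hi.sub continuous_const.integrable_angM).norm (fun _ => norm_nonneg _) h0 h1 θ₀
    rw [← hw] at h3
    linarith [hosc w hwD]
  refine ⟨Gb, ⟨hG, 1, hG1⟩, hlim, ⟨hper, hi, 50 * √C, fun θ₀ t h0 h1 => ?_⟩, fun ε hε => ?_⟩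
  · refine (hmean θ₀ t h0 h1).trans (mul_le_mul_of_nonneg_left (Real.sqrt_le_sqrt ?_) (by norm_num))
    exact (hB _ (smul_circlePt_mem (by linarith) (by linarith) θ₀)).2
  · obtain ⟨ρ, hρ, hρB⟩ := hB0 ((ε / 50) ^ 2) (by positivity)
    refine ⟨min (1 - ρ) 1, lt_min (by linarith) one_pos, fun θ₀ t h0 ht => ?_⟩
    obtain ⟨ht1, ht2⟩ := lt_min_iff.1 ht
    refine (hmean θ₀ t h0 ht2.le).trans ?_
    have h3 : √(B ((1 - t : ℝ) * circlePt θ₀)) ≤ ε / 50 := by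
      refine Real.sqrt_le_iff.2 ⟨by positivity, hρB _
        (smul_circlePt_mem (by linarith) (by linarith) θ₀) ?_⟩
      rw [norm_smul_circlePt (by linarith)]
      linarith
    linarith

theorem exists_integral_rpow_mul_exp_le {E h : ℂ → ℂ} (hE : DifferentiableOn ℂ E unitDisc)
    (hE0 : ∀ z ∈ unitDisc, E z ≠ 0) (hh : DifferentiableOn ℂ h unitDisc)
    (hEi : ∀ q : ℝ, 0 < q → ∃ M : ℝ, ∀ r : ℝ, 0 < r → r < 1 →
      ∫ θ, ‖E (r * circlePt θ)‖ ^ (-q) ∂angM ≤ M)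
    (hhi : ∀ q : ℝ, 0 < q → ∃ M : ℝ, ∀ r : ℝ, 0 < r → r < 1 →
      ∫ θ, Real.exp (-q * (h (r * circlePt θ)).re) ∂angM ≤ M) {q : ℝ} (hq : 0 < q) :
    ∃ M : ℝ, ∀ r : ℝ, 0 < r → r < 1 →
      ∫ θ, ‖(E (r * circlePt θ) * Complex.exp (h (r * circlePt θ)))⁻¹‖ ^ q ∂angM ≤ M := by
  obtain ⟨M₁, hM₁⟩ := hEi (2 * q) (by positivity)
  obtain ⟨M₂, hM₂⟩ := hhi (2 * q) (by positivity)
  refine ⟨(M₁ + M₂) / 2, fun r h0 h1 => ?_⟩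
  have hmem : ∀ θ, (r : ℂ) * circlePt θ ∈ unitDisc := smul_circlePt_mem h0.le h1
  have hEc : Continuous fun θ => E (r * circlePt θ) :=
    continuous_dilate_circlePt hE.continuousOn h0.le h1
  have hhc : Continuous fun θ => h (r * circlePt θ) :=
    continuous_dilate_circlePt hh.continuousOn h0.le h1
  have hn : ∀ θ, ‖E (r * circlePt θ)‖ ≠ 0 := fun θ => norm_ne_zero_iff.2 (hE0 _ (hmem θ))
  have hc₁ : Continuous fun θ => ‖E (r * circlePt θ)‖ ^ (-(2 * q)) :=
    hEc.norm.rpow_const fun θ => Or.inl (hn θ)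
  have hc₂ : Continuous fun θ => Real.exp (-(2 * q) * (h (r * circlePt θ)).re) := by
    have := Complex.continuous_re.comp hhc
    exact Real.continuous_exp.comp (continuous_const.mul this)
  have hc : Continuous fun θ =>
      ‖(E (r * circlePt θ) * Complex.exp (h (r * circlePt θ)))⁻¹‖ ^ q := by
    refine Continuous.rpow_const (Continuous.norm (Continuous.inv₀
      (hEc.mul (Complex.continuous_exp.comp hhc)) fun θ => ?_)) fun θ => Or.inr hq.le
    exact mul_ne_zero (hE0 _ (hmem θ)) (Complex.exp_ne_zero _)
  have hi : Integrable (fun θ => (‖E (r * circlePt θ)‖ ^ (-(2 * q)) +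
      Real.exp (-(2 * q) * (h (r * circlePt θ)).re)) / 2) angM :=
    (hc₁.integrable_angM.add hc₂.integrable_angM).div_const 2
  have h3 := integral_mono hc.integrable_angM hi fun θ => by
    change ‖(E (r * circlePt θ) * Complex.exp (h (r * circlePt θ)))⁻¹‖ ^ q ≤
      (‖E (r * circlePt θ)‖ ^ (-(2 * q)) + Real.exp (-(2 * q) * (h (r * circlePt θ)).re)) / 2
    have e1 : ‖E (r * circlePt θ)‖ ^ (-(2 * q)) = (‖E (r * circlePt θ)‖ ^ (-q)) ^ 2 := by
      rw [← Real.rpow_natCast, ← Real.rpow_mul (norm_nonneg _)]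
      congr 1
      push_cast
      ring
    have e2 : Real.exp (-(2 * q) * (h (r * circlePt θ)).re) =
        Real.exp (-q * (h (r * circlePt θ)).re) ^ 2 := by
      rw [← Real.exp_nat_mul]
      congr 1
      push_cast
      ring
    have e3 : ‖(E (r * circlePt θ) * Complex.exp (h (r * circlePt θ)))⁻¹‖ ^ q =
        ‖E (r * circlePt θ)‖ ^ (-q) * Real.exp (-q * (h (r * circlePt θ)).re) := by
      rw [norm_inv, norm_mul, Complex.norm_exp, Real.inv_rpow (by positivity),
        ← Real.rpow_neg (by positivity), Real.mul_rpow (norm_nonneg _) (Real.exp_pos _).le,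
        ← Real.exp_mul, mul_comm _ (-q)]
    rw [e1, e2, e3]
    linarith [two_mul_le_add_sq (‖E (r * circlePt θ)‖ ^ (-q))
      (Real.exp (-q * (h (r * circlePt θ)).re))]
  rw [integral_div, integral_add hc₁.integrable_angM hc₂.integrable_angM] at h3
  linarith [hM₁ r h0 h1, hM₂ r h0 h1]

/-- Corollary 4.2: for every `F ∈ BMOA` there are `G ∈ QA` and an analytic `H` on
the disc with `H ∈ ℍ^q` for every `0 < q < ∞` and `1/H ∈ ℍ^∞`, such that
`F' = G' H`. -/
theorem stmt_13 (F : ℂ → ℂ) (Fb : ℝ → ℂ) (hF : MemBMOA F Fb) :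
    ∃ (G : ℂ → ℂ) (Gb : ℝ → ℂ) (H : ℂ → ℂ),
      MemQA G Gb ∧ DifferentiableOn ℂ H unitDisc ∧
      (∀ q : ℝ, 0 < q → MemHardy q H) ∧
      (∀ z ∈ unitDisc, H z ≠ 0) ∧
      MemHinf (fun z => (H z)⁻¹) ∧
      ∀ z ∈ unitDisc, deriv F z = deriv G z * H z := by
  obtain ⟨E, B, C, hE, hE01, hEi, hB, hBj, hB0⟩ := hF.exists_multiplier
  have hf : DifferentiableOn ℂ (fun z => deriv F z * E z) unitDisc :=
    (hF.1.1.deriv isOpen_unitDisc).mul hE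
  obtain ⟨h, G, hh, hG, hGh⟩ := exists_log_solution hf hB hBj
  have hre : ∀ z ∈ unitDisc, (h z).re ≤ 0 := fun z hz =>
    (hGh z hz).2.2.trans (Real.log_nonpos (by nlinarith [(hGh z hz).1, norm_nonneg (G z)])
      (by nlinarith [sq_nonneg ‖G z‖]))
  have hexp : ∀ z ∈ unitDisc, ‖Complex.exp (h z)‖ ≤ 1 := fun z hz => by
    rw [Complex.norm_exp]
    exact Real.exp_le_one_iff.2 (hre z hz)
  have hGd : DifferentiableOn ℂ G unitDisc := fun z hz =>
    (hG z hz).differentiableAt.differentiableWithinAt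
  obtain ⟨Gb, hGb⟩ := exists_memQA hGd (fun z hz => (hGh z hz).1.le) hB (fun z hz => by
    obtain ⟨a, l, hj, hl⟩ := hBj z hz
    refine ⟨a, l, hj, hl.trans (neg_le_neg (pow_le_pow_left₀ (norm_nonneg _) ?_ 2))⟩
    rw [(hG z hz).deriv, norm_mul]
    exact mul_le_of_le_one_right (norm_nonneg _) (hexp z hz)) hB0
  have hK : DifferentiableOn ℂ (fun z => E z * Complex.exp (h z)) unitDisc := hE.mul hh.cexp
  have hK0 : ∀ z ∈ unitDisc, E z * Complex.exp (h z) ≠ 0 := fun z hz =>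
    mul_ne_zero (hE01 z hz).1 (Complex.exp_ne_zero _)
  have hH : DifferentiableOn ℂ (fun z => (E z * Complex.exp (h z))⁻¹) unitDisc := hK.fun_inv hK0
  refine ⟨G, Gb, fun z => (E z * Complex.exp (h z))⁻¹, hGb, hH, fun q hq => ⟨hH, ?_⟩,
    fun z hz => inv_ne_zero (hK0 z hz), ?_, fun z hz => ?_⟩
  · exact exists_integral_rpow_mul_exp_le hE (fun z hz => (hE01 z hz).1) hh hEi
      (fun q hq => exists_integral_exp_neg_le hf hB hBj hB0 hh hG hGh hq) hq
  · simp only [inv_inv]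
    refine ⟨hK, 1, fun z hz => ?_⟩
    rw [norm_mul]
    exact mul_le_one₀ (hE01 z hz).2 (norm_nonneg _) (hexp z hz)
  · rw [(hG z hz).deriv]
    field_simp [(hE01 z hz).1, Complex.exp_ne_zero (h z)]

end
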